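/- arXiv:2604.13802 — 4 statements merged into one kernel-verified Lean document; each statement's English description precedes it below -/
import Mathlib

section
/- Let (X, λ) be a standard Borel space with an atomless σ-finite measure satisfying λ(X) = ∞, and let T₁, T₂ ∈ Aut(X, λ) be conservative and aperiodic. Then T₁ and T₂ are λ-approximately conjugate: for every ε > 0 there exists S ∈ Aut(X, λ) such that λ({x ∈ X : S T₁ S⁻¹(x) ≠ T₂(x)}) < ε. -/
open MeasureTheory Set
open scoped ENNReal

variable {X : Type*}

/-- `T` is aperiodic: almost every point has `T^[n] x ≠ x` for all `n ≥ 1`. -/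
def Aperiodic [MeasurableSpace X] (lam : Measure X) (T : X ≃ᵐ X) : Prop :=
  ∀ᵐ x ∂lam, ∀ n : ℕ, 1 ≤ n → (⇑T)^[n] x ≠ x

/-- `T` is conservative: every positive measure Borel set has almost all of its points
returning to it under some positive iterate of `T`. -/
def Conserv [MeasurableSpace X] (lam : Measure X) (T : X ≃ᵐ X) : Prop :=
  ∀ A : Set X, MeasurableSet A → 0 < lam A →
    ∀ᵐ x ∂lam, x ∈ A → ∃ n : ℕ, 1 ≤ n ∧ (⇑T)^[n] x ∈ A

open Filter Topology

structure IsoD {X Y : Type*} [MeasurableSpace X] [MeasurableSpace Y] (μ : Measure X)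
    (ν : Measure Y) (f : X → Y) (g : Y → X) (U : Set X) (V : Set Y) : Prop where
  mf : Measurable f
  mg : Measurable g
  mU : MeasurableSet U
  mV : MeasurableSet V
  mt : ∀ x ∈ U, f x ∈ V
  mt2 : ∀ y ∈ V, g y ∈ U
  li : ∀ x ∈ U, g (f x) = x
  ri : ∀ y ∈ V, f (g y) = y
  pres : ∀ E, MeasurableSet E → μ (U ∩ f ⁻¹' E) = ν (V ∩ E)

namespace IsoD

variable {X Y Z : Type*} [MeasurableSpace X] [MeasurableSpace Y] [MeasurableSpace Z]
  {μ : Measure X} {ν : Measure Y} {ρ : Measure Z}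

theorem symm {f : X → Y} {g : Y → X} {U : Set X} {V : Set Y} (h : IsoD μ ν f g U V) :
    IsoD ν μ g f V U where
  mf := h.mg
  mg := h.mf
  mU := h.mV
  mV := h.mU
  mt := h.mt2
  mt2 := h.mt
  li := h.ri
  ri := h.li
  pres := by
    intro E hE
    rw [← h.pres _ (h.mg hE)]
    congr 1
    ext x
    simp only [mem_inter_iff, mem_preimage]
    constructor
    · rintro ⟨hx, hx2⟩
      rw [h.li x hx] at hx2
      exact ⟨hx, hx2⟩
    · rintro ⟨hx, hx2⟩
      rw [h.li x hx]
      exact ⟨hx, hx2⟩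

theorem trans {f : X → Y} {g : Y → X} {U : Set X} {V : Set Y} {f2 : Y → Z} {g2 : Z → Y}
    {W : Set Z} (h : IsoD μ ν f g U V) (h2 : IsoD ν ρ f2 g2 V W) :
    IsoD μ ρ (f2 ∘ f) (g ∘ g2) U W where
  mf := h2.mf.comp h.mf
  mg := h.mg.comp h2.mg
  mU := h.mU
  mV := h2.mV
  mt := fun x hx => h2.mt _ (h.mt x hx)
  mt2 := fun x hx => h.mt2 _ (h2.mt2 x hx)
  li := fun x hx => by simp [h2.li _ (h.mt x hx), h.li x hx]
  ri := fun x hx => by simp [h.ri _ (h2.mt2 x hx), h2.ri x hx]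
  pres := by
    intro E hE
    rw [← h2.pres E hE, ← h.pres _ (h2.mf hE)]
    rfl

theorem restr {f : X → Y} {g : Y → X} {U : Set X} {V : Set Y} (h : IsoD μ ν f g U V)
    {D : Set X} (hD : MeasurableSet D) : IsoD μ ν f g (U ∩ D) (V ∩ g ⁻¹' D) where
  mf := h.mf
  mg := h.mg
  mU := h.mU.inter hD
  mV := h.mV.inter (h.mg hD)
  mt := fun x hx => ⟨h.mt x hx.1, by simpa [h.li x hx.1] using hx.2⟩
  mt2 := fun x hx => ⟨h.mt2 x hx.1, hx.2⟩
  li := fun x hx => h.li x hx.1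
  ri := fun x hx => h.ri x hx.1
  pres := by
    intro E hE
    rw [inter_assoc V, ← h.pres _ ((h.mg hD).inter hE)]
    congr 1
    ext x
    simp only [mem_inter_iff, mem_preimage]
    constructor
    · rintro ⟨⟨hx, hx2⟩, hx3⟩
      rw [h.li x hx]
      exact ⟨hx, hx2, hx3⟩
    · rintro ⟨hx, hx2, hx3⟩
      rw [h.li x hx] at hx2
      exact ⟨⟨hx, hx2⟩, hx3⟩

theorem glue {ι : Type*} [Countable ι] [Nonempty ι] {f : ι → X → Y} {g : ι → Y → X}
    {U : ι → Set X} {V : ι → Set Y} (h : ∀ i, IsoD μ ν (f i) (g i) (U i) (V i))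
    (hU : Pairwise (fun i j => Disjoint (U i) (U j)))
    (hV : Pairwise (fun i j => Disjoint (V i) (V j))) :
    ∃ F G, IsoD μ ν F G (⋃ i, U i) (⋃ i, V i) ∧ ∀ i, ∀ x ∈ U i, F x = f i x := by
  obtain ⟨F, mF, hF⟩ := exists_measurable_piecewise U (fun i => (h i).mU) f (fun i => (h i).mf)
    (fun i j hij x hx => absurd hx.2 (disjoint_left.1 (hU hij) hx.1))
  obtain ⟨G, mG, hG⟩ := exists_measurable_piecewise V (fun i => (h i).mV) g (fun i => (h i).mg)
    (fun i j hij x hx => absurd hx.2 (disjoint_left.1 (hV hij) hx.1))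
  refine ⟨F, G, ⟨mF, mG, MeasurableSet.iUnion fun i => (h i).mU,
    MeasurableSet.iUnion fun i => (h i).mV, ?_, ?_, ?_, ?_, ?_⟩, fun i x hx => hF i hx⟩
  · intro x hx
    obtain ⟨i, hi⟩ := mem_iUnion.1 hx
    rw [hF i hi]
    exact mem_iUnion.2 ⟨i, (h i).mt x hi⟩
  · intro x hx
    obtain ⟨i, hi⟩ := mem_iUnion.1 hx
    rw [hG i hi]
    exact mem_iUnion.2 ⟨i, (h i).mt2 x hi⟩
  · intro x hx
    obtain ⟨i, hi⟩ := mem_iUnion.1 hx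
    rw [hF i hi, hG i ((h i).mt x hi), (h i).li x hi]
  · intro x hx
    obtain ⟨i, hi⟩ := mem_iUnion.1 hx
    rw [hG i hi, hF i ((h i).mt2 x hi), (h i).ri x hi]
  · intro E hE
    rw [iUnion_inter, iUnion_inter, measure_iUnion, measure_iUnion]
    · congr 1
      ext i
      rw [← (h i).pres E hE]
      congr 1
      ext x
      simp only [mem_inter_iff, mem_preimage]
      exact and_congr_right fun hx => by rw [hF i hx]
    · exact fun i j hij => (hV hij).mono inter_subset_left inter_subset_left
    · exact fun i => (h i).mV.inter hE
    · exact fun i j hij => (hU hij).mono inter_subset_left inter_subset_left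
    · exact fun i => (h i).mU.inter (mF hE)

end IsoD

/-- distribution function of a finite atomless measure on the line -/
theorem cdf_map (ν : Measure ℝ) [IsFiniteMeasure ν] [NullSingletonClass ν] :
    ∃ F : ℝ → ℝ, Monotone F ∧
      Measure.map F ν = volume.restrict (Ioo 0 (ν univ).toReal) := by
  set a := (ν univ).toReal with ha
  set F : ℝ → ℝ := fun t => (ν (Iic t)).toReal with hF
  have hmono : Monotone F := fun s t hst =>
    ENNReal.toReal_mono (measure_ne_top _ _) (measure_mono (Iic_subset_Iic.2 hst))
  have hof : ∀ t, ENNReal.ofReal (F t) = ν (Iic t) := fun t =>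
    ENNReal.ofReal_toReal (measure_ne_top _ _)
  have hle : ∀ t, F t ≤ a := fun t =>
    ENNReal.toReal_mono (measure_ne_top _ _) (measure_mono (subset_univ _))
  have hge : ∀ t, 0 ≤ F t := fun t => ENNReal.toReal_nonneg
  have hbot : Tendsto F atBot (𝓝 0) := by
    have h1 : Tendsto (ν ∘ Iic) atBot (𝓝 (ν (⋂ t : ℝ, Iic t))) :=
      tendsto_measure_iInter_atBot (fun i => measurableSet_Iic.nullMeasurableSet)
        (fun s t hst => Iic_subset_Iic.2 hst) ⟨0, measure_ne_top _ _⟩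
    have h0 : (⋂ t : ℝ, Iic t) = ∅ := by
      ext y
      simp only [mem_iInter, mem_Iic, mem_empty_iff_false, iff_false]
      intro h
      have := h (y - 1)
      linarith
    rw [h0, measure_empty] at h1
    have h2 := (ENNReal.tendsto_toReal (by simp)).comp h1
    exact h2
  have htop : Tendsto F atTop (𝓝 a) := by
    have := tendsto_measure_Iic_atTop ν
    exact (ENNReal.tendsto_toReal (measure_ne_top _ _)).comp this
  have hcont : Continuous F := by
    have hd : ∀ s t, s ≤ t → F t - F s = (ν (Icc s t)).toReal := by
      intro s t hst
      have : ν (Iic t) = ν (Iic s) + ν (Icc s t) := by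
        rw [← measure_congr (Ioc_ae_eq_Icc (μ := ν) (a := s) (b := t)),
          ← measure_union _ measurableSet_Ioc, Iic_union_Ioc_eq_Iic hst]
        exact Set.disjoint_left.2 fun x hx hx2 => not_lt.2 hx hx2.1
      simp only [hF]
      rw [this, ENNReal.toReal_add (measure_ne_top _ _) (measure_ne_top _ _)]
      ring
    rw [continuous_iff_continuousAt]
    intro x
    rw [Metric.continuousAt_iff]
    intro ε hε
    have h1 : Tendsto (fun n : ℕ => ν (Icc (x - 1 / ((n:ℝ) + 1)) (x + 1 / ((n:ℝ) + 1)))) atTop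
        (𝓝 (ν (⋂ n : ℕ, Icc (x - 1 / ((n:ℝ) + 1)) (x + 1 / ((n:ℝ) + 1))))) := by
      refine tendsto_measure_iInter_atTop (fun n => measurableSet_Icc.nullMeasurableSet) ?_
        ⟨0, measure_ne_top _ _⟩
      intro n m hnm
      have : 1 / ((m:ℝ) + 1) ≤ 1 / ((n:ℝ) + 1) := by
        apply one_div_le_one_div_of_le (by positivity)
        have : (n:ℝ) ≤ m := by exact_mod_cast hnm
        linarith
      exact Icc_subset_Icc (by linarith) (by linarith)
    have h2 : (⋂ n : ℕ, Icc (x - 1 / ((n:ℝ) + 1)) (x + 1 / ((n:ℝ) + 1))) = {x} := by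
      ext y
      simp only [mem_iInter, mem_Icc, mem_singleton_iff]
      constructor
      · intro h
        have h3 := tendsto_one_div_add_atTop_nhds_zero_nat (𝕜 := ℝ)
        apply le_antisymm
        · have := ge_of_tendsto' (h3.const_add x) (fun n => (h n).2)
          simpa using this
        · have := le_of_tendsto' (h3.const_sub x) (fun n => (h n).1)
          simpa using this
      · rintro rfl n
        have : 0 ≤ 1 / ((n:ℝ) + 1) := by positivity
        constructor <;> linarith
    rw [h2, measure_singleton] at h1
    obtain ⟨n, hn⟩ := ((tendsto_order.1 h1).2 (ENNReal.ofReal ε) (by simpa using hε)).exists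
    refine ⟨1 / ((n:ℝ) + 1), by positivity, fun {y} hy => ?_⟩
    rw [Real.dist_eq] at hy ⊢
    have key : (ν (Icc (x - 1 / ((n:ℝ) + 1)) (x + 1 / ((n:ℝ) + 1)))).toReal < ε :=
      ENNReal.toReal_lt_of_lt_ofReal hn
    have hy' := abs_lt.1 hy
    have hm := hd (x - 1 / ((n:ℝ) + 1)) (x + 1 / ((n:ℝ) + 1)) (by linarith)
    have hx1 := hmono (show x ≤ x + 1 / ((n:ℝ) + 1) by linarith)
    have hx2 := hmono (show x - 1 / ((n:ℝ) + 1) ≤ x by linarith)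
    have hy1 := hmono (show y ≤ x + 1 / ((n:ℝ) + 1) by linarith)
    have hy2 := hmono (show x - 1 / ((n:ℝ) + 1) ≤ y by linarith)
    rw [abs_lt]
    constructor <;> linarith
  refine ⟨F, hmono, ?_⟩
  have key : ∀ s, 0 < s → s < a → ν (F ⁻¹' Iic s) = ENNReal.ofReal s := by
    intro s hs0 hsa
    obtain ⟨tl, htl⟩ := ((tendsto_order.1 hbot).2 s hs0).exists
    obtain ⟨tr, htr⟩ := ((tendsto_order.1 htop).1 s hsa).exists
    obtain ⟨t, ht⟩ : s ∈ range F := mem_range_of_exists_le_of_exists_ge hcont ⟨tl, htl.le⟩ ⟨tr, htr.le⟩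
    have hbd : BddAbove (F ⁻¹' Iic s) := ⟨tr, fun y hy => by
      by_contra hc
      exact absurd (hmono (not_le.1 hc).le) (not_le.2 (lt_of_le_of_lt hy htr))⟩
    have hcl : IsClosed (F ⁻¹' Iic s) := isClosed_Iic.preimage hcont
    have hmem := hcl.csSup_mem ⟨t, ht.le⟩ hbd
    set u := sSup (F ⁻¹' Iic s)
    have heq : F ⁻¹' Iic s = Iic u := by
      ext y
      exact ⟨fun hy => le_csSup hbd hy, fun hy => (hmono hy).trans hmem⟩
    have hFu : F u = s := le_antisymm hmem (ht ▸ hmono (le_csSup hbd ht.le))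
    rw [heq, ← hof, hFu]
  have hFm : Measurable F := hmono.measurable
  have hsingle : ν univ = ENNReal.ofReal a := (ENNReal.ofReal_toReal (measure_ne_top _ _)).symm
  have : IsFiniteMeasure (Measure.map F ν) := Measure.isFiniteMeasure_map _ _
  apply Measure.ext_of_Iic
  intro s
  rw [Measure.map_apply hFm measurableSet_Iic, Measure.restrict_apply measurableSet_Iic]
  rcases le_or_gt a s with has | hsa
  · have e1 : F ⁻¹' Iic s = univ := eq_univ_of_forall fun t => (hle t).trans has
    have e2 : Iic s ∩ Ioo 0 a = Ioo 0 a := inter_eq_right.2 fun x hx => hx.2.le.trans has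
    rw [e1, e2, Real.volume_Ioo, hsingle, sub_zero]
  · rcases lt_or_ge 0 s with hs | hs
    · have e2 : Iic s ∩ Ioo 0 a = Ioc 0 s := by
        ext x
        simp only [mem_inter_iff, mem_Iic, mem_Ioo, mem_Ioc]
        constructor
        · rintro ⟨h1, h2, h3⟩; exact ⟨h2, h1⟩
        · rintro ⟨h1, h2⟩; exact ⟨h2, h1, by linarith⟩
      rw [key s hs hsa, e2, Real.volume_Ioc, sub_zero]
    · have e2 : Iic s ∩ Ioo 0 a = ∅ := by
        ext x
        simp only [mem_inter_iff, mem_Iic, mem_Ioo, mem_empty_iff_false, iff_false]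
        rintro ⟨h1, h2, h3⟩; linarith
      rw [e2, measure_empty]
      apply le_antisymm _ bot_le
      rcases (le_trans (hge 0) (hle 0)).eq_or_lt with h0 | h0
      · calc _ ≤ ν univ := measure_mono (subset_univ _)
          _ ≤ 0 := by rw [hsingle, ← h0]; simp
      · apply ENNReal.le_of_forall_pos_le_add
        intro e he _
        have hpos : 0 < min (e : ℝ) (a / 2) := lt_min (by exact_mod_cast he) (by linarith)
        calc ν (F ⁻¹' Iic s) ≤ ν (F ⁻¹' Iic (min (e : ℝ) (a / 2))) :=
              measure_mono (preimage_mono (Iic_subset_Iic.2 (by linarith)))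
          _ = ENNReal.ofReal (min (e : ℝ) (a / 2)) := key _ hpos
              (lt_of_le_of_lt (min_le_right _ _) (by linarith))
          _ ≤ ENNReal.ofReal e := ENNReal.ofReal_le_ofReal (min_le_left _ _)
          _ ≤ 0 + e := by simp

theorem exists_coord [MeasurableSpace X] [StandardBorelSpace X] (lam : Measure X)
    [NullSingletonClass lam] (P : Set X) (hP : MeasurableSet P) (hfin : lam P ≠ ∞) :
    ∃ (φ : X → ℝ) (P' : Set X), Measurable φ ∧ MeasurableSet P' ∧ P' ⊆ P ∧ lam (P \ P') = 0 ∧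
      InjOn φ P' ∧ Measure.map φ (lam.restrict P) = volume.restrict (Ioo 0 (lam P).toReal) := by
  have he := measurableEmbedding_embeddingReal X
  set e := embeddingReal X
  have : IsFiniteMeasure (lam.restrict P) := ⟨by simpa [lt_top_iff_ne_top] using hfin⟩
  set ν := Measure.map e (lam.restrict P) with hν
  have : IsFiniteMeasure ν := Measure.isFiniteMeasure_map _ _
  have : NullSingletonClass ν := ⟨fun x => by
    rw [hν, Measure.map_apply he.measurable (measurableSet_singleton x)]
    exact (subsingleton_singleton.preimage he.injective).measure_zero _⟩
  obtain ⟨F, hF, hmap⟩ := cdf_map ν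
  have hu : ν univ = lam P := by
    rw [hν, Measure.map_apply he.measurable MeasurableSet.univ]; simp
  rw [hu] at hmap
  have hmap2 : Measure.map (F ∘ e) (lam.restrict P) = volume.restrict (Ioo 0 (lam P).toReal) := by
    rw [← hmap, hν, Measure.map_map hF.measurable he.measurable]
  have hm : Measurable (F ∘ e) := hF.measurable.comp he.measurable
  set N : Set X := ⋃ q : ℚ, (F ∘ e) ⁻¹' {F q} with hN
  have hNm : MeasurableSet N := MeasurableSet.iUnion fun q => hm (measurableSet_singleton _)
  refine ⟨F ∘ e, P \ N, hm, hP.diff hNm, sdiff_subset, ?_, ?_, hmap2⟩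
  · have : lam.restrict P N = 0 := by
      rw [hN, measure_iUnion_null_iff]
      intro q
      rw [← Measure.map_apply hm (measurableSet_singleton _), hmap2]
      simp
    rw [Measure.restrict_apply hNm] at this
    rwa [sdiff_sdiff_right_self, inter_comm]
  · have aux : ∀ x ∈ P \ N, ∀ y, e x < e y → F (e x) ≠ F (e y) := by
      intro x hx y hxy heq
      obtain ⟨q, h1, h2⟩ := exists_rat_btwn hxy
      apply hx.2
      refine mem_iUnion.2 ⟨q, ?_⟩
      exact le_antisymm (hF h1.le) (by simpa [heq] using hF h2.le)
    intro x hx y hy hxy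
    apply he.injective
    rcases lt_trichotomy (e x) (e y) with h | h | h
    · exact absurd hxy (aux x hx y h)
    · exact h
    · exact absurd hxy.symm (aux y hy x h)

theorem exists_isoD_real [MeasurableSpace X] [StandardBorelSpace X] [Nonempty X] (lam : Measure X)
    [NullSingletonClass lam] (P : Set X) (hP : MeasurableSet P) (hfin : lam P ≠ ∞) :
    ∃ (f : X → ℝ) (g : ℝ → X) (P' : Set X) (D : Set ℝ), IsoD lam volume f g P' D ∧ P' ⊆ P ∧
      lam (P \ P') = 0 ∧ D ⊆ Ioo 0 (lam P).toReal ∧ volume (Ioo 0 (lam P).toReal \ D) = 0 := by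
  obtain ⟨φ, P₀, hφ, hP₀, hsub₀, hnull₀, hinj₀, hmap⟩ := exists_coord lam P hP hfin
  set I := Ioo 0 (lam P).toReal
  have hI : MeasurableSet I := measurableSet_Ioo
  set P' := P₀ ∩ φ ⁻¹' I with hP'def
  have hP' : MeasurableSet P' := hP₀.inter (hφ hI)
  have hinj : InjOn φ P' := hinj₀.mono inter_subset_left
  have hsub : P' ⊆ P := inter_subset_left.trans hsub₀
  have hm : ∀ E, MeasurableSet E → lam (P ∩ φ ⁻¹' E) = volume (I ∩ E) := by
    intro E hE
    have := congrArg (fun m : Measure ℝ => m E) hmap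
    rwa [Measure.map_apply hφ hE, Measure.restrict_apply (hφ hE), Measure.restrict_apply hE,
      inter_comm, inter_comm E] at this
  have hnull : lam (P \ P') = 0 := by
    refine measure_mono_null (t := (P \ P₀) ∪ (P ∩ φ ⁻¹' Iᶜ)) ?_ ?_
    · intro x hx
      by_cases h : x ∈ P₀
      · exact Or.inr ⟨hx.1, fun h2 => hx.2 ⟨h, h2⟩⟩
      · exact Or.inl ⟨hx.1, h⟩
    · rw [measure_union_null_iff]
      exact ⟨hnull₀, by rw [hm _ hI.compl]; simp⟩
  have hm' : ∀ E, MeasurableSet E → lam (P' ∩ φ ⁻¹' E) = volume (I ∩ E) := by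
    intro E hE
    rw [← hm E hE]
    apply le_antisymm (measure_mono (inter_subset_inter_left _ hsub))
    calc lam (P ∩ φ ⁻¹' E) ≤ lam ((P' ∩ φ ⁻¹' E) ∪ (P \ P')) := by
          apply measure_mono
          intro x hx
          by_cases h : x ∈ P'
          · exact Or.inl ⟨h, hx.2⟩
          · exact Or.inr ⟨hx.1, h⟩
      _ ≤ _ := measure_union_le _ _
      _ = _ := by rw [hnull, add_zero]
  have hD : MeasurableSet (φ '' P') := hP'.image_of_measurable_injOn hφ hinj
  have hDI : φ '' P' ⊆ I := by
    rintro _ ⟨x, hx, rfl⟩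
    exact hx.2
  have hDn : volume (I \ φ '' P') = 0 := by
    rw [sdiff_eq, ← hm' _ hD.compl]
    convert measure_empty (μ := lam)
    ext x
    simp only [mem_inter_iff, mem_preimage, mem_compl_iff, mem_empty_iff_false, iff_false]
    rintro ⟨h1, h2⟩
    exact h2 ⟨x, h1, rfl⟩
  have : StandardBorelSpace P' := hP'.standardBorel
  have hemb : MeasurableEmbedding (fun x : P' => φ x) :=
    (hφ.comp measurable_subtype_coe).measurableEmbedding
      (fun x y hxy => Subtype.ext (hinj x.2 y.2 hxy))
  obtain ⟨g, hg, hgeq⟩ := hemb.exists_measurable_extend (g := fun x : P' => (x : X))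
    measurable_subtype_coe (fun _ => inferInstance)
  have hg' : ∀ x ∈ P', g (φ x) = x := fun x hx => congrFun hgeq ⟨x, hx⟩
  refine ⟨φ, g, P', φ '' P', ⟨hφ, hg, hP', hD, fun x hx => ⟨x, hx, rfl⟩, ?_, hg', ?_, ?_⟩, hsub,
    hnull, hDI, hDn⟩
  · rintro _ ⟨x, hx, rfl⟩
    rwa [hg' x hx]
  · rintro _ ⟨x, hx, rfl⟩
    rw [hg' x hx]
  · intro E hE
    rw [hm' E hE]
    apply le_antisymm
    · calc volume (I ∩ E) ≤ volume ((φ '' P' ∩ E) ∪ (I \ φ '' P')) := by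
            apply measure_mono
            intro x hx
            by_cases h : x ∈ φ '' P'
            · exact Or.inl ⟨h, hx.2⟩
            · exact Or.inr ⟨hx.1, h⟩
        _ ≤ _ := measure_union_le _ _
        _ = _ := by rw [hDn, add_zero]
    · exact measure_mono (inter_subset_inter_left _ hDI)

/-- any two sets of equal finite measure are isomorphic mod null sets -/
theorem exists_isoD [MeasurableSpace X] [StandardBorelSpace X] [Nonempty X] (lam : Measure X)
    [NullSingletonClass lam] (P Q : Set X) (hP : MeasurableSet P) (hQ : MeasurableSet Q)
    (hfin : lam P ≠ ∞) (hPQ : lam P = lam Q) :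
    ∃ (f g : X → X) (P' Q' : Set X), IsoD lam lam f g P' Q' ∧ P' ⊆ P ∧ Q' ⊆ Q ∧
      lam (P \ P') = 0 ∧ lam (Q \ Q') = 0 := by
  obtain ⟨f, g, P', D, h, h1, h2, h3, h4⟩ := exists_isoD_real lam P hP hfin
  obtain ⟨f2, g2, Q', D2, h', h1', h2', h3', h4'⟩ := exists_isoD_real lam Q hQ (hPQ ▸ hfin)
  rw [← hPQ] at h3' h4'
  have k := h.symm.restr h'.mV
  have k' := h'.symm.restr h.mV
  rw [inter_comm] at k'
  refine ⟨_, _, _, _, k.symm.trans k', inter_subset_left.trans h1, inter_subset_left.trans h1',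
    ?_, ?_⟩
  · have e : P' \ (P' ∩ f ⁻¹' D2) = P' ∩ f ⁻¹' D2ᶜ := by ext; simp
    refine measure_mono_null (sdiff_triangle P P' _) ?_
    apply measure_union_null
    · assumption
    rw [e, h.pres _ h'.mV.compl]
    refine measure_mono_null ?_ h4'
    exact fun x hx => ⟨h3 hx.1, hx.2⟩
  · have e : Q' \ (Q' ∩ f2 ⁻¹' D) = Q' ∩ f2 ⁻¹' Dᶜ := by ext; simp
    refine measure_mono_null (sdiff_triangle Q Q' _) ?_
    apply measure_union_null
    · assumption
    rw [e, h'.pres _ h.mV.compl]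
    refine measure_mono_null ?_ h4
    exact fun x hx => ⟨h3' hx.1, hx.2⟩

/-- splitting a set of finite measure into pieces of prescribed measures -/
theorem exists_split [MeasurableSpace X] [StandardBorelSpace X] (lam : Measure X)
    [NullSingletonClass lam] (P : Set X) (hP : MeasurableSet P) (hfin : lam P ≠ ∞)
    (p : ℕ → ℝ≥0∞) (hp : ∑' j, p j = lam P) :
    ∃ Q : ℕ → Set X, (∀ j, MeasurableSet (Q j)) ∧ (∀ j, Q j ⊆ P) ∧
      Pairwise (fun i j => Disjoint (Q i) (Q j)) ∧ (∀ j, lam (Q j) = p j) ∧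
      lam (P \ ⋃ j, Q j) = 0 := by
  obtain ⟨φ, -, hφ, -, -, -, -, hmap⟩ := exists_coord lam P hP hfin
  have hm : ∀ E, MeasurableSet E → lam (P ∩ φ ⁻¹' E) = volume (Ioo 0 (lam P).toReal ∩ E) := by
    intro E hE
    have := congrArg (fun m : Measure ℝ => m E) hmap
    rwa [Measure.map_apply hφ hE, Measure.restrict_apply (hφ hE), Measure.restrict_apply hE,
      inter_comm, inter_comm E] at this
  have hpf : ∀ j, p j ≠ ∞ := fun j => ne_top_of_le_ne_top (hp ▸ hfin) (ENNReal.le_tsum j)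
  set s : ℕ → ℝ := fun n => ∑ j ∈ Finset.range n, (p j).toReal with hs
  have hs1 : ∀ n, s (n + 1) = s n + (p n).toReal := fun n => Finset.sum_range_succ _ _
  have hmono : Monotone s := monotone_nat_of_le_succ fun n => by
    rw [hs1]; linarith [ENNReal.toReal_nonneg (a := p n)]
  have hs0 : ∀ n, 0 ≤ s n := fun n => Finset.sum_nonneg fun j _ => ENNReal.toReal_nonneg
  have hsa : ∀ n, s n ≤ (lam P).toReal := by
    intro n
    rw [hs]
    simp only
    rw [← ENNReal.toReal_sum (fun j _ => hpf j)]
    apply ENNReal.toReal_mono hfin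
    rw [← hp]
    exact ENNReal.sum_le_tsum _
  have hmeas : ∀ j, MeasurableSet (P ∩ φ ⁻¹' Ioc (s j) (s (j + 1))) := fun j =>
    hP.inter (hφ measurableSet_Ioc)
  have hdisj : Pairwise (fun i j => Disjoint (P ∩ φ ⁻¹' Ioc (s i) (s (i + 1)))
      (P ∩ φ ⁻¹' Ioc (s j) (s (j + 1)))) := by
    intro i j hij
    rw [disjoint_left]
    rintro x ⟨-, h1, h2⟩ ⟨-, h3, h4⟩
    rcases lt_or_gt_of_ne hij with h | h
    · have := hmono (show i + 1 ≤ j from h); linarith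
    · have := hmono (show j + 1 ≤ i from h); linarith
  have hval : ∀ j, lam (P ∩ φ ⁻¹' Ioc (s j) (s (j + 1))) = p j := by
    intro j
    rw [hm _ measurableSet_Ioc]
    have : volume (Ioo 0 (lam P).toReal ∩ Ioc (s j) (s (j + 1))) = volume (Ioc (s j) (s (j + 1))) := by
      apply le_antisymm (measure_mono inter_subset_right)
      rw [← measure_congr (Ioo_ae_eq_Ioc (μ := (volume : Measure ℝ)))]
      apply measure_mono
      rintro x ⟨h1, h2⟩
      exact ⟨⟨(hs0 j).trans_lt h1, h2.trans_le (hsa _)⟩, h1, h2.le⟩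
    rw [this, Real.volume_Ioc, hs1, add_sub_cancel_left, ENNReal.ofReal_toReal (hpf j)]
  refine ⟨fun j => P ∩ φ ⁻¹' Ioc (s j) (s (j + 1)), hmeas, fun j => inter_subset_left, hdisj, hval, ?_⟩
  have hsub : (⋃ j, P ∩ φ ⁻¹' Ioc (s j) (s (j + 1))) ⊆ P := iUnion_subset fun j => inter_subset_left
  rw [measure_sdiff hsub (MeasurableSet.iUnion hmeas).nullMeasurableSet
    (ne_top_of_le_ne_top hfin (measure_mono hsub)), measure_iUnion hdisj hmeas]
  simp [hval, hp]

/-- partial isomorphism mod null sets, intertwining up to cost `c` -/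
def PIso [MeasurableSpace X] (lam : Measure X) (T₁ T₂ : X → X) (U V : Set X) (c : ℝ≥0∞) : Prop :=
  ∃ (f g : X → X) (U' V' : Set X), IsoD lam lam f g U' V' ∧ U' ⊆ U ∧ V' ⊆ V ∧
    lam (U \ U') = 0 ∧ lam (V \ V') = 0 ∧
    lam {x | x ∈ U' ∧ ¬ (T₁ x ∈ U' ∧ f (T₁ x) = T₂ (f x))} ≤ c

namespace PIso

variable [MeasurableSpace X] {lam : Measure X}

theorem mono {T₁ T₂ : X → X} {U V W Z : Set X} {c d : ℝ≥0∞}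
    (h : PIso lam T₁ T₂ U V c) (hU : U ⊆ W) (hV : V ⊆ Z) (hU0 : lam (W \ U) = 0)
    (hV0 : lam (Z \ V) = 0) (hc : c ≤ d) : PIso lam T₁ T₂ W Z d := by
  obtain ⟨f, g, U', V', h, h1, h2, h3, h4, h5⟩ := h
  refine ⟨f, g, U', V', h, h1.trans hU, h2.trans hV, ?_, ?_, h5.trans hc⟩
  · exact measure_mono_null (sdiff_triangle W U U') (measure_union_null hU0 h3)
  · exact measure_mono_null (sdiff_triangle Z V V') (measure_union_null hV0 h4)

theorem symm [StandardBorelSpace X] {T₁ T₂ : X → X} {U V : Set X} {c : ℝ≥0∞}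
    (hT₁ : Measurable T₁) (hT₂ : Measurable T₂)
    (h : PIso lam T₁ T₂ U V c) : PIso lam T₂ T₁ V U c := by
  obtain ⟨f, g, U', V', h, h1, h2, h3, h4, h5⟩ := h
  refine ⟨g, f, V', U', h.symm, h2, h1, h4, h3, le_trans ?_ h5⟩
  have hbad : MeasurableSet {x | x ∈ U' ∧ ¬ (T₁ x ∈ U' ∧ f (T₁ x) = T₂ (f x))} := by
    have e1 : MeasurableSet {x | f (T₁ x) = T₂ (f x)} :=
      measurableSet_eq_fun (h.mf.comp hT₁) (hT₂.comp h.mf)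
    exact h.mU.inter ((hT₁ h.mU).inter e1).compl
  set B := {x | x ∈ U' ∧ ¬ (T₁ x ∈ U' ∧ f (T₁ x) = T₂ (f x))} with hB
  calc _ ≤ lam (V' ∩ g ⁻¹' B) := by
        apply measure_mono
        rintro y ⟨hy, hy2⟩
        refine ⟨hy, h.mt2 y hy, ?_⟩
        rintro ⟨h6, h7⟩
        apply hy2
        rw [h.ri y hy] at h7
        rw [← h7]
        exact ⟨h.mt _ h6, h.li _ h6⟩
    _ = lam (U' ∩ B) := h.symm.pres B hbad
    _ ≤ lam B := measure_mono inter_subset_right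

theorem of_null [Nonempty X] {T₁ T₂ : X → X} {U V : Set X}
    (hU : lam U = 0) (hV : lam V = 0) : PIso lam T₁ T₂ U V 0 := by
  refine ⟨id, id, ∅, ∅, ⟨measurable_id, measurable_id, .empty, .empty, ?_, ?_, ?_, ?_, ?_⟩,
    empty_subset _, empty_subset _, by simpa using hU, by simpa using hV, by simp⟩ <;> simp

theorem of_eq [StandardBorelSpace X] [Nonempty X] [NullSingletonClass lam] {T₁ T₂ : X → X}
    {U V : Set X}
    (hU : MeasurableSet U) (hV : MeasurableSet V) (hfin : lam U ≠ ∞) (hUV : lam U = lam V) :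
    PIso lam T₁ T₂ U V (lam U) := by
  obtain ⟨f, g, U', V', h, h1, h2, h3, h4⟩ := exists_isoD lam U V hU hV hfin hUV
  exact ⟨f, g, U', V', h, h1, h2, h3, h4, measure_mono fun x hx => h1 hx.1⟩

theorem iUnion {ι : Type*} [Countable ι] [Nonempty ι] {T₁ T₂ : X → X} {U V : ι → Set X}
    {c : ι → ℝ≥0∞} (h : ∀ i, PIso lam T₁ T₂ (U i) (V i) (c i))
    (hU : Pairwise (fun i j => Disjoint (U i) (U j)))
    (hV : Pairwise (fun i j => Disjoint (V i) (V j))) :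
    PIso lam T₁ T₂ (⋃ i, U i) (⋃ i, V i) (∑' i, c i) := by
  choose f g U' V' h h1 h2 h3 h4 h5 using h
  obtain ⟨F, G, hFG, hF⟩ := IsoD.glue h (fun i j hij => (hU hij).mono (h1 i) (h1 j))
    (fun i j hij => (hV hij).mono (h2 i) (h2 j))
  have aux : ∀ (A A' : ι → Set X), (∀ i, lam (A i \ A' i) = 0) →
      lam ((⋃ i, A i) \ ⋃ i, A' i) = 0 := by
    intro A A' hA
    refine measure_mono_null (t := ⋃ i, (A i \ A' i)) ?_ (measure_iUnion_null hA)
    rintro x ⟨hx, hx2⟩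
    obtain ⟨i, hi⟩ := mem_iUnion.1 hx
    exact mem_iUnion.2 ⟨i, hi, fun h => hx2 (mem_iUnion.2 ⟨i, h⟩)⟩
  refine ⟨F, G, _, _, hFG, iUnion_mono h1, iUnion_mono h2, aux _ _ h3, aux _ _ h4, ?_⟩
  calc _ ≤ lam (⋃ i, {x | x ∈ U' i ∧ ¬ (T₁ x ∈ U' i ∧ f i (T₁ x) = T₂ (f i x))}) := by
        apply measure_mono
        rintro x ⟨hx, hx2⟩
        obtain ⟨i, hi⟩ := mem_iUnion.1 hx
        refine mem_iUnion.2 ⟨i, hi, ?_⟩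
        rintro ⟨h6, h7⟩
        apply hx2
        refine ⟨mem_iUnion.2 ⟨i, h6⟩, ?_⟩
        rw [hF i _ h6, hF i _ hi, h7]
    _ ≤ _ := measure_iUnion_le _
    _ ≤ _ := ENNReal.tsum_le_tsum h5

end PIso

/-- `i`-th level over `A` -/
def Lev [MeasurableSpace X] (T : X ≃ᵐ X) (i : ℕ) (A : Set X) : Set X := (⇑T.symm)^[i] ⁻¹' A

/-- tower of height `n` over `A` -/
def Tow [MeasurableSpace X] (T : X ≃ᵐ X) (n : ℕ) (A : Set X) : Set X := ⋃ i : Fin n, Lev T i A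

section
variable [MeasurableSpace X] {lam : Measure X}

theorem symm_mp {T : X ≃ᵐ X} (hT : MeasurePreserving T lam lam) :
    MeasurePreserving T.symm lam lam := MeasurePreserving.symm T hT

theorem Lev_meas (T : X ≃ᵐ X) (i : ℕ) {A : Set X} (hA : MeasurableSet A) :
    MeasurableSet (Lev T i A) := (T.symm.measurable.iterate i) hA

theorem Lev_measure {T : X ≃ᵐ X} (hT : MeasurePreserving T lam lam) (i : ℕ) {A : Set X}
    (hA : MeasurableSet A) : lam (Lev T i A) = lam A :=
  ((symm_mp hT).iterate i).measure_preimage hA.nullMeasurableSet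

theorem Lev_Lev (T : X ≃ᵐ X) (i j : ℕ) (A : Set X) : Lev T i (Lev T j A) = Lev T (j + i) A := by
  ext x
  simp [Lev, Function.iterate_add_apply]

theorem Tow_meas (T : X ≃ᵐ X) (n : ℕ) {A : Set X} (hA : MeasurableSet A) :
    MeasurableSet (Tow T n A) := MeasurableSet.iUnion fun i => Lev_meas T i hA

theorem Tow_measure {T : X ≃ᵐ X} (hT : MeasurePreserving T lam lam) (n : ℕ) {A : Set X}
    (hA : MeasurableSet A) (hd : Pairwise (fun i j : Fin n => Disjoint (Lev T i A) (Lev T j A))) :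
    lam (Tow T n A) = n * lam A := by
  rw [Tow, measure_iUnion hd fun i => Lev_meas T i hA]
  simp [Lev_measure hT _ hA, tsum_fintype]

theorem sym_it (T : X ≃ᵐ X) (i : ℕ) (x : X) : (⇑T.symm)^[i] ((⇑T)^[i] x) = x :=
  (Function.LeftInverse.iterate T.symm_apply_apply i) x

theorem it_sym (T : X ≃ᵐ X) (i : ℕ) (x : X) : (⇑T)^[i] ((⇑T.symm)^[i] x) = x :=
  (Function.LeftInverse.iterate T.apply_symm_apply i) x

theorem IsoD_lev {T : X ≃ᵐ X} (hT : MeasurePreserving T lam lam) (i : ℕ) {A : Set X}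
    (hA : MeasurableSet A) : IsoD lam lam ((⇑T.symm)^[i]) ((⇑T)^[i]) (Lev T i A) A where
  mf := T.symm.measurable.iterate i
  mg := T.measurable.iterate i
  mU := Lev_meas T i hA
  mV := hA
  mt := fun x hx => hx
  mt2 := fun x hx => by
    show (⇑T.symm)^[i] _ ∈ A
    rwa [sym_it]
  li := fun x _ => it_sym T i x
  ri := fun x _ => sym_it T i x
  pres := by
    intro E hE
    exact Lev_measure hT i (hA.inter hE)

variable [StandardBorelSpace X] [Nonempty X] [NullSingletonClass lam]

theorem PIso_tower {T₁ T₂ : X ≃ᵐ X} (hT₁ : MeasurePreserving T₁ lam lam)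
    (hT₂ : MeasurePreserving T₂ lam lam) {n : ℕ} (hn : 1 ≤ n) {P Q : Set X}
    (hP : MeasurableSet P) (hQ : MeasurableSet Q) (hfin : lam P ≠ ∞) (hPQ : lam P = lam Q)
    (hdP : Pairwise (fun i j : Fin n => Disjoint (Lev T₁ i P) (Lev T₁ j P)))
    (hdQ : Pairwise (fun i j : Fin n => Disjoint (Lev T₂ i Q) (Lev T₂ j Q))) :
    PIso lam T₁ T₂ (Tow T₁ n P) (Tow T₂ n Q) (lam P) := by
  obtain ⟨f, g, P', Q', h, h1, h2, h3, h4⟩ := exists_isoD lam P Q hP hQ hfin hPQ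
  have : NeZero n := ⟨by omega⟩
  have hiso : ∀ i : Fin n, IsoD lam lam _ _ (Lev T₁ i P') (Lev T₂ i Q') := fun i =>
    ((IsoD_lev hT₁ i h.mU).trans h).trans (IsoD_lev hT₂ i h.mV).symm
  obtain ⟨F, G, hFG, hF⟩ := IsoD.glue hiso
    (fun i j hij => (hdP hij).mono (preimage_mono h1) (preimage_mono h1))
    (fun i j hij => (hdQ hij).mono (preimage_mono h2) (preimage_mono h2))
  have aux : ∀ {T : X ≃ᵐ X} (hT : MeasurePreserving T lam lam) {A A' : Set X}
      (_ : MeasurableSet A) (_ : MeasurableSet A'), lam (A \ A') = 0 →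
      lam (Tow T n A \ ⋃ i : Fin n, Lev T i A') = 0 := by
    intro T hT A A' hA hA' h0
    refine measure_mono_null (t := ⋃ i : Fin n, Lev T i (A \ A')) ?_ (measure_iUnion_null fun i => ?_)
    · rintro x ⟨hx, hx2⟩
      obtain ⟨i, hi⟩ := mem_iUnion.1 hx
      exact mem_iUnion.2 ⟨i, hi, fun h => hx2 (mem_iUnion.2 ⟨i, h⟩)⟩
    · rw [Lev_measure hT _ (hA.diff hA'), h0]
  refine ⟨F, G, _, _, hFG, iUnion_mono fun i => preimage_mono h1,
    iUnion_mono fun i => preimage_mono h2, aux hT₁ hP h.mU h3, aux hT₂ hQ h.mV h4, ?_⟩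
  rw [← Lev_measure hT₁ (n - 1) hP]
  apply measure_mono
  rintro x ⟨hx, hx2⟩
  obtain ⟨i, hi⟩ := mem_iUnion.1 hx
  by_cases hin : (i : ℕ) + 1 < n
  · exfalso
    apply hx2
    have hmem : T₁ x ∈ Lev T₁ ((⟨i + 1, hin⟩ : Fin n) : ℕ) P' := by
      show (⇑T₁.symm)^[(i : ℕ) + 1] (T₁ x) ∈ P'
      rw [Function.iterate_succ_apply, T₁.symm_apply_apply]
      exact hi
    refine ⟨mem_iUnion.2 ⟨_, hmem⟩, ?_⟩
    rw [hF _ _ hmem, hF i x hi]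
    simp only [Function.comp_apply]
    rw [Function.iterate_succ_apply', Function.iterate_succ_apply, T₁.symm_apply_apply]
  · have : (i : ℕ) = n - 1 := by have := i.2; omega
    rw [← this]
    exact h1 hi

theorem PIso_block {T₁ T₂ : X ≃ᵐ X} (hT₁ : MeasurePreserving T₁ lam lam)
    (hT₂ : MeasurePreserving T₂ lam lam) {n m : ℕ} (hn : 1 ≤ n) (hnm : n * n ≤ m) {P Q : Set X}
    (hP : MeasurableSet P) (hQ : MeasurableSet Q) (hfin : lam P ≠ ∞)
    (hPQ : n * lam P = m * lam Q)
    (hdP : Pairwise (fun i j : Fin n => Disjoint (Lev T₁ i P) (Lev T₁ j P)))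
    (hdQ : Pairwise (fun i j : Fin m => Disjoint (Lev T₂ i Q) (Lev T₂ j Q))) :
    PIso lam T₁ T₂ (Tow T₁ n P) (Tow T₂ m Q) (2 * lam P) := by
  set q := m / n with hq
  set r := m % n with hr
  have hqr : n * q + r = m := Nat.div_add_mod m n
  have hrn : r < n := Nat.mod_lt _ hn
  have hnq : n ≤ q := (Nat.le_div_iff_mul_le hn).2 hnm
  have hn0 : (n : ℝ≥0∞) ≠ 0 := by exact_mod_cast (by omega : n ≠ 0)
  have hnt : (n : ℝ≥0∞) ≠ ∞ := ENNReal.natCast_ne_top n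
  set x := lam Q with hx
  have hlP : lam P = q * x + r * x / n := by
    have : (n : ℝ≥0∞) * lam P = n * (q * x + r * x / n) := by
      rw [hPQ, mul_add, ENNReal.mul_div_cancel hn0 hnt, ← hqr]
      push_cast
      ring
    exact (ENNReal.mul_right_inj hn0 hnt).1 this
  have hxfin : q * x ≠ ∞ := ne_top_of_le_ne_top hfin (hlP ▸ le_self_add)
  set p : ℕ → ℝ≥0∞ := fun j => if j < q then x else if j = q then r * x / n else 0 with hp
  have hpsum : ∑' j, p j = lam P := by
    rw [tsum_eq_sum (s := Finset.range (q + 1)), Finset.sum_range_succ, hlP]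
    · congr 1
      · rw [Finset.sum_congr rfl (g := fun _ => x) (fun j hj => by
          simp [hp, Finset.mem_range.1 hj])]
        simp
      · simp [hp]
    · intro j hj
      simp only [Finset.mem_range, not_lt] at hj
      simp only [hp]
      rw [if_neg (by omega), if_neg (by omega)]
  obtain ⟨S, hSm, hSsub, hSd, hSp, hS0⟩ := exists_split lam P hP hfin p hpsum
  have hlev : ∀ a b : ℕ, a < m → b < m → ∀ y, y ∈ Lev T₂ a Q → y ∈ Lev T₂ b Q → a = b := by
    intro a b ha hb y h1 h2
    by_contra hab
    exact disjoint_left.1 (hdQ (i := ⟨a, ha⟩) (j := ⟨b, hb⟩) (by simpa using hab)) h1 h2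
  have hlev1 : ∀ a b : ℕ, a < n → b < n → ∀ y, y ∈ Lev T₁ a P → y ∈ Lev T₁ b P → a = b := by
    intro a b ha hb y h1 h2
    by_contra hab
    exact disjoint_left.1 (hdP (i := ⟨a, ha⟩) (j := ⟨b, hb⟩) (by simpa using hab)) h1 h2
  set ht : ℕ → ℕ := fun j => if j < q then n else r with hht
  have htn : ∀ j, ht j ≤ n := fun j => by simp only [hht]; split_ifs <;> omega
  have htm : ∀ j, j ≤ q → ∀ i, i < ht j → j * n + i < m := by
    intro j hj i hi
    simp only [hht] at hi
    split_ifs at hi with h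
    · have : (j + 1) * n ≤ q * n := Nat.mul_le_mul_right n h
      nlinarith
    · have : j = q := by omega
      subst this
      nlinarith
  have hdL : ∀ j, j ≤ q → Pairwise (fun i i' : Fin (ht j) =>
      Disjoint (Lev T₂ i (Lev T₂ (j * n) Q)) (Lev T₂ i' (Lev T₂ (j * n) Q))) := by
    intro j hj i i' hii
    rw [disjoint_left]
    intro y h1 h2
    rw [Lev_Lev] at h1 h2
    have := hlev _ _ (htm j hj i i.2) (htm j hj i' i'.2) y h1 h2
    exact hii (Fin.ext (by omega))
  have hdS : ∀ j, Pairwise (fun i i' : Fin n => Disjoint (Lev T₁ i (S j)) (Lev T₁ i' (S j))) :=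
    fun j i i' hii => (hdP hii).mono (preimage_mono (hSsub j)) (preimage_mono (hSsub j))
  have hpiece : ∀ j : Fin (q + 1), PIso lam T₁ T₂ (Tow T₁ n (S j))
      (Tow T₂ (ht j) (Lev T₂ (j * n) Q)) (if (j : ℕ) < q then x else r * x) := by
    intro j
    have hjq : (j : ℕ) ≤ q := Nat.lt_succ_iff.1 j.2
    have hdj := hdL j hjq
    by_cases h : (j : ℕ) < q
    · have e1 : ht j = n := if_pos h
      rw [e1] at hdj ⊢
      have e2 : lam (S j) = x := by rw [hSp]; exact if_pos h
      rw [if_pos h]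
      have := PIso_tower hT₁ hT₂ hn (hSm j) (Lev_meas T₂ (j * n) hQ)
        (ne_top_of_le_ne_top hfin (measure_mono (hSsub j)))
        (by rw [e2, Lev_measure hT₂ _ hQ]) (hdS j) hdj
      rwa [e2] at this
    · have hj : (j : ℕ) = q := by omega
      have e1 : ht j = r := if_neg h
      rw [e1] at hdj ⊢
      have e2 : lam (S j) = r * x / n := by
        rw [hSp]
        simp only [hp]
        rw [if_neg h, if_pos hj]
      rw [if_neg h]
      have e3 : lam (Tow T₁ n (S j)) = r * x := by
        rw [Tow_measure hT₁ n (hSm j) (hdS j), e2, ENNReal.mul_div_cancel hn0 hnt]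
      have e4 : lam (Tow T₂ r (Lev T₂ (j * n) Q)) = r * x := by
        rw [Tow_measure hT₂ r (Lev_meas T₂ _ hQ) hdj, Lev_measure hT₂ _ hQ]
      have := PIso.of_eq (T₁ := T₁) (T₂ := T₂) (Tow_meas T₁ n (hSm j))
        (Tow_meas T₂ r (Lev_meas T₂ (j * n) hQ)) (by
          rw [Tow_measure hT₁ n (hSm j) (hdS j)]
          exact ENNReal.mul_ne_top hnt (ne_top_of_le_ne_top hfin (measure_mono (hSsub j))))
        (by rw [e3, e4])
      rwa [e3] at this
  have hall := PIso.iUnion hpiece ?_ ?_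
  · refine hall.mono ?_ ?_ ?_ ?_ ?_
    · exact iUnion_subset fun j => iUnion_mono fun i => preimage_mono (hSsub j)
    · refine iUnion_subset fun j => iUnion_subset fun i => ?_
      rw [Lev_Lev]
      exact subset_iUnion (fun i : Fin m => Lev T₂ i Q)
        ⟨j * n + i, htm j (Nat.lt_succ_iff.1 j.2) i i.2⟩
    · refine measure_mono_null (t := ⋃ i : Fin n, Lev T₁ i (P \ ⋃ j, S j) ∪
        ⋃ j : {j : ℕ // q < j}, Lev T₁ i (S j)) ?_ ?_
      · rintro y ⟨hy, hy2⟩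
        obtain ⟨i, hi⟩ := mem_iUnion.1 hy
        refine mem_iUnion.2 ⟨i, ?_⟩
        by_cases h : (⇑T₁.symm)^[i] y ∈ ⋃ j, S j
        · right
          obtain ⟨j, hj⟩ := mem_iUnion.1 h
          by_cases hjq : q < j
          · exact mem_iUnion.2 ⟨⟨j, hjq⟩, hj⟩
          · exact absurd (mem_iUnion.2 ⟨⟨j, by omega⟩, mem_iUnion.2 ⟨i, hj⟩⟩) hy2
        · left
          exact ⟨hi, h⟩
      · refine measure_iUnion_null fun i => measure_union_null ?_ (measure_iUnion_null fun j => ?_)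
        · rw [Lev_measure hT₁ _ (hP.diff (MeasurableSet.iUnion hSm)), hS0]
        · rw [Lev_measure hT₁ _ (hSm _), hSp]
          have := j.2
          simp only [hp]
          rw [if_neg (by omega), if_neg (by omega)]
    · convert measure_empty (μ := lam)
      rw [sdiff_eq_empty]
      refine iUnion_subset fun a => ?_
      have ha := a.2
      have hdm : n * ((a : ℕ) / n) + (a : ℕ) % n = a := Nat.div_add_mod _ _
      have hmod : (a : ℕ) % n < n := Nat.mod_lt _ hn
      have hjq : (a : ℕ) / n ≤ q := Nat.div_le_div_right ha.le
      have hi : (a : ℕ) % n < ht ((a : ℕ) / n) := by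
        simp only [hht]
        split_ifs with h
        · exact hmod
        · have : (a : ℕ) / n = q := by omega
          rw [this] at hdm
          omega
      intro y hy
      refine mem_iUnion.2 ⟨⟨(a : ℕ) / n, by omega⟩, mem_iUnion.2 ⟨⟨(a : ℕ) % n, hi⟩, ?_⟩⟩
      rw [Lev_Lev]
      simp only
      rw [mul_comm, hdm]
      exact hy
    · rw [tsum_fintype, Fin.sum_univ_castSucc]
      simp only [Fin.val_castSucc, Fin.is_lt, if_true, Fin.val_last, lt_irrefl, if_false]
      rw [Finset.sum_const, two_mul]
      have e1 : q * x ≤ lam P := hlP ▸ le_self_add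
      refine add_le_add ?_ ?_
      · simpa using e1
      · refine le_trans ?_ e1
        gcongr
        omega
  · intro j j' hjj
    rw [disjoint_left]
    intro y h1 h2
    obtain ⟨i, hi⟩ := mem_iUnion.1 h1
    obtain ⟨i', hi'⟩ := mem_iUnion.1 h2
    have := hlev1 i i' i.2 i'.2 y (hSsub j hi) (hSsub j' hi')
    have hii : i = i' := Fin.ext this
    subst hii
    exact disjoint_left.1 (hSd (fun h => hjj (Fin.ext h))) hi hi'
  · intro j j' hjj
    rw [disjoint_left]
    intro y h1 h2
    obtain ⟨i, hi⟩ := mem_iUnion.1 h1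
    obtain ⟨i', hi'⟩ := mem_iUnion.1 h2
    rw [Lev_Lev] at hi hi'
    have key := hlev _ _ (htm j (Nat.lt_succ_iff.1 j.2) i i.2)
      (htm j' (Nat.lt_succ_iff.1 j'.2) i' i'.2) y hi hi'
    have hin := lt_of_lt_of_le i.2 (htn j)
    have hin' := lt_of_lt_of_le i'.2 (htn j')
    apply hjj
    apply Fin.ext
    have k1 : ((j : ℕ) * n + i) / n = j := by
      rw [mul_comm, Nat.mul_add_div hn, Nat.div_eq_of_lt hin, add_zero]
    have k2 : ((j' : ℕ) * n + i') / n = j' := by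
      rw [mul_comm, Nat.mul_add_div hn, Nat.div_eq_of_lt hin', add_zero]
    rw [← k1, ← k2, key]

end

theorem exists_null_uncountable [MeasurableSpace X] [StandardBorelSpace X] (lam : Measure X)
    [SigmaFinite lam] [NullSingletonClass lam] (hX : lam univ = ∞) :
    ∃ Z : Set X, MeasurableSet Z ∧ lam Z = 0 ∧ ¬ Z.Countable := by
  have hunc : ¬ Countable X := by
    intro h
    have := (countable_univ (α := X)).measure_zero lam
    rw [this] at hX
    exact ENNReal.zero_ne_top hX
  have hR : ¬ Countable ℝ := not_countable
  have hRR : ¬ Countable (ℝ × ℝ) := not_countable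
  let e : X ≃ᵐ ℝ × ℝ := PolishSpace.measurableEquivOfNotCountable hunc hRR
  let A : ℝ → Set X := fun t => e ⁻¹' ({t} ×ˢ univ)
  have hA : ∀ t, MeasurableSet (A t) := fun t =>
    e.measurable ((measurableSet_singleton t).prod MeasurableSet.univ)
  have hd : Pairwise (Function.onFun Disjoint A) := by
    intro s t hst
    rw [Function.onFun, disjoint_left]
    intro x h1 h2
    exact hst (h1.1.symm.trans h2.1)
  have hc := Measure.countable_meas_pos_of_disjoint_iUnion (μ := lam) hA hd
  obtain ⟨t, ht⟩ : ∃ t, t ∉ {i | 0 < lam (A i)} := by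
    by_contra hcon
    push Not at hcon
    have : {i | 0 < lam (A i)} = univ := eq_univ_of_forall hcon
    rw [this] at hc
    exact hR (countable_univ_iff.1 hc)
  refine ⟨A t, hA t, by simpa using ht, fun hcount => ?_⟩
  have : (range fun s : ℝ => e.symm (t, s)).Countable := hcount.mono (by
    rintro _ ⟨s, rfl⟩
    simp [A])
  have hinj : Function.Injective fun s : ℝ => e.symm (t, s) := fun s s' h => by
    simpa using h
  rw [← image_univ] at this
  exact hR (countable_univ_iff.1 (countable_of_injective_of_countable_image hinj.injOn this))

theorem PIso_final [MeasurableSpace X] [StandardBorelSpace X] [Nonempty X] (lam : Measure X)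
    [SigmaFinite lam] [NullSingletonClass lam] (hX : lam univ = ∞)
    (T₁ T₂ : X ≃ᵐ X) (hT₁ : MeasurePreserving T₁ lam lam) {c : ℝ≥0∞}
    (h : PIso lam T₁ T₂ univ univ c) :
    ∃ S : X ≃ᵐ X, MeasurePreserving (⇑S) lam lam ∧
      lam {x | S (T₁ (S.symm x)) ≠ T₂ x} ≤ c := by
  obtain ⟨Z, hZm, hZ0, hZc⟩ := exists_null_uncountable lam hX
  obtain ⟨f, g, U, V, h, -, -, hU0, hV0, hc⟩ := h
  rw [← compl_eq_univ_sdiff] at hU0 hV0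
  have hDm : MeasurableSet (Zᶜ ∩ f ⁻¹' Zᶜ) := hZm.compl.inter (h.mf hZm.compl)
  have k := h.restr hDm
  set U' := U ∩ (Zᶜ ∩ f ⁻¹' Zᶜ) with hU'
  set V' := V ∩ g ⁻¹' (Zᶜ ∩ f ⁻¹' Zᶜ) with hV'
  have hZU : Z ⊆ U'ᶜ := fun x hx hx2 => hx2.2.1 hx
  have hZV : Z ⊆ V'ᶜ := fun x hx hx2 => by
    have := hx2.2.2
    rw [mem_preimage, h.ri x hx2.1] at this
    exact this hx
  have hN1 : lam U'ᶜ = 0 := by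
    refine measure_mono_null (t := Uᶜ ∪ (Z ∪ (U ∩ f ⁻¹' Z))) ?_ ?_
    · intro x hx
      by_cases h1 : x ∈ U
      · by_cases h2 : x ∈ Z
        · exact Or.inr (Or.inl h2)
        · by_cases h3 : f x ∈ Z
          · exact Or.inr (Or.inr ⟨h1, h3⟩)
          · exact absurd ⟨h1, h2, h3⟩ hx
      · exact Or.inl h1
    · refine measure_union_null hU0 (measure_union_null hZ0 ?_)
      rw [h.pres Z hZm]
      exact measure_mono_null inter_subset_right hZ0
  have hN2 : lam V'ᶜ = 0 := by
    refine measure_mono_null (t := Vᶜ ∪ (V ∩ g ⁻¹' U'ᶜ)) ?_ ?_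
    · intro y hy
      by_cases h1 : y ∈ V
      · right
        exact ⟨h1, fun h2 => hy ⟨h1, h2.2⟩⟩
      · exact Or.inl h1
    · refine measure_union_null hV0 ?_
      rw [h.symm.pres _ k.mU.compl]
      exact measure_mono_null inter_subset_right hN1
  have hs1 : StandardBorelSpace (U'ᶜ : Set X) := k.mU.compl.standardBorel
  have hs2 : StandardBorelSpace (V'ᶜ : Set X) := k.mV.compl.standardBorel
  let e : (U'ᶜ : Set X) ≃ᵐ (V'ᶜ : Set X) := PolishSpace.measurableEquivOfNotCountable
    (fun hh => hZc (Set.Countable.mono hZU (countable_coe_iff.1 hh)))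
    (fun hh => hZc (Set.Countable.mono hZV (countable_coe_iff.1 hh)))
  obtain ⟨f2, hf2, hf2e⟩ := (MeasurableEmbedding.subtype_coe k.mU.compl).exists_measurable_extend
    (g := fun x => (e x : X)) (measurable_subtype_coe.comp e.measurable) (fun _ => inferInstance)
  obtain ⟨g2, hg2, hg2e⟩ := (MeasurableEmbedding.subtype_coe k.mV.compl).exists_measurable_extend
    (g := fun x => (e.symm x : X)) (measurable_subtype_coe.comp e.symm.measurable)
    (fun _ => inferInstance)
  have hf2' : ∀ x (hx : x ∈ U'ᶜ), f2 x = e ⟨x, hx⟩ := fun x hx => congrFun hf2e ⟨x, hx⟩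
  have hg2' : ∀ x (hx : x ∈ V'ᶜ), g2 x = e.symm ⟨x, hx⟩ := fun x hx => congrFun hg2e ⟨x, hx⟩
  have k2 : IsoD lam lam f2 g2 U'ᶜ V'ᶜ := by
    refine ⟨hf2, hg2, k.mU.compl, k.mV.compl, ?_, ?_, ?_, ?_, ?_⟩
    · intro x hx
      rw [hf2' x hx]
      exact (e _).2
    · intro x hx
      rw [hg2' x hx]
      exact (e.symm _).2
    · intro x hx
      rw [hf2' x hx, hg2' _ (e _).2]
      simp
    · intro x hx
      rw [hg2' x hx, hf2' _ (e.symm _).2]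
      simp
    · intro E hE
      rw [measure_mono_null inter_subset_left hN1, measure_mono_null inter_subset_left hN2]
  obtain ⟨F, G, hFG, hF⟩ := IsoD.glue (ι := Bool) (f := fun b => bif b then f else f2)
    (g := fun b => bif b then g else g2) (U := fun b => bif b then U' else U'ᶜ)
    (V := fun b => bif b then V' else V'ᶜ) (μ := lam) (ν := lam)
    (by rintro (_ | _); exacts [k2, k])
    (by rintro (_ | _) (_ | _) hij <;> simp [disjoint_compl_left, disjoint_compl_right] at hij ⊢)
    (by rintro (_ | _) (_ | _) hij <;> simp [disjoint_compl_left, disjoint_compl_right] at hij ⊢)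
  have eU : (⋃ b : Bool, bif b then U' else U'ᶜ) = univ := by
    ext x; by_cases hx : x ∈ U' <;> simp [hx]
  have eV : (⋃ b : Bool, bif b then V' else V'ᶜ) = univ := by
    ext x; by_cases hx : x ∈ V' <;> simp [hx]
  rw [eU, eV] at hFG
  have hFU : ∀ x ∈ U', F x = f x := fun x hx => hF true x hx
  let S : X ≃ᵐ X :=
    { toFun := F
      invFun := G
      left_inv := fun x => hFG.li x (mem_univ x)
      right_inv := fun x => hFG.ri x (mem_univ x)
      measurable_toFun := hFG.mf
      measurable_invFun := hFG.mg }
  have hS : MeasurePreserving (⇑S) lam lam := ⟨hFG.mf, by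
    ext E hE
    rw [Measure.map_apply S.measurable hE]
    have := hFG.pres E hE
    rw [univ_inter, univ_inter] at this
    exact this⟩
  refine ⟨S, hS, ?_⟩
  have hSs : MeasurePreserving (⇑S.symm) lam lam := MeasurePreserving.symm S hS
  have hB : MeasurableSet {y | S (T₁ y) ≠ T₂ (S y)} := 
    (measurableSet_eq_fun (S.measurable.comp T₁.measurable)
      (T₂.measurable.comp S.measurable)).compl
  calc lam {x | S (T₁ (S.symm x)) ≠ T₂ x} = lam (S.symm ⁻¹' {y | S (T₁ y) ≠ T₂ (S y)}) := by
        congr 1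
        ext x
        simp
    _ = lam {y | S (T₁ y) ≠ T₂ (S y)} := hSs.measure_preimage hB.nullMeasurableSet
    _ ≤ lam ({x | x ∈ U ∧ ¬ (T₁ x ∈ U ∧ f (T₁ x) = T₂ (f x))} ∪ (U'ᶜ ∪ T₁ ⁻¹' U'ᶜ)) := by
        apply measure_mono
        intro y hy
        by_cases h1 : y ∈ U'
        · by_cases h2 : T₁ y ∈ U'
          · left
            refine ⟨h1.1, fun h3 => hy ?_⟩
            show F (T₁ y) = T₂ (F y)
            rw [hFU _ h1, hFU _ h2, h3.2]
          · exact Or.inr (Or.inr h2)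
        · exact Or.inr (Or.inl h1)
    _ ≤ lam {x | x ∈ U ∧ ¬ (T₁ x ∈ U ∧ f (T₁ x) = T₂ (f x))} + lam (U'ᶜ ∪ T₁ ⁻¹' U'ᶜ) :=
        measure_union_le _ _
    _ ≤ c + 0 := by
        refine add_le_add hc (le_of_eq (measure_union_null hN1 ?_))
        rw [hT₁.measure_preimage k.mU.compl.nullMeasurableSet, hN1]
    _ = c := add_zero c

theorem exists_thresholds (α β : ℕ → ℝ≥0∞) (hα : ∑' n, α n = ∞) (hβ : ∑' n, β n = ∞)
    (hαf : ∀ n, α n ≠ ∞) (hβf : ∀ n, β n ≠ ∞) :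
    ∃ bl : ℕ → ℕ, (∀ n m, bl n + 2 ≤ bl m → n * n ≤ m) ∧
      ∃ a b : ℕ → ℝ≥0∞, (∀ k, a k = ∑' n, if bl n = k then α n else 0) ∧
        (∀ k, b k = ∑' n, if bl n = k then β n else 0) ∧
        (∀ k, a k ≠ 0) ∧ (∀ k, b k ≠ 0) ∧ (∀ k, a k ≠ ∞) ∧ (∀ k, b k ≠ ∞) ∧
        (∀ k, a k ≤ b (k + 1)) ∧ (∀ k, b k ≤ a (k + 1)) ∧ (∀ k, a k ≤ a (k + 1)) ∧
        (∀ k, b k ≤ b (k + 1)) := by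
  have hfin : ∀ (γ : ℕ → ℝ≥0∞), (∀ n, γ n ≠ ∞) → ∀ s : Finset ℕ, ∑ i ∈ s, γ i ≠ ∞ :=
    fun γ h s => ENNReal.sum_ne_top.2 fun i _ => h i
  have htend : ∀ (γ : ℕ → ℝ≥0∞), (∀ n, γ n ≠ ∞) → (∑' n, γ n = ∞) → ∀ (s : ℕ) (M : ℝ≥0∞),
      M ≠ ∞ → ∀ᶠ t in atTop, M ≤ ∑ i ∈ Finset.Ico s t, γ i := by
    intro γ h1 h2 s M hM
    have := ENNReal.tendsto_nat_tsum γ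
    rw [h2] at this
    have h3 := (tendsto_order.1 this).1 (M + ∑ i ∈ Finset.range s, γ i)
      (ENNReal.add_lt_top.2 ⟨hM.lt_top, (hfin γ h1 _).lt_top⟩)
    filter_upwards [h3, eventually_ge_atTop s] with t ht hst
    rw [← Finset.sum_range_add_sum_Ico _ hst, add_comm] at ht
    exact (ENNReal.add_lt_add_iff_left (hfin γ h1 _)).1 ht |>.le
  have step : ∀ s : ℕ, ∃ t : ℕ, s * s + s < t ∧
      1 + (∑ i ∈ Finset.range s, α i + ∑ i ∈ Finset.range s, β i) ≤ ∑ i ∈ Finset.Ico s t, α i ∧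
      1 + (∑ i ∈ Finset.range s, α i + ∑ i ∈ Finset.range s, β i) ≤ ∑ i ∈ Finset.Ico s t, β i := by
    intro s
    have hM : 1 + (∑ i ∈ Finset.range s, α i + ∑ i ∈ Finset.range s, β i) ≠ ∞ :=
      ENNReal.add_ne_top.2 ⟨ENNReal.one_ne_top, ENNReal.add_ne_top.2 ⟨hfin α hαf _, hfin β hβf _⟩⟩
    obtain ⟨t, h1, h2, h3⟩ := ((eventually_gt_atTop (s * s + s)).and
      ((htend α hαf hα s _ hM).and (htend β hβf hβ s _ hM))).exists
    exact ⟨t, h1, h2, h3⟩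
  choose nx hnx1 hnx2 hnx3 using step
  let t : ℕ → ℕ := fun k => nx^[k] 0
  have ht1 : ∀ k, t (k + 1) = nx (t k) := fun k => Function.iterate_succ_apply' nx k 0
  have hlt : ∀ k, t k * t k + t k < t (k + 1) := fun k => by rw [ht1]; exact hnx1 _
  have hsm : StrictMono t := strictMono_nat_of_lt_succ fun k => by
    have := hlt k
    have h0 : 0 ≤ t k * t k := Nat.zero_le _
    omega
  have hex : ∀ n, ∃ k, n < t (k + 1) := fun n => ⟨n, hsm.id_le (n + 1)⟩
  classical
  let bl : ℕ → ℕ := fun n => Nat.find (hex n)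
  have hbl : ∀ n k, bl n = k ↔ n ∈ Finset.Ico (t k) (t (k + 1)) := by
    intro n k
    rw [Finset.mem_Ico]
    constructor
    · rintro rfl
      refine ⟨?_, Nat.find_spec (hex n)⟩
      rcases hk : bl n with _ | j
      · exact Nat.zero_le _
      · have := Nat.find_min (hex n) (m := j) (show j < bl n by omega)
        omega
    · rintro ⟨h1, h2⟩
      apply le_antisymm
      · exact Nat.find_min' (hex n) h2
      · by_contra hc
        have h3 : bl n + 1 ≤ k := by omega
        have h4 : n < t (bl n + 1) := Nat.find_spec (hex n)
        have := hsm.monotone h3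
        omega
  have hsum : ∀ (γ : ℕ → ℝ≥0∞) k, (∑' n, if bl n = k then γ n else 0) =
      ∑ n ∈ Finset.Ico (t k) (t (k + 1)), γ n := by
    intro γ k
    simp_rw [hbl]
    rw [tsum_eq_sum (s := Finset.Ico (t k) (t (k + 1)))]
    · exact Finset.sum_congr rfl fun n hn => if_pos hn
    · intro n hn
      exact if_neg hn
  have hsub : ∀ (γ : ℕ → ℝ≥0∞) k, ∑ n ∈ Finset.Ico (t k) (t (k + 1)), γ n ≤
      ∑ n ∈ Finset.range (t (k + 1)), γ n := by
    intro γ k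
    apply Finset.sum_le_sum_of_subset
    intro n hn
    exact Finset.mem_range.2 (Finset.mem_Ico.1 hn).2
  have hA : ∀ k, 1 + (∑ i ∈ Finset.range (t k), α i + ∑ i ∈ Finset.range (t k), β i) ≤
      ∑ i ∈ Finset.Ico (t k) (t (k + 1)), α i := fun k => by rw [ht1]; exact hnx2 _
  have hB : ∀ k, 1 + (∑ i ∈ Finset.range (t k), α i + ∑ i ∈ Finset.range (t k), β i) ≤
      ∑ i ∈ Finset.Ico (t k) (t (k + 1)), β i := fun k => by rw [ht1]; exact hnx3 _
  refine ⟨bl, ?_, _, _, fun k => rfl, fun k => rfl, ?_⟩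
  · intro n m hnm
    have h1 := (Finset.mem_Ico.1 ((hbl n _).1 rfl)).2
    have h2 := (Finset.mem_Ico.1 ((hbl m _).1 rfl)).1
    have h3 := hsm.monotone hnm
    have h4 := hlt (bl n + 1)
    have h5 : n * n ≤ t (bl n + 1) * t (bl n + 1) := Nat.mul_le_mul h1.le h1.le
    have h6 : bl n + 1 + 1 = bl n + 2 := rfl
    rw [h6] at h4
    omega
  · simp only [hsum]
    refine ⟨fun k => ?_, fun k => ?_, fun k => hfin α hαf _, fun k => hfin β hβf _, fun k => ?_,
      fun k => ?_, fun k => ?_, fun k => ?_⟩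
    · exact (lt_of_lt_of_le one_pos (le_self_add.trans (hA k))).ne'
    · exact (lt_of_lt_of_le one_pos (le_self_add.trans (hB k))).ne'
    · exact (hsub α k).trans (le_self_add.trans (le_add_self.trans (hB (k + 1))))
    · exact (hsub β k).trans (le_add_self.trans (le_add_self.trans (hA (k + 1))))
    · exact (hsub α k).trans (le_self_add.trans (le_add_self.trans (hA (k + 1))))
    · exact (hsub β k).trans (le_add_self.trans (le_add_self.trans (hB (k + 1))))

/-- flows between blocks -/
noncomputable def flow (a b : ℕ → ℝ≥0∞) : ℕ → ℝ≥0∞ × ℝ≥0∞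
  | 0 => (a 0, b 0)
  | 1 => (a 1, b 1)
  | (k + 2) => (a (k + 2) - (flow a b k).2, b (k + 2) - (flow a b k).1)

theorem flow_le (a b : ℕ → ℝ≥0∞) : ∀ k, (flow a b k).1 ≤ a k ∧ (flow a b k).2 ≤ b k
  | 0 => by simp [flow]
  | 1 => by simp [flow]
  | (k + 2) => by simp [flow]

theorem exists_blockflow (a b : ℕ → ℝ≥0∞) (hab : ∀ k, a k ≤ b (k + 2))
    (hba : ∀ k, b k ≤ a (k + 2)) :
    ∃ F : ℕ → ℕ → ℝ≥0∞, (∀ k, ∑' l, F k l = a k) ∧ (∀ l, ∑' k, F k l = b l) ∧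
      ∀ k l, F k l ≠ 0 → k + 2 ≤ l ∨ l + 2 ≤ k := by
  have hrow : ∀ (u v : ℕ → ℝ≥0∞) (k : ℕ),
      (∑' l, ((if l = k + 2 then u k else 0) + (if k = l + 2 then v l else 0))) =
      u k + ∑' l, (if k = l + 2 then v l else 0) := by
    intro u v k
    rw [ENNReal.tsum_add, tsum_ite_eq]
  have hs : ∀ (v : ℕ → ℝ≥0∞) (k : ℕ), (∑' l, (if k + 2 = l + 2 then v l else 0)) = v k := by
    intro v k
    have : ∀ l, (if k + 2 = l + 2 then v l else 0) = if l = k then v k else 0 := by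
      intro l
      by_cases h : l = k
      · subst h; simp
      · rw [if_neg h, if_neg (by omega)]
    simp_rw [this]
    exact tsum_ite_eq _ _
  have hz : ∀ (v : ℕ → ℝ≥0∞) (k : ℕ), k < 2 → (∑' l, (if k = l + 2 then v l else 0)) = 0 := by
    intro v k hk
    simp only [ENNReal.tsum_eq_zero]
    intro l
    rw [if_neg (by omega)]
  refine ⟨fun k l => (if l = k + 2 then (flow a b k).1 else 0) +
    (if k = l + 2 then (flow a b l).2 else 0), ?_, ?_, ?_⟩
  · intro k
    rw [hrow (fun k => (flow a b k).1) (fun k => (flow a b k).2) k]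
    match k with
    | 0 => rw [hz _ _ (by omega)]; simp [flow]
    | 1 => rw [hz _ _ (by omega)]; simp [flow]
    | (k + 2) =>
      rw [hs]
      simp only [flow]
      exact tsub_add_cancel_of_le ((flow_le a b k).2.trans (hba k))
  · intro k
    have e : ∀ l, ((if k = l + 2 then (flow a b l).1 else 0) +
        (if l = k + 2 then (flow a b k).2 else 0)) =
        ((if l = k + 2 then (flow a b k).2 else 0) +
        (if k = l + 2 then (flow a b l).1 else 0)) := fun l => add_comm _ _
    rw [tsum_congr e]
    rw [hrow (fun k => (flow a b k).2) (fun k => (flow a b k).1) k]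
    match k with
    | 0 => rw [hz _ _ (by omega)]; simp [flow]
    | 1 => rw [hz _ _ (by omega)]; simp [flow]
    | (k + 2) =>
      rw [hs]
      simp only [flow]
      exact tsub_add_cancel_of_le ((flow_le a b k).1.trans (hab k))
  · intro k l h
    by_contra hc
    apply h
    beta_reduce
    rw [if_neg (by omega), if_neg (by omega), add_zero]

theorem exists_coupling (α β : ℕ → ℝ≥0∞) (hα : ∑' n, α n = ∞) (hβ : ∑' n, β n = ∞)
    (hαf : ∀ n, α n ≠ ∞) (hβf : ∀ n, β n ≠ ∞) :
    ∃ γ : ℕ → ℕ → ℝ≥0∞, (∀ n, ∑' m, γ n m = α n) ∧ (∀ m, ∑' n, γ n m = β m) ∧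
      ∀ n m, γ n m ≠ 0 → n * n ≤ m ∨ m * m ≤ n := by
  obtain ⟨bl, hbl, a, b, ha, hb, ha0, hb0, haf, hbf, hab, hba, haa, hbb⟩ :=
    exists_thresholds α β hα hβ hαf hβf
  obtain ⟨F, hF1, hF2, hF3⟩ := exists_blockflow a b
    (fun k => (hab k).trans (hbb (k + 1))) (fun k => (hba k).trans (haa (k + 1)))
  have key : ∀ (w γ c : ℕ → ℝ≥0∞), (∀ k, c k = ∑' n, if bl n = k then γ n else 0) →
      (∀ k, c k ≠ 0) → (∀ k, c k ≠ ∞) →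
      ∑' m, w (bl m) * (γ m / c (bl m)) = ∑' l, w l := by
    intro w γ c hc hc0 hcf
    have h1 : ∀ m, w (bl m) * (γ m / c (bl m)) =
        ∑' l, (w l / c l) * (if bl m = l then γ m else 0) := by
      intro m
      rw [tsum_eq_single (bl m)]
      · rw [if_pos rfl, div_eq_mul_inv, div_eq_mul_inv]
        ring
      · intro l hl
        rw [if_neg (fun h => hl h.symm), mul_zero]
    simp_rw [h1]
    rw [ENNReal.tsum_comm]
    congr 1
    ext l
    rw [ENNReal.tsum_mul_left, ← hc, ENNReal.div_mul_cancel (hc0 l) (hcf l)]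
  refine ⟨fun n m => F (bl n) (bl m) * (α n / a (bl n)) * (β m / b (bl m)), ?_, ?_, ?_⟩
  · intro n
    have : ∀ m, F (bl n) (bl m) * (α n / a (bl n)) * (β m / b (bl m)) =
        (α n / a (bl n)) * (F (bl n) (bl m) * (β m / b (bl m))) := fun m => by ring
    simp_rw [this]
    rw [ENNReal.tsum_mul_left, key (fun l => F (bl n) l) β b hb hb0 hbf, hF1,
      ENNReal.div_mul_cancel (ha0 _) (haf _)]
  · intro m
    have : ∀ n, F (bl n) (bl m) * (α n / a (bl n)) * (β m / b (bl m)) =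
        (β m / b (bl m)) * (F (bl n) (bl m) * (α n / a (bl n))) := fun m => by ring
    simp_rw [this]
    rw [ENNReal.tsum_mul_left, key (fun l => F l (bl m)) α a ha ha0 haf, hF2,
      ENNReal.div_mul_cancel (hb0 _) (hbf _)]
  · intro n m h
    have : F (bl n) (bl m) ≠ 0 := fun h0 => h (by beta_reduce; rw [h0]; simp)
    rcases hF3 _ _ this with h1 | h1
    · exact Or.inl (hbl _ _ h1)
    · exact Or.inr (hbl _ _ h1)

section
variable [MeasurableSpace X] {lam : Measure X}

theorem inv_it_le {f g : X → X} (h : Function.LeftInverse g f) {m n : ℕ} (hmn : m ≤ n) (x : X) :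
    g^[m] (f^[n] x) = f^[n - m] x := by
  obtain ⟨k, rfl⟩ := Nat.exists_eq_add_of_le hmn
  rw [Function.iterate_add_apply, (h.iterate m) _]
  simp

theorem inv_it_ge {f g : X → X} (h : Function.LeftInverse g f) {m n : ℕ} (hmn : n ≤ m) (x : X) :
    g^[m] (f^[n] x) = g^[m - n] x := by
  obtain ⟨k, rfl⟩ := Nat.exists_eq_add_of_le hmn
  rw [add_comm, Function.iterate_add_apply, (h.iterate n) _]
  simp

theorem ret_ae {T : X ≃ᵐ X} (hc : Conserv lam T) {A : Set X} (hA : MeasurableSet A) :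
    ∀ᵐ x ∂lam, x ∈ A → ∃ n : ℕ, 1 ≤ n ∧ (⇑T)^[n] x ∈ A := by
  by_cases h : lam A = 0
  · have : ∀ᵐ x ∂lam, x ∉ A := measure_eq_zero_iff_ae_notMem.1 h
    filter_upwards [this] with x hx hx2
    exact absurd hx2 hx
  · exact hc A hA (pos_iff_ne_zero.2 h)

/-- the permutation underlying `T` -/
def prm (T : X ≃ᵐ X) : Equiv.Perm X := T.toEquiv

theorem prm_nat (T : X ≃ᵐ X) (n : ℕ) (x : X) : (prm T ^ (n : ℤ)) x = (⇑T)^[n] x := by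
  rw [zpow_natCast, ← Equiv.Perm.iterate_eq_pow]
  rfl

theorem prm_neg (T : X ≃ᵐ X) (n : ℕ) (x : X) : (prm T ^ (-(n : ℤ))) x = (⇑T.symm)^[n] x := by
  rw [zpow_neg, zpow_natCast, ← inv_pow, ← Equiv.Perm.iterate_eq_pow]
  rfl

theorem prm_meas (T : X ≃ᵐ X) (k : ℤ) : Measurable (prm T ^ k : Equiv.Perm X) := by
  rcases Int.eq_nat_or_neg k with ⟨n, rfl | rfl⟩
  · have : ((prm T ^ (n : ℤ) : Equiv.Perm X) : X → X) = (⇑T)^[n] := funext (prm_nat T n)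
    rw [this]; exact T.measurable.iterate n
  · have : ((prm T ^ (-(n : ℤ)) : Equiv.Perm X) : X → X) = (⇑T.symm)^[n] := funext (prm_neg T n)
    rw [this]; exact T.symm.measurable.iterate n

theorem exists_sweep_fin [StandardBorelSpace X] {T : X ≃ᵐ X}
    (hap : Aperiodic lam T) (hc : Conserv lam T) {B : Set X} (hB : MeasurableSet B)
    (hBf : lam B ≠ ∞) {δ : ℝ≥0∞} (hδ : 0 < δ) :
    ∃ A : Set X, MeasurableSet A ∧ lam A < δ ∧ ∀ x ∈ B, ∃ k : ℤ, (prm T ^ k) x ∈ A := by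
  obtain ⟨g, hgm, hgi, hgb⟩ : ∃ g : X → ℝ, Measurable g ∧ Function.Injective g ∧
      ∀ x, -(Real.pi / 2) ≤ g x :=
    ⟨fun x => Real.arctan (embeddingReal X x),
      Real.measurable_arctan.comp (measurableEmbedding_embeddingReal X).measurable,
      Real.arctan_injective.comp (measurableEmbedding_embeddingReal X).injective,
      fun x => (Real.neg_pi_div_two_lt_arctan _).le⟩
  let S : ℝ → Set X := fun s => {x | x ∈ B ∧ ∀ k : ℤ, (prm T ^ k) x ∈ B → g x < g ((prm T ^ k) x) + s}
  have hSm : ∀ s, MeasurableSet (S s) := by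
    intro s
    have : S s = B ∩ ⋂ k : ℤ, (((prm T ^ k : Equiv.Perm X) ⁻¹' B)ᶜ ∪
        {x | g x < g ((prm T ^ k) x) + s}) := by
      ext x
      simp [S, imp_iff_not_or]
    rw [this]
    refine hB.inter (MeasurableSet.iInter fun k => (prm_meas T k hB).compl.union ?_)
    exact measurableSet_lt hgm ((hgm.comp (prm_meas T k)).add_const s)
  have hSs : ∀ s, 0 < s → ∀ x ∈ B, ∃ k : ℤ, (prm T ^ k) x ∈ S s := by
    intro s hs x hx
    let R : Set ℝ := {r | ∃ k : ℤ, (prm T ^ k) x ∈ B ∧ r = g ((prm T ^ k) x)}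
    have hR : R.Nonempty := ⟨g x, 0, by simpa using hx, by simp⟩
    have hRb : BddBelow R := ⟨-(Real.pi / 2), by rintro r ⟨k, _, rfl⟩; exact hgb _⟩
    obtain ⟨r, ⟨k, hk, rfl⟩, hr⟩ := Real.lt_sInf_add_pos hR hs
    refine ⟨k, hk, fun l hl => ?_⟩
    rw [← Equiv.Perm.mul_apply, ← zpow_add] at hl ⊢
    have := csInf_le hRb ⟨l + k, hl, rfl⟩
    linarith
  let u : ℕ → ℝ := fun j => 1 / ((j : ℝ) + 1)
  have hu : ∀ j, 0 < u j := fun j => by positivity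
  have hanti : Antitone fun j => S (u j) := by
    intro i j hij x hx
    refine ⟨hx.1, fun k hk => (hx.2 k hk).trans_le ?_⟩
    have : u j ≤ u i := one_div_le_one_div_of_le (by positivity) (by gcongr)
    linarith
  have hlim := tendsto_measure_iInter_atTop (μ := lam) (s := fun j => S (u j))
    (fun j => (hSm _).nullMeasurableSet) hanti
    ⟨0, (lt_of_le_of_lt (measure_mono fun x hx => hx.1) hBf.lt_top).ne⟩
  have hW : ∀ x ∈ ⋂ j, S (u j), ∀ k : ℤ, (prm T ^ k) x ∈ B → g x ≤ g ((prm T ^ k) x) := by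
    intro x hx k hk
    have h1 : ∀ j, g x ≤ g ((prm T ^ k) x) + u j := fun j => ((mem_iInter.1 hx j).2 k hk).le
    have h2 : Tendsto (fun j => g ((prm T ^ k) x) + u j) atTop (𝓝 (g ((prm T ^ k) x) + 0)) :=
      tendsto_const_nhds.add tendsto_one_div_add_atTop_nhds_zero_nat
    rw [add_zero] at h2
    exact ge_of_tendsto' h2 h1
  have hW0 : lam (⋂ j, S (u j)) = 0 := by
    rw [measure_eq_zero_iff_ae_notMem]
    filter_upwards [hap, ret_ae hc (MeasurableSet.iInter fun j => hSm (u j))] with x hx1 hx2 hx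
    obtain ⟨n, hn, hy⟩ := hx2 hx
    have hxB : x ∈ B := (mem_iInter.1 hx 0).1
    have hyB := (mem_iInter.1 hy 0).1
    refine hx1 n hn (hgi (le_antisymm ?_ ?_))
    · have := hW _ hy (-(n : ℤ)) (by rw [prm_neg, sym_it]; exact hxB)
      rwa [prm_neg, sym_it] at this
    · have := hW _ hx n (by rw [prm_nat]; exact hyB)
      rwa [prm_nat] at this
  rw [hW0] at hlim
  obtain ⟨j, hj⟩ := (hlim.eventually (gt_mem_nhds hδ)).exists
  exact ⟨S (u j), hSm _, hj, hSs _ (hu j)⟩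

theorem exists_sweep [StandardBorelSpace X] [SigmaFinite lam] {T : X ≃ᵐ X}
    (hap : Aperiodic lam T) (hc : Conserv lam T) {δ : ℝ≥0∞} (hδ : 0 < δ) :
    ∃ A : Set X, MeasurableSet A ∧ lam A < δ ∧ ∀ x, ∃ k : ℤ, (prm T ^ k) x ∈ A := by
  obtain ⟨w, hw, hws⟩ := ENNReal.exists_pos_sum_of_countable' hδ.ne' ℕ
  choose A hA1 hA2 hA3 using fun k => exists_sweep_fin hap hc (measurableSet_spanningSets lam k)
    (measure_spanningSets_lt_top lam k).ne (hw k)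
  refine ⟨⋃ k, A k, MeasurableSet.iUnion hA1, ?_, fun x => ?_⟩
  · exact (measure_iUnion_le _).trans_lt ((ENNReal.tsum_le_tsum fun k => (hA2 k).le).trans_lt hws)
  · obtain ⟨i, hi⟩ := mem_iUnion.1 ((iUnion_spanningSets lam).symm ▸ mem_univ x : x ∈ ⋃ i, spanningSets lam i)
    obtain ⟨k, hk⟩ := hA3 i x hi
    exact ⟨k, mem_iUnion.2 ⟨i, hk⟩⟩

theorem exists_towers [StandardBorelSpace X] [SigmaFinite lam] {T : X ≃ᵐ X}
    (hT : MeasurePreserving T lam lam)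
    (hap : Aperiodic lam T) (hc : Conserv lam T) {δ : ℝ≥0∞} (hδ : 0 < δ) :
    ∃ A : ℕ → Set X, (∀ n, MeasurableSet (A n)) ∧
      (∀ n m i j, i < n → j < m → (n, i) ≠ (m, j) → Disjoint (Lev T i (A n)) (Lev T j (A m))) ∧
      lam (⋃ n, Tow T n (A n))ᶜ = 0 ∧ ∑' n, lam (A n) < δ ∧ A 0 = ∅ := by
  obtain ⟨A, hA, hAδ, hsw⟩ := exists_sweep hap hc hδ
  have hli : Function.LeftInverse T.symm T := T.symm_apply_apply
  have hri : Function.LeftInverse T T.symm := T.apply_symm_apply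
  let D : Set X := A ∩ ⋂ m : ℕ, ((⇑T.symm)^[m + 1] ⁻¹' A)ᶜ
  have hDm : MeasurableSet D :=
    hA.inter (MeasurableSet.iInter fun m => (T.symm.measurable.iterate _ hA).compl)
  have hD0 : ∀ᵐ x ∂lam, x ∉ D := by
    filter_upwards [ret_ae hc hDm] with x hx hxD
    obtain ⟨n, hn, hy⟩ := hx hxD
    obtain ⟨k, rfl⟩ := Nat.exists_eq_add_of_le' hn
    exact mem_iInter.1 hy.2 k (by
      show (⇑T.symm)^[k + 1] ((⇑T)^[k + 1] x) ∈ A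
      rw [sym_it]; exact hxD.1)
  have hD : ∀ᵐ x ∂lam, ∀ n : ℕ, (⇑T)^[n] x ∉ D :=
    ae_all_iff.2 fun n => (hT.iterate n).quasiMeasurePreserving.ae hD0
  have hret : ∀ᵐ x ∂lam, ∀ i : ℕ, (⇑T.symm)^[i] x ∈ A →
      ∃ n : ℕ, 1 ≤ n ∧ (⇑T)^[n] ((⇑T.symm)^[i] x) ∈ A :=
    ae_all_iff.2 fun i => ((symm_mp hT).iterate i).quasiMeasurePreserving.ae (ret_ae hc hA)
  have hback : ∀ᵐ x ∂lam, ∃ m : ℕ, (⇑T.symm)^[m] x ∈ A := by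
    filter_upwards [hD] with x hx
    by_contra! hno
    obtain ⟨k, hk⟩ := hsw x
    have hex : ∃ n : ℕ, (⇑T)^[n] x ∈ A := by
      rcases Int.eq_nat_or_neg k with ⟨n, rfl | rfl⟩
      · exact ⟨n, by rwa [prm_nat] at hk⟩
      · exact absurd (by rwa [prm_neg] at hk) (hno n)
    classical
    have h1 := Nat.find_spec hex
    have h2 : ∀ m < Nat.find hex, (⇑T)^[m] x ∉ A := fun m hm => Nat.find_min hex hm
    refine hx _ ⟨h1, mem_iInter.2 fun m hm => ?_⟩
    change (⇑T.symm)^[m + 1] ((⇑T)^[Nat.find hex] x) ∈ A at hm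
    rcases le_or_gt (m + 1) (Nat.find hex) with h | h
    · rw [inv_it_le hli h] at hm
      exact h2 _ (by omega) hm
    · rw [inv_it_ge hli h.le] at hm
      exact hno _ hm
  let C : ℕ → Set X := fun n => {x | 1 ≤ n ∧ x ∈ A ∧ (⇑T)^[n] x ∈ A ∧
    ∀ j, 1 ≤ j → j < n → (⇑T)^[j] x ∉ A}
  have hC0 : C 0 = ∅ := by ext x; simp [C]
  have hCm : ∀ n, MeasurableSet (C n) := by
    intro n
    have : C n = {x | 1 ≤ n} ∩ (A ∩ ((⇑T)^[n] ⁻¹' A ∩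
        ⋂ j, ⋂ (_ : 1 ≤ j), ⋂ (_ : j < n), ((⇑T)^[j] ⁻¹' A)ᶜ)) := by
      ext x; simp [C]
    rw [this]
    exact (MeasurableSet.const _).inter (hA.inter ((T.measurable.iterate n hA).inter
      (MeasurableSet.iInter fun j => MeasurableSet.iInter fun _ => MeasurableSet.iInter fun _ =>
        (T.measurable.iterate j hA).compl)))
  have key : ∀ n m i j x, i < n → j < m → i ≤ j → x ∈ Lev T i (C n) → x ∈ Lev T j (C m) →
      n = m ∧ i = j := by
    intro n m i j x hi hj hij h1 h2
    have h1' : (⇑T.symm)^[i] x ∈ C n := h1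
    have h2' : (⇑T.symm)^[j] x ∈ C m := h2
    have e : (⇑T)^[j - i] ((⇑T.symm)^[j] x) = (⇑T.symm)^[i] x := by
      rw [inv_it_le hri (by omega)]
      congr 2
      omega
    have hij' : i = j := by
      by_contra hne
      exact h2'.2.2.2 (j - i) (by omega) (by omega) (by rw [e]; exact h1'.2.1)
    subst hij'
    refine ⟨?_, rfl⟩
    by_contra hne
    rcases lt_or_gt_of_ne hne with h | h
    · exact h2'.2.2.2 n h1'.1 h h1'.2.2.1
    · exact h1'.2.2.2 m h2'.1 h h2'.2.2.1
  have hdis : ∀ n m i j, i < n → j < m → (n, i) ≠ (m, j) →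
      Disjoint (Lev T i (C n)) (Lev T j (C m)) := by
    intro n m i j hi hj hne
    refine disjoint_left.2 fun x h1 h2 => hne ?_
    rcases le_total i j with h | h
    · obtain ⟨rfl, rfl⟩ := key n m i j x hi hj h h1 h2
      rfl
    · obtain ⟨rfl, rfl⟩ := key m n j i x hj hi h h2 h1
      rfl
  refine ⟨C, hCm, hdis, ?_, ?_, hC0⟩
  · change ∀ᵐ x ∂lam, x ∈ (⋃ n, Tow T n (C n))
    filter_upwards [hback, hret] with x hex hr
    classical
    have h1 := Nat.find_spec hex
    have h2 : ∀ m < Nat.find hex, (⇑T.symm)^[m] x ∉ A := fun m hm => Nat.find_min hex hm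
    have hex2 := hr _ h1
    have h3 := Nat.find_spec hex2
    have h4 : ∀ m < Nat.find hex2, ¬ (1 ≤ m ∧ (⇑T)^[m] ((⇑T.symm)^[Nat.find hex] x) ∈ A) :=
      fun m hm => Nat.find_min hex2 hm
    generalize Nat.find hex = i at *
    generalize Nat.find hex2 = n at *
    have hin : i < n := by
      by_contra hle
      have h5 := h3.2
      rw [inv_it_le hri (by omega)] at h5
      exact h2 _ (by omega) h5
    refine mem_iUnion.2 ⟨n, mem_iUnion.2 ⟨⟨i, hin⟩, ?_⟩⟩
    exact ⟨h3.1, h1, h3.2, fun j hj hjn hA => h4 j hjn ⟨hj, hA⟩⟩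
  · refine lt_of_le_of_lt ?_ hAδ
    rw [← measure_iUnion (fun n m hnm => ?_) hCm]
    · exact measure_mono (iUnion_subset fun n x hx => hx.2.1)
    · refine disjoint_left.2 fun x h1 h2 => hnm ?_
      exact (key n m 0 0 x h1.1 h2.1 le_rfl h1 h2).1

end

section
variable [MeasurableSpace X] {lam : Measure X}

theorem tow_total {T : X ≃ᵐ X} (hT : MeasurePreserving T lam lam) {A : ℕ → Set X}
    (hA : ∀ n, MeasurableSet (A n))
    (hd : ∀ n m i j, i < n → j < m → (n, i) ≠ (m, j) →
      Disjoint (Lev T i (A n)) (Lev T j (A m)))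
    (h0 : lam (⋃ n, Tow T n (A n))ᶜ = 0) : ∑' n : ℕ, (n : ℝ≥0∞) * lam (A n) = lam univ := by
  have h1 : ∀ n : ℕ, (n : ℝ≥0∞) * lam (A n) = lam (Tow T n (A n)) := fun n =>
    (Tow_measure hT n (hA n) fun i j hij => hd n n i j i.2 j.2 (by
      intro h; exact hij (Fin.ext (Prod.ext_iff.1 h).2))).symm
  simp_rw [h1]
  rw [← measure_iUnion _ fun n => Tow_meas T n (hA n)]
  · rw [← measure_add_measure_compl (μ := lam) (MeasurableSet.iUnion fun n => Tow_meas T n (hA n)),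
      h0, add_zero]
  · intro n m hnm
    refine disjoint_iUnion_left.2 fun i => disjoint_iUnion_right.2 fun j => ?_
    exact hd n m i j i.2 j.2 fun h => hnm (Prod.ext_iff.1 h).1

theorem split_towers [StandardBorelSpace X] [Nonempty X] [NullSingletonClass lam] {T : X ≃ᵐ X}
    (hT : MeasurePreserving T lam lam) {A : ℕ → Set X}
    (hA : ∀ n, MeasurableSet (A n))
    (hd : ∀ n m i j, i < n → j < m → (n, i) ≠ (m, j) →
      Disjoint (Lev T i (A n)) (Lev T j (A m)))
    (h0 : lam (⋃ n, Tow T n (A n))ᶜ = 0) (hA0 : A 0 = ∅) (hAf : ∀ n, lam (A n) ≠ ∞)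
    (γ : ℕ → ℕ → ℝ≥0∞) (hγ : ∀ n, ∑' m, γ n m = n * lam (A n)) :
    ∃ P : ℕ → ℕ → Set X, (∀ n m, MeasurableSet (P n m)) ∧
      (∀ n m, n * lam (P n m) = γ n m) ∧ (∀ n, ∑' m, lam (P n m) = lam (A n)) ∧
      (∀ n m, lam (P n m) ≠ ∞) ∧
      (∀ n m, Pairwise fun i j : Fin n => Disjoint (Lev T i (P n m)) (Lev T j (P n m))) ∧
      (Pairwise fun p q : ℕ × ℕ => Disjoint (Tow T p.1 (P p.1 p.2)) (Tow T q.1 (P q.1 q.2))) ∧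
      lam (⋃ p : ℕ × ℕ, Tow T p.1 (P p.1 p.2))ᶜ = 0 := by
  have hz : ∀ m, γ 0 m = 0 := by
    have := hγ 0
    simpa using this
  have hsum : ∀ n : ℕ, ∑' m, γ n m / n = lam (A n) := by
    intro n
    simp_rw [div_eq_mul_inv]
    rw [ENNReal.tsum_mul_right, hγ]
    rcases Nat.eq_zero_or_pos n with rfl | hn
    · simp [hA0]
    · rw [mul_comm, ← mul_assoc, ENNReal.inv_mul_cancel (by simp; omega) (by simp), one_mul]
  choose P hPm hPs hPd hPl hPn using fun n =>
    exists_split lam (A n) (hA n) (hAf n) (fun m => γ n m / n) (hsum n)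
  refine ⟨P, hPm, ?_, ?_, ?_, ?_, ?_, ?_⟩
  · intro n m
    rw [hPl]
    rcases Nat.eq_zero_or_pos n with rfl | hn
    · simp [hz]
    · exact ENNReal.mul_div_cancel (by simp; omega) (by simp)
  · intro n
    simp_rw [hPl]
    exact hsum n
  · intro n m
    exact ((measure_mono (hPs n m)).trans_lt (hAf n).lt_top).ne
  · intro n m i j hij
    exact (hd n n i j i.2 j.2 fun h => hij (Fin.ext (Prod.ext_iff.1 h).2)).mono
      (preimage_mono (hPs n m)) (preimage_mono (hPs n m))
  · rintro ⟨n, m⟩ ⟨n', m'⟩ hne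
    refine disjoint_iUnion_left.2 fun i => disjoint_iUnion_right.2 fun j => ?_
    by_cases h : (n, (i : ℕ)) = (n', (j : ℕ))
    · obtain ⟨h1, h2⟩ := Prod.ext_iff.1 h
      simp only at h1 h2
      have hm : m ≠ m' := by
        rintro rfl
        exact hne (by rw [h1])
      show Disjoint (Lev T i (P n m)) (Lev T j (P n' m'))
      rw [← h2, ← h1]
      exact (hPd n hm).preimage _
    · exact (hd n n' i j i.2 j.2 h).mono
        (preimage_mono (hPs n m)) (preimage_mono (hPs n' m'))
  · refine measure_mono_null (t := (⋃ n, Tow T n (A n))ᶜ ∪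
      ⋃ n : ℕ, ⋃ i : ℕ, Lev T i (A n \ ⋃ m, P n m)) ?_ (measure_union_null h0 ?_)
    · intro x hx
      by_contra hc
      simp only [mem_union, not_or, mem_compl_iff, not_not] at hc
      obtain ⟨h1, h2⟩ := hc
      obtain ⟨n, hn⟩ := mem_iUnion.1 h1
      obtain ⟨i, hi⟩ := mem_iUnion.1 hn
      have h3 : (⇑T.symm)^[(i : ℕ)] x ∈ ⋃ m, P n m := by
        by_contra h4
        exact h2 (mem_iUnion.2 ⟨n, mem_iUnion.2 ⟨i, ⟨hi, h4⟩⟩⟩)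
      obtain ⟨m, hm⟩ := mem_iUnion.1 h3
      exact hx (mem_iUnion.2 ⟨(n, m), mem_iUnion.2 ⟨i, hm⟩⟩)
    · refine measure_iUnion_null fun n => measure_iUnion_null fun i => ?_
      rw [Lev_measure hT i ((hA n).diff (MeasurableSet.iUnion (hPm n)))]
      exact hPn n

end

theorem conservative_aperiodic_approx_conj
    [MeasurableSpace X] [StandardBorelSpace X]
    (lam : Measure X) [SigmaFinite lam] [NullSingletonClass lam] (hX : lam univ = ∞)
    (T₁ T₂ : X ≃ᵐ X)
    (hT₁ : MeasurePreserving (⇑T₁) lam lam) (hT₂ : MeasurePreserving (⇑T₂) lam lam)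
    (hap₁ : Aperiodic lam T₁) (hap₂ : Aperiodic lam T₂)
    (hcons₁ : Conserv lam T₁) (hcons₂ : Conserv lam T₂) :
    ∀ ε : ℝ≥0∞, 0 < ε → ∃ S : X ≃ᵐ X, MeasurePreserving (⇑S) lam lam ∧
      lam {x | S (T₁ (S.symm x)) ≠ T₂ x} < ε := by
  intro ε hε
  have : Nonempty X := by
    by_contra h
    rw [not_nonempty_iff] at h
    rw [univ_eq_empty_iff.2 h] at hX
    simp at hX
  have hδ : 0 < ε / 2 / 2 := ENNReal.half_pos (ENNReal.half_pos hε.ne').ne'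
  obtain ⟨A, hA, hAd, hAn, hAs, hA0⟩ := exists_towers hT₁ hap₁ hcons₁ hδ
  obtain ⟨C, hC, hCd, hCn, hCs, hC0⟩ := exists_towers hT₂ hap₂ hcons₂ hδ
  have hAf : ∀ n, lam (A n) ≠ ∞ := fun n =>
    ((ENNReal.le_tsum n).trans_lt (hAs.trans_le le_top)).ne
  have hCf : ∀ n, lam (C n) ≠ ∞ := fun n =>
    ((ENNReal.le_tsum n).trans_lt (hCs.trans_le le_top)).ne
  obtain ⟨γ, hγ1, hγ2, hγ3⟩ := exists_coupling (fun n => n * lam (A n)) (fun n => n * lam (C n))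
    ((tow_total hT₁ hA hAd hAn).trans hX) ((tow_total hT₂ hC hCd hCn).trans hX)
    (fun n => ENNReal.mul_ne_top (by simp) (hAf n)) (fun n => ENNReal.mul_ne_top (by simp) (hCf n))
  obtain ⟨P, hP, hPγ, hPs, hPf, hPd, hPt, hPn⟩ := split_towers hT₁ hA hAd hAn hA0 hAf γ hγ1
  obtain ⟨Q, hQ, hQγ, hQs, hQf, hQd, hQt, hQn⟩ :=
    split_towers hT₂ hC hCd hCn hC0 hCf (fun m n => γ n m) hγ2
  have hb : ∀ p : ℕ × ℕ, PIso lam T₁ T₂ (Tow T₁ p.1 (P p.1 p.2)) (Tow T₂ p.2 (Q p.2 p.1))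
      (2 * (lam (P p.1 p.2) + lam (Q p.2 p.1))) := by
    rintro ⟨n, m⟩
    show PIso lam T₁ T₂ (Tow T₁ n (P n m)) (Tow T₂ m (Q m n)) (2 * (lam (P n m) + lam (Q m n)))
    by_cases h : γ n m = 0
    · refine (PIso.of_null ?_ ?_).mono subset_rfl subset_rfl (by simp) (by simp) (zero_le)
      · rw [Tow_measure hT₁ n (hP n m) (hPd n m), hPγ, h]
      · rw [Tow_measure hT₂ m (hQ m n) (hQd m n), hQγ, h]
    · have hn : 1 ≤ n := by
        by_contra hn
        obtain rfl : n = 0 := by omega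
        exact h (by rw [← hPγ]; simp)
      have hm : 1 ≤ m := by
        by_contra hm
        obtain rfl : m = 0 := by omega
        exact h (by rw [← hQγ 0 n]; simp)
      rcases hγ3 n m h with h1 | h1
      · refine (PIso_block hT₁ hT₂ hn h1 (hP n m) (hQ m n) (hPf n m) ?_ (hPd n m) (hQd m n)).mono
          subset_rfl subset_rfl (by simp) (by simp) (by gcongr; exact le_self_add)
        rw [hPγ, hQγ]
      · refine ((PIso_block hT₂ hT₁ hm h1 (hQ m n) (hP n m) (hQf m n) ?_ (hQd m n)
          (hPd n m)).symm T₂.measurable T₁.measurable).mono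
          subset_rfl subset_rfl (by simp) (by simp) (by gcongr; exact le_add_self)
        rw [hPγ, hQγ]
  have hall := PIso.iUnion hb hPt (fun p q hpq => hQt (i := p.swap) (j := q.swap)
    (fun h => hpq (Prod.swap_injective h)))
  have hQu : (⋃ p : ℕ × ℕ, Tow T₂ p.2 (Q p.2 p.1)) = ⋃ p : ℕ × ℕ, Tow T₂ p.1 (Q p.1 p.2) :=
    (Equiv.prodComm ℕ ℕ).surjective.iUnion_comp (fun p : ℕ × ℕ => Tow T₂ p.1 (Q p.1 p.2))
  rw [hQu] at hall
  have hfin := hall.mono (subset_univ _) (subset_univ _) (by rw [← compl_eq_univ_sdiff]; exact hPn)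
    (by rw [← compl_eq_univ_sdiff]; exact hQn) le_rfl
  obtain ⟨S, hS, hSc⟩ := PIso_final lam hX T₁ T₂ hT₁ hfin
  refine ⟨S, hS, hSc.trans_lt ?_⟩
  have e1 : ∑' p : ℕ × ℕ, lam (P p.1 p.2) = ∑' n, lam (A n) := by
    rw [ENNReal.tsum_prod (f := fun n m => lam (P n m))]
    simp_rw [hPs]
  have e2 : ∑' p : ℕ × ℕ, lam (Q p.2 p.1) = ∑' n, lam (C n) := by
    rw [ENNReal.tsum_prod (f := fun n m => lam (Q m n)), ENNReal.tsum_comm]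
    simp_rw [hQs]
  rw [ENNReal.tsum_mul_left, ENNReal.tsum_add, e1, e2]
  apply ENNReal.mul_lt_of_lt_div'
  calc _ < ε / 2 / 2 + ε / 2 / 2 := ENNReal.add_lt_add hAs hCs
    _ = ε / 2 := ENNReal.add_halves _
end

section
/- Let (X, λ) be a standard Borel space with an atomless σ-finite measure satisfying λ(X) = ∞, and let T ∈ Aut(X, λ) be such that the restriction of T to its support supp T = {x ∈ X : T(x) ≠ x} is conservative and aperiodic. Then for every ε > 0 there exists a Borel subset B ⊆ supp T with λ(B) < ε such that B intersects the T-orbit of λ-a.e. point of supp T. -/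
open MeasureTheory Set
open scoped ENNReal

variable {X : Type*}

/-- The support of `T`. -/
def suppT [MeasurableSpace X] (T : X ≃ᵐ X) : Set X := {x | T x ≠ x}

theorem zpow_meas [MeasurableSpace X] (T : X ≃ᵐ X) (n : ℤ) :
    Measurable (fun x => (T.toEquiv ^ n) x) := by
  have hp : ∀ k : ℕ, Measurable (fun x => (T.toEquiv ^ k) x) := by
    intro k
    induction k with
    | zero => exact measurable_id
    | succ k ih =>
      simp only [pow_succ', Equiv.Perm.mul_apply]
      exact T.measurable.comp ih
  have hq : ∀ k : ℕ, Measurable (fun x => (T.toEquiv⁻¹ ^ k) x) := by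
    intro k
    induction k with
    | zero => exact measurable_id
    | succ k ih =>
      simp only [pow_succ', Equiv.Perm.mul_apply]
      exact T.symm.measurable.comp ih
  obtain ⟨k, rfl | rfl⟩ := n.eq_nat_or_neg
  · simpa using hp k
  · simpa using hq k

theorem iterate_eq_zpow [MeasurableSpace X] (T : X ≃ᵐ X) (n : ℕ) (x : X) :
    (⇑T)^[n] x = (T.toEquiv ^ (n : ℤ)) x := by
  rw [zpow_natCast, ← Equiv.Perm.iterate_eq_pow]
  rfl

theorem small_piece [MeasurableSpace X]
    (lam : Measure X) (T : X ≃ᵐ X) (f : X → ℝ) (hf : Measurable f)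
    (hinj : Function.Injective f) (hpos : ∀ x, 0 ≤ f x)
    (hcons : ∀ A : Set X, A ⊆ suppT T → MeasurableSet A → 0 < lam A →
      ∀ᵐ x ∂lam, x ∈ A → ∃ n : ℕ, 1 ≤ n ∧ (⇑T)^[n] x ∈ A)
    (hap : ∀ᵐ x ∂lam, x ∈ suppT T → ∀ n : ℕ, 1 ≤ n → (⇑T)^[n] x ≠ x)
    (A : Set X) (hA : MeasurableSet A) (hAS : A ⊆ suppT T) (hfin : lam A ≠ ∞)
    (ε : ℝ≥0∞) (hε : 0 < ε) :
    ∃ B : Set X, MeasurableSet B ∧ B ⊆ A ∧ lam B < ε ∧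
      ∀ x ∈ A, ∃ n : ℤ, (T.toEquiv ^ n) x ∈ B := by
  let B : ℕ → Set X := fun k =>
    A ∩ ⋂ n : ℤ, {x | (T.toEquiv ^ n) x ∈ A → f x < f ((T.toEquiv ^ n) x) + 1 / ((k : ℝ) + 1)}
  have hBm : ∀ k, MeasurableSet (B k) := by
    intro k
    refine hA.inter (MeasurableSet.iInter fun n => ?_)
    refine MeasurableSet.imp (zpow_meas T n hA) ?_
    exact measurableSet_lt hf ((hf.comp (zpow_meas T n)).add_const _)
  have hBA : ∀ k, B k ⊆ A := fun k => inter_subset_left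
  have hanti : Antitone B := by
    intro k l hkl x hx
    refine ⟨hx.1, mem_iInter.2 fun n hn => ?_⟩
    have h1 := mem_iInter.1 hx.2 n hn
    have h2 : 1 / ((l : ℝ) + 1) ≤ 1 / ((k : ℝ) + 1) := Nat.one_div_le_one_div hkl
    linarith
  have hW0 : lam (⋂ k, B k) = 0 := by
    by_contra h0
    have hWm : MeasurableSet (⋂ k, B k) := MeasurableSet.iInter hBm
    have hWA : (⋂ k, B k) ⊆ A := (iInter_subset B 0).trans (hBA 0)
    have key : ∀ x ∈ ⋂ k, B k, ∀ n : ℤ, (T.toEquiv ^ n) x ∈ A → f x ≤ f ((T.toEquiv ^ n) x) := by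
      intro x hx n hn
      refine le_of_forall_pos_lt_add fun δ hδ => ?_
      obtain ⟨k, hk⟩ := exists_nat_one_div_lt hδ
      have := mem_iInter.1 (mem_iInter.1 hx k).2 n hn
      linarith
    apply h0
    have h1 := hcons _ (hWA.trans hAS) hWm (pos_iff_ne_zero.2 h0)
    rw [measure_eq_zero_iff_ae_notMem]
    filter_upwards [h1, hap] with x hx1 hx2 hx
    obtain ⟨n, hn, hnW⟩ := hx1 hx
    apply hx2 (hAS (hWA hx)) n hn
    rw [iterate_eq_zpow] at hnW ⊢
    apply hinj
    apply le_antisymm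
    · have hb : (T.toEquiv ^ (-(n : ℤ))) ((T.toEquiv ^ (n : ℤ)) x) = x := by
        rw [← Equiv.Perm.mul_apply, ← zpow_add]; simp
      have := key _ hnW (-(n : ℤ)) (by rw [hb]; exact hWA hx)
      rwa [hb] at this
    · exact key _ hx n (hWA hnW)
  have ht := tendsto_measure_iInter_atTop (μ := lam) (fun k => (hBm k).nullMeasurableSet) hanti
    ⟨0, ne_top_of_le_ne_top hfin (measure_mono (hBA 0))⟩
  rw [hW0] at ht
  obtain ⟨k, hk⟩ := (ht.eventually_lt_const hε).exists
  refine ⟨B k, hBm k, hBA k, hk, fun x hx => ?_⟩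
  let V : Set ℝ := {r | ∃ n : ℤ, (T.toEquiv ^ n) x ∈ A ∧ f ((T.toEquiv ^ n) x) = r}
  have hVb : BddBelow V := ⟨0, by rintro r ⟨n, -, rfl⟩; exact hpos _⟩
  have hVn : V.Nonempty := ⟨f x, 0, by simpa using hx, by simp⟩
  obtain ⟨r, ⟨n, hn, rfl⟩, hlt⟩ := Real.lt_sInf_add_pos hVn
    (show (0 : ℝ) < 1 / ((k : ℝ) + 1) by positivity)
  refine ⟨n, hn, mem_iInter.2 fun m hm => ?_⟩
  have hc : (T.toEquiv ^ m) ((T.toEquiv ^ n) x) = (T.toEquiv ^ (m + n)) x := by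
    rw [zpow_add, Equiv.Perm.mul_apply]
  rw [hc] at hm ⊢
  have := csInf_le hVb (show f ((T.toEquiv ^ (m + n)) x) ∈ V from ⟨m + n, hm, rfl⟩)
  linarith

theorem small_set_meeting_all_orbits
    [MeasurableSpace X] [StandardBorelSpace X]
    (lam : Measure X) [SigmaFinite lam] [NullSingletonClass lam] (hX : lam univ = ∞)
    (T : X ≃ᵐ X) (hT : MeasurePreserving (⇑T) lam lam)
    -- the restriction of `T` to its support is conservative
    (hcons : ∀ A : Set X, A ⊆ suppT T → MeasurableSet A → 0 < lam A →
      ∀ᵐ x ∂lam, x ∈ A → ∃ n : ℕ, 1 ≤ n ∧ (⇑T)^[n] x ∈ A)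
    -- the restriction of `T` to its support is aperiodic
    (hap : ∀ᵐ x ∂lam, x ∈ suppT T → ∀ n : ℕ, 1 ≤ n → (⇑T)^[n] x ≠ x) :
    ∀ ε : ℝ≥0∞, 0 < ε → ∃ B : Set X, MeasurableSet B ∧ B ⊆ suppT T ∧ lam B < ε ∧
      ∀ᵐ x ∂lam, x ∈ suppT T → ∃ n : ℤ, ⇑(T.toEquiv ^ n) x ∈ B := by
  intro ε hε
  obtain ⟨g, hg⟩ := exists_measurableEmbedding_real X
  have hf : Measurable fun x => Real.exp (g x) := Real.measurable_exp.comp hg.measurable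
  have hinj : Function.Injective fun x => Real.exp (g x) := Real.exp_injective.comp hg.injective
  have hS : MeasurableSet (suppT T) := by
    have : suppT T = {x | g (T x) = g x}ᶜ := by
      ext x
      simp [suppT, hg.injective.eq_iff]
    rw [this]
    exact (measurableSet_eq_fun (hg.measurable.comp T.measurable) hg.measurable).compl
  obtain ⟨δ, hδ, hsum⟩ := ENNReal.exists_pos_sum_of_countable' hε.ne' ℕ
  have H := fun k => small_piece lam T _ hf hinj (fun x => (Real.exp_pos _).le) hcons hap
    (suppT T ∩ spanningSets lam k) (hS.inter (measurableSet_spanningSets lam k)) inter_subset_left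
    (ne_top_of_le_ne_top (measure_spanningSets_lt_top lam k).ne (measure_mono inter_subset_right))
    (δ k) (hδ k)
  choose B hBm hBA hBl hB using H
  refine ⟨⋃ k, B k, MeasurableSet.iUnion hBm,
    iUnion_subset fun k => (hBA k).trans inter_subset_left, ?_, ?_⟩
  · exact ((measure_iUnion_le B).trans (ENNReal.tsum_le_tsum fun k => (hBl k).le)).trans_lt hsum
  · refine Filter.Eventually.of_forall fun x hx => ?_
    have hx2 : x ∈ ⋃ k, spanningSets lam k := by rw [iUnion_spanningSets]; trivial
    obtain ⟨k, hk⟩ := mem_iUnion.1 hx2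
    obtain ⟨n, hn⟩ := hB k x ⟨hx, hk⟩
    exact ⟨n, mem_iUnion.2 ⟨k, hn⟩⟩
end

section
/- (Rokhlin lemma for infinite measure-preserving bijections.) Let (X, λ) be a standard Borel space with an atomless σ-finite measure satisfying λ(X) = ∞, and let T ∈ Aut(X, λ) be aperiodic. Then for every integer N ≥ 1 and every ε > 0 there exists a Borel subset A ⊆ X such that the sets A, T(A), …, T^{N−1}(A) are pairwise disjoint and λ(X \ (A ∪ T(A) ∪ ⋯ ∪ T^{N−1}(A))) < ε. -/
open MeasureTheory Set
open scoped ENNReal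

variable {X : Type*}

namespace RokhlinAux

/-- points of `P` minimizing `g` among the points of `P` in the same orbit -/
def mn (F : ℤ → X → X) (P : Set X) (g : X → ℕ) : Set X :=
  {x | x ∈ P ∧ ∀ m : ℤ, F m x ∈ P → g x ≤ g (F m x)}

def seqP (F : ℤ → X → X) (g : ℕ → X → ℕ) : ℕ → Set X
  | 0 => mn F univ (g 0)
  | k + 1 => mn F (seqP F g k) (g (k + 1))

lemma mn_meas [MeasurableSpace X] {F : ℤ → X → X} (hF : ∀ m, Measurable (F m)) {P : Set X}
    (hP : MeasurableSet P) {g : X → ℕ} (hg : Measurable g) : MeasurableSet (mn F P g) := by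
  have : mn F P g = P ∩ ⋂ m : ℤ, ((F m ⁻¹' P)ᶜ ∪ {x | g x ≤ g (F m x)}) := by
    ext x
    simp only [mn, mem_setOf_eq, mem_inter_iff, mem_iInter, mem_union, mem_compl_iff, mem_preimage,
      imp_iff_not_or]
  rw [this]
  exact hP.inter (MeasurableSet.iInter fun m => ((hF m hP).compl).union
    (measurableSet_le hg (hg.comp (hF m))))

lemma seqP_meas [MeasurableSpace X] {F : ℤ → X → X} (hF : ∀ m, Measurable (F m))
    {g : ℕ → X → ℕ} (hg : ∀ k, Measurable (g k)) (k : ℕ) : MeasurableSet (seqP F g k) := by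
  induction k with
  | zero => exact mn_meas hF MeasurableSet.univ (hg 0)
  | succ k ih => exact mn_meas hF ih (hg _)

lemma mn_hit {F : ℤ → X → X} (hadd : ∀ a b x, F (a + b) x = F a (F b x)) {P : Set X}
    {g : X → ℕ} {x : X} (h : ∃ m, F m x ∈ P) : ∃ m, F m x ∈ mn F P g := by
  classical
  have h2 : ∃ v, ∃ m, F m x ∈ P ∧ g (F m x) = v := by
    obtain ⟨m, hm⟩ := h
    exact ⟨_, m, hm, rfl⟩
  obtain ⟨m, hm, hv⟩ := Nat.find_spec h2
  refine ⟨m, hm, fun j hj => ?_⟩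
  rw [hv]
  apply Nat.find_min' h2
  refine ⟨j + m, ?_, ?_⟩
  · rw [hadd]; exact hj
  · rw [hadd]

lemma seqP_hit {F : ℤ → X → X} (hadd : ∀ a b x, F (a + b) x = F a (F b x))
    (g : ℕ → X → ℕ) (x : X) (k : ℕ) : ∃ m, F m x ∈ seqP F g k := by
  induction k with
  | zero => exact mn_hit hadd ⟨0, mem_univ _⟩
  | succ k ih => exact mn_hit hadd ih

lemma seqP_anti (F : ℤ → X → X) (g : ℕ → X → ℕ) : Antitone (seqP F g) :=
  antitone_nat_of_succ_le fun _ _ hx => hx.1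

lemma mn_eq {F : ℤ → X → X} (h0 : ∀ x, F 0 x = x) (hadd : ∀ a b x, F (a + b) x = F a (F b x))
    {P : Set X} {g : X → ℕ} {x : X} {m : ℤ} (hx : x ∈ mn F P g) (hy : F m x ∈ mn F P g) :
    g (F m x) = g x := by
  apply le_antisymm _ (hx.2 m hy.1)
  have := hy.2 (-m)
  rw [← hadd, neg_add_cancel, h0] at this
  exact this hx.1

lemma seqP_eq {F : ℤ → X → X} (h0 : ∀ x, F 0 x = x) (hadd : ∀ a b x, F (a + b) x = F a (F b x))
    {g : ℕ → X → ℕ} {x : X} {m : ℤ} {k : ℕ} (hx : x ∈ seqP F g k) (hy : F m x ∈ seqP F g k) :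
    g k (F m x) = g k x := by
  cases k with
  | zero => exact mn_eq h0 hadd hx hy
  | succ k => exact mn_eq h0 hadd hx hy

/-- a complete section with few returns -/
lemma exists_section [MeasurableSpace X] [StandardBorelSpace X]
    (lam : Measure X) [SigmaFinite lam] {F : ℤ → X → X} (hF : ∀ m, Measurable (F m))
    (h0 : ∀ x, F 0 x = x) (hadd : ∀ a b x, F (a + b) x = F a (F b x))
    (hap : ∀ᵐ x ∂lam, ∀ n : ℕ, 1 ≤ n → F (-n) x ≠ x) (δ : ℝ≥0∞) (hδ : δ ≠ 0) :
    ∃ P : Set X, MeasurableSet P ∧ (∀ x, ∃ m, F m x ∈ P) ∧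
      lam {y | y ∈ P ∧ ∃ n : ℕ, 1 ≤ n ∧ F (-n) y ∈ P} < δ := by
  classical
  obtain ⟨f, hf, hfi⟩ := MeasurableSpace.measurable_injection_nat_bool_of_countablySeparated X
  let idx : X → ℕ := spanningSetsIndex lam
  have hidx : Measurable idx := measurableSet_spanningSetsIndex lam
  let g : ℕ → X → ℕ := fun k => match k with
    | 0 => idx
    | k + 1 => fun x => (f x k).toNat
  have hg : ∀ k, Measurable (g k) := by
    intro k
    cases k with
    | zero => exact hidx
    | succ k => exact (measurable_of_countable Bool.toNat).comp ((measurable_pi_apply k).comp hf)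
  let Pk := seqP F g
  have hPk : ∀ k, MeasurableSet (Pk k) := seqP_meas hF hg
  let Q := ⋂ k, Pk k
  have hQ : MeasurableSet Q := MeasurableSet.iInter hPk
  let sQ := ⋃ m : ℤ, F m ⁻¹' Q
  have hsQ : MeasurableSet sQ := MeasurableSet.iUnion fun m => hF m hQ
  have hQuniq : ∀ x m, x ∈ Q → F m x ∈ Q → F m x = x := by
    intro x m hx hy
    apply hfi
    funext k
    have := seqP_eq (k := k + 1) h0 hadd (mem_iInter.1 hx (k + 1)) (mem_iInter.1 hy (k + 1))
    have hinj : ∀ a b : Bool, a.toNat = b.toNat → a = b := by decide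
    exact hinj _ _ this
  let S : ℕ → Set X := fun n => idx ⁻¹' {n}
  have hS : ∀ n, MeasurableSet (S n) := fun n => hidx (measurableSet_singleton n)
  have hSfin : ∀ n, lam (S n) < ∞ := fun n => by
    refine lt_of_le_of_lt (measure_mono ?_) (measure_spanningSets_lt_top lam n)
    rintro x rfl
    exact mem_spanningSetsIndex lam x
  obtain ⟨d, hd, hdsum⟩ := ENNReal.exists_pos_sum_of_countable' hδ ℕ
  have hk : ∀ n, ∃ k, lam ((Pk k ∩ S n) \ sQ) < d n := by
    intro n
    have ht : Filter.Tendsto (fun k => lam ((Pk k ∩ S n) \ sQ)) Filter.atTop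
        (nhds (lam (⋂ k, (Pk k ∩ S n) \ sQ))) := by
      apply tendsto_measure_iInter_atTop
      · exact fun k => (((hPk k).inter (hS n)).diff hsQ).nullMeasurableSet
      · intro a b hab x hx
        exact ⟨⟨seqP_anti F g hab hx.1.1, hx.1.2⟩, hx.2⟩
      · exact ⟨0, ((measure_mono (fun x hx => hx.1.2)).trans_lt (hSfin n)).ne⟩
    have he : (⋂ k, (Pk k ∩ S n) \ sQ) = ∅ := by
      ext x
      simp only [mem_iInter, mem_empty_iff_false, iff_false]
      intro h
      apply (h 0).2
      refine mem_iUnion.2 ⟨0, ?_⟩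
      rw [mem_preimage, h0]
      exact mem_iInter.2 fun k => (h k).1.1
    rw [he, measure_empty] at ht
    exact (ht.eventually (gt_mem_nhds (hd n))).exists
  choose k hk using hk
  let R := ⋃ n, (Pk (k n) ∩ S n) \ sQ
  have hR : MeasurableSet R :=
    MeasurableSet.iUnion fun n => ((hPk _).inter (hS n)).diff hsQ
  refine ⟨Q ∪ R, hQ.union hR, ?_, ?_⟩
  · intro x
    by_cases hx : x ∈ sQ
    · obtain ⟨m, hm⟩ := mem_iUnion.1 hx
      exact ⟨m, Or.inl hm⟩
    · obtain ⟨m, hm⟩ := seqP_hit hadd g x 0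
      obtain ⟨j, hj⟩ := seqP_hit hadd g (F m x) (k (idx (F m x)))
      refine ⟨j + m, Or.inr (mem_iUnion.2 ⟨idx (F m x), ⟨?_, ?_⟩, ?_⟩)⟩
      · rw [hadd]; exact hj
      · rw [hadd]
        exact seqP_eq (k := 0) h0 hadd hm (seqP_anti F g (Nat.zero_le _) hj)
      · intro h
        obtain ⟨l, hl⟩ := mem_iUnion.1 h
        apply hx
        refine mem_iUnion.2 ⟨l + (j + m), ?_⟩
        rw [mem_preimage, hadd]; exact hl
  · have hsub : {y | y ∈ Q ∪ R ∧ ∃ n : ℕ, 1 ≤ n ∧ F (-n) y ∈ Q ∪ R} ⊆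
        {x | ¬ ∀ n : ℕ, 1 ≤ n → F (-n) x ≠ x} ∪ R := by
      rintro y ⟨hy | hy, n, hn, hn'⟩
      · left
        intro hall
        rcases hn' with hn' | hn'
        · exact hall n hn (hQuniq _ _ hy hn')
        · obtain ⟨i, hi⟩ := mem_iUnion.1 hn'
          apply hi.2
          refine mem_iUnion.2 ⟨n, ?_⟩
          rw [mem_preimage, ← hadd, add_neg_cancel, h0]; exact hy
      · exact Or.inr hy
    calc _ ≤ _ := measure_mono hsub
      _ ≤ lam {x | ¬ ∀ n : ℕ, 1 ≤ n → F (-n) x ≠ x} + lam R := measure_union_le _ _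
      _ = lam R := by rw [ae_iff.1 hap, zero_add]
      _ ≤ ∑' n, lam ((Pk (k n) ∩ S n) \ sQ) := measure_iUnion_le _
      _ ≤ ∑' n, d n := ENNReal.tsum_le_tsum fun n => (hk n).le
      _ < δ := hdsum

lemma exists_phase [MeasurableSpace X] {F : ℤ → X → X} (hF : ∀ m, Measurable (F m))
    (h0 : ∀ x, F 0 x = x) (hadd : ∀ a b x, F (a + b) x = F a (F b x))
    {P : Set X} (hP : MeasurableSet P) (hc : ∀ x, ∃ m, F m x ∈ P) :
    ∃ c : X → ℤ, Measurable c ∧ ∀ x,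
      ¬ (F 1 x ∈ P ∧ ∃ n : ℕ, 1 ≤ n ∧ F (-n) (F 1 x) ∈ P) → c (F 1 x) = c x + 1 := by
  classical
  let past : X → Prop := fun x => ∃ j : ℕ, F (-j) x ∈ P
  have hpast : MeasurableSet {x | past x} := by
    have : {x | past x} = ⋃ j : ℕ, F (-j) ⁻¹' P := by ext x; simp [past]
    rw [this]
    exact MeasurableSet.iUnion fun j => hF _ hP
  let p : X → ℕ → Prop := fun x n => F (-n) x ∈ P ∨ ¬ past x
  let q : X → ℕ → Prop := fun x n => F n x ∈ P ∨ past x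
  have hp : ∀ x, ∃ n, p x n := by
    intro x
    by_cases h : past x
    · obtain ⟨j, hj⟩ := h
      exact ⟨j, Or.inl hj⟩
    · exact ⟨0, Or.inr h⟩
  have hq : ∀ x, ∃ n, q x n := by
    intro x
    by_cases h : past x
    · exact ⟨0, Or.inr h⟩
    · obtain ⟨m, hm⟩ := hc x
      obtain ⟨n, rfl | rfl⟩ := m.eq_nat_or_neg
      · exact ⟨n, Or.inl hm⟩
      · exact absurd ⟨n, hm⟩ h
  have ha : Measurable fun x => Nat.find (hp x) :=
    measurable_find hp fun n => (hF _ hP).union hpast.compl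
  have hb : Measurable fun x => Nat.find (hq x) :=
    measurable_find hq fun n => (hF _ hP).union hpast
  refine ⟨fun x => (Nat.find (hp x) : ℤ) - Nat.find (hq x),
    ((measurable_of_countable (fun n : ℕ => (n : ℤ))).comp ha).sub
      ((measurable_of_countable (fun n : ℕ => (n : ℤ))).comp hb), ?_⟩
  intro x hx
  have hs : ∀ m : ℤ, F m (F 1 x) = F (m + 1) x := fun m => (hadd _ _ _).symm
  have hback : ∀ j : ℕ, F (-((j + 1 : ℕ) : ℤ)) (F 1 x) = F (-j) x := by
    intro j
    rw [hs]; congr 1; push_cast; ring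
  by_cases h : past x
  · have h1 : past (F 1 x) := by
      obtain ⟨j, hj⟩ := h
      exact ⟨j + 1, by rw [hback]; exact hj⟩
    have hn : F 1 x ∉ P := by
      intro hn
      obtain ⟨j, hj⟩ := h
      exact hx ⟨hn, j + 1, by omega, by rw [hback]; exact hj⟩
    have e1 : Nat.find (hq x) = 0 := (Nat.find_eq_zero _).2 (Or.inr h)
    have e2 : Nat.find (hq (F 1 x)) = 0 := (Nat.find_eq_zero _).2 (Or.inr h1)
    have e3 : Nat.find (hp (F 1 x)) = Nat.find (hp x) + 1 := by
      rw [Nat.find_eq_iff]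
      constructor
      · left
        rw [hback]
        exact (Nat.find_spec (hp x)).resolve_right (not_not.2 h)
      · intro n hlt hpn
        have hpn := hpn.resolve_right (not_not.2 h1)
        cases n with
        | zero =>
          apply hn
          simpa [h0] using hpn
        | succ n =>
          rw [hback] at hpn
          exact Nat.find_min (hp x) (by omega) (Or.inl hpn)
    simp only [e1, e2, e3]
    push_cast; ring
  · have hf : ∃ m, F ((m + 1 : ℕ) : ℤ) x ∈ P ∧ Nat.find (hq x) = m + 1 := by
      have hsp := (Nat.find_spec (hq x)).resolve_right h
      cases hN : Nat.find (hq x) with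
      | zero =>
        rw [hN] at hsp
        exact absurd ⟨0, by simpa using hsp⟩ h
      | succ m =>
        rw [hN] at hsp
        exact ⟨m, hsp, rfl⟩
    obtain ⟨m, hm, hm'⟩ := hf
    have e1 : Nat.find (hp x) = 0 := (Nat.find_eq_zero _).2 (Or.inr h)
    have hmin : ∀ j < m, F ((j + 1 : ℕ) : ℤ) x ∉ P := fun j hj hjP =>
      Nat.find_min (hq x) (m := j + 1) (by omega) (Or.inl hjP)
    by_cases hn : F 1 x ∈ P
    · have hm0 : m = 0 := by
        by_contra hne
        exact hmin 0 (by omega) (by simpa using hn)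
      have h1 : past (F 1 x) := ⟨0, by simpa [h0] using hn⟩
      have e2 : Nat.find (hq (F 1 x)) = 0 := (Nat.find_eq_zero _).2 (Or.inr h1)
      have e3 : Nat.find (hp (F 1 x)) = 0 :=
        (Nat.find_eq_zero _).2 (Or.inl (by simpa [h0] using hn))
      simp only [e1, e2, e3, hm', hm0]
      norm_num
    · have h1 : ¬ past (F 1 x) := by
        rintro ⟨j, hj⟩
        cases j with
        | zero => exact hn (by simpa [h0] using hj)
        | succ j => rw [hback] at hj; exact h ⟨j, hj⟩
      have e2 : Nat.find (hp (F 1 x)) = 0 := (Nat.find_eq_zero _).2 (Or.inr h1)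
      have hs' : ∀ j : ℕ, F j (F 1 x) = F ((j + 1 : ℕ) : ℤ) x := by
        intro j; rw [hs]; congr 1
      have e3 : Nat.find (hq (F 1 x)) = m := by
        rw [Nat.find_eq_iff]
        constructor
        · left; rw [hs']; exact hm
        · intro n hlt hqn
          have hqn := hqn.resolve_right h1
          rw [hs'] at hqn
          exact hmin n hlt hqn
      simp only [e1, e2, e3, hm']
      push_cast; ring

lemma main [MeasurableSpace X] [StandardBorelSpace X]
    (lam : Measure X) [SigmaFinite lam] {F : ℤ → X → X}
    (hF : ∀ m, MeasurePreserving (F m) lam lam)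
    (h0 : ∀ x, F 0 x = x) (hadd : ∀ a b x, F (a + b) x = F a (F b x))
    (hap : ∀ᵐ x ∂lam, ∀ n : ℕ, 1 ≤ n → F (-n) x ≠ x) (N : ℕ) (hN : 1 ≤ N)
    (ε : ℝ≥0∞) (hε : 0 < ε) : ∃ A : Set X, MeasurableSet A ∧
      (∀ i j : ℕ, i < N → j < N → i ≠ j → Disjoint (F i '' A) (F j '' A)) ∧
      lam (univ \ ⋃ (k : ℕ) (_ : k < N), F k '' A) < ε := by
  have hFm : ∀ m, Measurable (F m) := fun m => (hF m).measurable
  let I : Finset ℤ := Finset.Ioo (-(N : ℤ)) N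
  have hI : (0 : ℤ) ∈ I := by simp [I]; omega
  have hcard : (I.card : ℝ≥0∞) ≠ 0 := by
    exact_mod_cast (Finset.card_pos.2 ⟨0, hI⟩).ne'
  obtain ⟨P, hP, hPc, hPm⟩ := exists_section lam hFm h0 hadd hap (ε / I.card)
    (ENNReal.div_pos hε.ne' (ENNReal.natCast_ne_top _)).ne'
  obtain ⟨c, hcm, hc⟩ := exists_phase hFm h0 hadd hP hPc
  set B : Set X := {y | y ∈ P ∧ ∃ n : ℕ, 1 ≤ n ∧ F (-n) y ∈ P} with hBdef
  have hB : MeasurableSet B := by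
    have : B = P ∩ ⋃ n : ℕ, ⋃ _ : 1 ≤ n, F (-n) ⁻¹' P := by ext x; simp [B]
    rw [this]
    exact hP.inter (MeasurableSet.iUnion fun n => MeasurableSet.iUnion fun _ => hFm _ hP)
  have hc1 : ∀ x, F 1 x ∉ B → c (F 1 x) = c x + 1 := hc
  have hci : ∀ (i : ℕ) x, (∀ j : ℕ, 1 ≤ j → j ≤ i → F j x ∉ B) → c (F i x) = c x + i := by
    intro i x
    induction i with
    | zero => intro _; simp [h0]
    | succ i ih =>
      intro h
      have e : F ((i + 1 : ℕ) : ℤ) x = F 1 (F i x) := by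
        rw [← hadd]; congr 1; push_cast; ring
      rw [e, hc1, ih (fun j h1 h2 => h j h1 (by omega))]
      · push_cast; ring
      · rw [← e]; exact h _ (by omega) le_rfl
  let A : Set X := {x | (N : ℤ) ∣ c x ∧ ∀ i : ℕ, 1 ≤ i → i < N → F i x ∉ B}
  have hA : MeasurableSet A := by
    have : A = c ⁻¹' {z | (N : ℤ) ∣ z} ∩ ⋂ i : ℕ, ⋂ _ : 1 ≤ i, ⋂ _ : i < N, (F i ⁻¹' B)ᶜ := by
      ext x; simp [A]
    rw [this]
    exact (hcm (MeasurableSet.of_discrete)).inter (MeasurableSet.iInter fun i =>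
      MeasurableSet.iInter fun _ => MeasurableSet.iInter fun _ => (hFm _ hB).compl)
  have key : ∀ i : ℕ, i < N → ∀ x ∈ A, (N : ℤ) ∣ c (F i x) - i := by
    intro i hi x hx
    rw [hci i x (fun j h1 h2 => hx.2 j h1 (by omega))]
    simpa using hx.1
  refine ⟨A, hA, ?_, ?_⟩
  · intro i j hi hj hij
    rw [Set.disjoint_left]
    rintro _ ⟨x, hx, rfl⟩ ⟨y, hy, hxy⟩
    have h1 := key i hi x hx
    have h2 := key j hj y hy
    rw [hxy] at h2
    have h3 : (N : ℤ) ∣ (j : ℤ) - i := by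
      have := dvd_sub h1 h2
      ring_nf at this ⊢
      rwa [add_comm, ← sub_eq_add_neg, ] at this ⊢
    have h4 := Int.eq_zero_of_abs_lt_dvd h3 (by rw [abs_lt]; constructor <;> omega)
    omega
  · have hsub : (univ \ ⋃ (k : ℕ) (_ : k < N), F k '' A) ⊆ ⋃ l ∈ I, F l ⁻¹' B := by
      intro x hx
      by_contra hcon
      have hcon' : ∀ l : ℤ, -(N : ℤ) < l → l < N → F l x ∉ B := by
        intro l h1 h2 h3
        exact hcon (mem_iUnion₂.2 ⟨l, Finset.mem_Ioo.2 ⟨h1, h2⟩, h3⟩)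
      apply hx.2
      have hNpos : (0 : ℤ) < N := by omega
      obtain ⟨r, hr⟩ := Int.eq_ofNat_of_zero_le (Int.emod_nonneg (c x) hNpos.ne')
      have hrN : r < N := by
        have := Int.emod_lt_of_pos (c x) hNpos
        omega
      have hxy : F r (F (-r) x) = x := by rw [← hadd, add_neg_cancel, h0]
      have hj : ∀ j : ℕ, 1 ≤ j → j < N → F j (F (-r) x) ∉ B := by
        intro j h1 h2
        rw [← hadd]
        exact hcon' _ (by omega) (by omega)
      refine mem_iUnion₂.2 ⟨r, hrN, F (-r) x, ⟨?_, hj⟩, hxy⟩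
      have := hci r (F (-r) x) (fun j h1 h2 => hj j h1 (by omega))
      rw [hxy] at this
      have h5 : c (F (-r) x) = c x - c x % N := by rw [hr, this]; simp
      rw [h5]
      exact Int.dvd_self_sub_emod
    calc _ ≤ _ := measure_mono hsub
      _ ≤ ∑ l ∈ I, lam (F l ⁻¹' B) := measure_biUnion_finset_le _ _
      _ = I.card * lam B := by
        rw [Finset.sum_congr rfl fun l _ => (hF l).measure_preimage hB.nullMeasurableSet]
        simp
      _ < ε := by
        rw [mul_comm]
        exact ENNReal.mul_lt_of_lt_div hPm

end RokhlinAux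

/-- The Rokhlin lemma for infinite measure-preserving bijections. -/
theorem rokhlin_infinite_measure
    [MeasurableSpace X] [StandardBorelSpace X]
    (lam : Measure X) [SigmaFinite lam] [NullSingletonClass lam] (hX : lam univ = ∞)
    (T : X ≃ᵐ X) (hT : MeasurePreserving (⇑T) lam lam) (hap : Aperiodic lam T) :
    ∀ N : ℕ, 1 ≤ N → ∀ ε : ℝ≥0∞, 0 < ε → ∃ A : Set X, MeasurableSet A ∧
      (∀ i j : ℕ, i < N → j < N → i ≠ j → Disjoint ((⇑T)^[i] '' A) ((⇑T)^[j] '' A)) ∧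
      lam (univ \ ⋃ (k : ℕ) (_ : k < N), (⇑T)^[k] '' A) < ε := by
  intro N hN ε hε
  let e : Equiv.Perm X := T.toEquiv
  let F : ℤ → X → X := fun m => ⇑(e ^ m)
  have hnat : ∀ n : ℕ, F n = (⇑T)^[n] := by
    intro n
    simp only [F, zpow_natCast, Equiv.Perm.coe_pow]
    rfl
  have hneg : ∀ n : ℕ, F (-n) = (⇑T.symm)^[n] := by
    intro n
    simp only [F, zpow_neg, zpow_natCast, ← inv_pow, Equiv.Perm.coe_pow]
    rfl
  have h0 : ∀ x, F 0 x = x := fun x => by simp [F]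
  have hadd : ∀ a b x, F (a + b) x = F a (F b x) := fun a b x => by
    simp [F, zpow_add]
  have hF : ∀ m, MeasurePreserving (F m) lam lam := by
    intro m
    obtain ⟨n, rfl | rfl⟩ := m.eq_nat_or_neg
    · rw [hnat]; exact hT.iterate n
    · rw [hneg]; exact (hT.symm T).iterate n
  have hap' : ∀ᵐ x ∂lam, ∀ n : ℕ, 1 ≤ n → F (-n) x ≠ x := by
    filter_upwards [hap] with x hx n hn h
    apply hx n hn
    rw [← hnat]
    conv_lhs => rw [← h]
    rw [← hadd, add_neg_cancel, h0]
  have := RokhlinAux.main lam hF h0 hadd hap' N hN ε hε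
  simpa only [hnat] using this
end

section
/- Let (X, λ) be a standard Borel space with an atomless σ-finite measure satisfying λ(X) = ∞, let T₁, T₂ ∈ Aut(X, λ) be aperiodic, and let μ be a probability measure on X equivalent to λ (i.e., μ and λ have the same null sets). Then for every ε > 0 there exists S ∈ Aut(X, λ) such that μ({x ∈ X : S T₁ S⁻¹(x) ≠ T₂(x)}) < ε. -/
open MeasureTheory Set
open scoped ENNReal

variable {X : Type*}

lemma aux_cdf (m : Measure ℝ) [NullSingletonClass m] (hfin : ∀ t, m (Iic t) < ∞) (c : ℝ) :
    m {x | (m (Iic x)).toReal ≤ c} = min (ENNReal.ofReal c) (m univ) := by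
  set J : Set ℝ := {x | (m (Iic x)).toReal ≤ c} with hJ
  have hmono : ∀ x y, x ≤ y → (m (Iic x)).toReal ≤ (m (Iic y)).toReal := fun x y h =>
    ENNReal.toReal_mono (hfin y).ne (measure_mono (Iic_subset_Iic.2 h))
  have hlow : ∀ x y, x ≤ y → y ∈ J → x ∈ J := fun x y h hy => (hmono x y h).trans hy
  have hle : ∀ x ∈ J, m (Iic x) ≤ ENNReal.ofReal c := fun x hx =>
    (ENNReal.le_ofReal_iff_toReal_le (hfin x).ne (ENNReal.toReal_nonneg.trans hx)).2 hx
  have hge : ∀ x ∉ J, ENNReal.ofReal c ≤ m (Iic x) := fun x hx => by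
    have : c < (m (Iic x)).toReal := not_le.1 hx
    exact ENNReal.ofReal_le_of_le_toReal this.le
  have htop : Filter.Tendsto (fun n : ℕ => m (Iic (n:ℝ))) Filter.atTop (nhds (m univ)) :=
    (tendsto_measure_Iic_atTop m).comp tendsto_natCast_atTop_atTop
  by_cases h1 : J = univ
  · have : m univ ≤ ENNReal.ofReal c := le_of_tendsto' htop (fun n => hle _ (h1 ▸ mem_univ _))
    rw [h1, min_eq_right this]
  obtain ⟨b, hb⟩ := (ne_univ_iff_exists_notMem J).1 h1
  have hcu : ENNReal.ofReal c ≤ m univ := (hge b hb).trans (measure_mono (subset_univ _))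
  rw [min_eq_left hcu]
  rcases J.eq_empty_or_nonempty with h2 | h2
  · rw [h2, measure_empty]
    have : Filter.Tendsto (fun n : ℕ => m (Iic (-(n:ℝ)))) Filter.atTop (nhds (m (⋂ n : ℕ, Iic (-(n:ℝ))))) := by
      apply tendsto_measure_iInter_atTop
      · intro i; exact measurableSet_Iic.nullMeasurableSet
      · intro i j hij; exact Iic_subset_Iic.2 (by simpa using hij)
      · exact ⟨0, (hfin _).ne⟩
    have he : (⋂ n : ℕ, Iic (-(n:ℝ))) = ∅ := by
      ext x; simp only [mem_iInter, mem_Iic, mem_empty_iff_false, iff_false, not_forall, not_le]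
      obtain ⟨n, hn⟩ := exists_nat_gt (-x)
      exact ⟨n, by linarith⟩
    rw [he, measure_empty] at this
    exact (le_antisymm (ge_of_tendsto' this (fun n => hge _ (h2 ▸ notMem_empty _))) bot_le).symm
  have hbdd : BddAbove J := ⟨b, fun x hx => by
    by_contra h; exact hb (hlow _ _ (not_le.1 h).le hx)⟩
  set s := sSup J
  have hs1 : ∀ x < s, x ∈ J := fun x hx => by
    obtain ⟨y, hy, hxy⟩ := exists_lt_of_lt_csSup h2 hx
    exact hlow _ _ hxy.le hy
  have hs2 : J ⊆ Iic s := fun x hx => le_csSup hbdd hx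
  have hs3 : ∀ x, s < x → x ∉ J := fun x hx h => absurd (hs2 h) (not_le.2 hx)
  have hI : m (Iio s) = m (Iic s) := measure_congr Iio_ae_eq_Iic
  have hJs : m J = m (Iic s) := le_antisymm (measure_mono hs2)
    (hI ▸ measure_mono (fun x hx => hs1 x hx))
  rw [hJs]
  obtain ⟨u, hu, hu', hut⟩ := exists_seq_strictAnti_tendsto (0:ℝ)
  apply le_antisymm
  · have : Filter.Tendsto (fun n : ℕ => m (Iic (s - u n))) Filter.atTop (nhds (m (⋃ n : ℕ, Iic (s - u n)))) := by
      apply tendsto_measure_iUnion_atTop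
      intro i j hij; exact Iic_subset_Iic.2 (by have := hu.antitone hij; linarith)
    have he : (⋃ n : ℕ, Iic (s - u n)) = Iio s := by
      ext x; simp only [mem_iUnion, mem_Iic, mem_Iio]
      constructor
      · rintro ⟨n, hn⟩; have := hu' n; linarith
      · intro h
        obtain ⟨n, hn⟩ := (hut.eventually (gt_mem_nhds (show 0 < s - x by linarith))).exists
        exact ⟨n, by linarith⟩
    rw [he, hI] at this
    exact le_of_tendsto' this (fun n => hle _ (hs1 _ (by have := hu' n; linarith)))
  · have : Filter.Tendsto (fun n : ℕ => m (Iic (s + u n))) Filter.atTop (nhds (m (⋂ n : ℕ, Iic (s + u n)))) := by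
      apply tendsto_measure_iInter_atTop
      · intro i; exact measurableSet_Iic.nullMeasurableSet
      · intro i j hij; exact Iic_subset_Iic.2 (by have := hu.antitone hij; linarith)
      · exact ⟨0, (hfin _).ne⟩
    have he : (⋂ n : ℕ, Iic (s + u n)) = Iic s := by
      ext x; simp only [mem_iInter, mem_Iic]
      constructor
      · intro h
        by_contra hx
        obtain ⟨n, hn⟩ := (hut.eventually (gt_mem_nhds (show 0 < x - s by linarith))).exists
        have := h n
        linarith
      · intro h n; have := hu' n; linarith
    rw [he] at this
    exact ge_of_tendsto' this (fun n => hge _ (hs3 _ (by have := hu' n; linarith)))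

lemma aux_A [MeasurableSpace X] [StandardBorelSpace X] (ν : Measure X) [SigmaFinite ν]
    [NullSingletonClass ν] : ∃ (f : X → ℝ) (G : Set X), Measurable f ∧ MeasurableSet G ∧
      ν Gᶜ = 0 ∧ InjOn f G ∧ ∀ c : ℝ, ν (f ⁻¹' Iic c) = min (ENNReal.ofReal c) (ν univ) := by
  set g : X → ℝ := fun x => (spanningSetsIndex ν x : ℝ) + Real.sigmoid (embeddingReal X x) with hg
  have hgm : Measurable g := by
    apply Measurable.add
    · exact measurable_from_top.comp (measurableSet_spanningSetsIndex ν)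
    · exact Real.sigmoid_monotone.measurable.comp (measurableEmbedding_embeddingReal X).measurable
  have hginj : Function.Injective g := by
    intro x y h
    simp only [hg] at h
    have h1 := Real.sigmoid_pos (embeddingReal X x)
    have h2 := Real.sigmoid_lt_one (embeddingReal X x)
    have h3 := Real.sigmoid_pos (embeddingReal X y)
    have h4 := Real.sigmoid_lt_one (embeddingReal X y)
    have h5 : spanningSetsIndex ν x = spanningSetsIndex ν y := by
      apply le_antisymm
      · apply Nat.lt_succ_iff.1
        have : (spanningSetsIndex ν x : ℝ) < (spanningSetsIndex ν y : ℝ) + 1 := by linarith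
        exact_mod_cast this
      · apply Nat.lt_succ_iff.1
        have : (spanningSetsIndex ν y : ℝ) < (spanningSetsIndex ν x : ℝ) + 1 := by linarith
        exact_mod_cast this
    rw [h5] at h
    exact (measurableEmbedding_embeddingReal X).injective (Real.sigmoid_injective (by linarith))
  set m := ν.map g with hm
  have : NullSingletonClass m := ⟨fun t => by
    rw [hm, Measure.map_apply hgm (measurableSet_singleton t)]
    exact (Set.subsingleton_singleton.preimage hginj).measure_zero ν⟩
  have hfin : ∀ t, m (Iic t) < ∞ := fun t => by
    rw [hm, Measure.map_apply hgm measurableSet_Iic]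
    refine lt_of_le_of_lt (measure_mono ?_) (measure_spanningSets_lt_top ν ⌊t⌋₊)
    intro x hx
    apply mem_spanningSets_of_index_le
    apply Nat.le_floor
    have h1 := Real.sigmoid_pos (embeddingReal X x)
    have : g x ≤ t := hx
    simp only [hg] at this
    linarith
  set F : ℝ → ℝ := fun x => (m (Iic x)).toReal with hF
  have hFmono : Monotone F := fun x y h =>
    ENNReal.toReal_mono (hfin y).ne (measure_mono (Iic_subset_Iic.2 h))
  have hd : ∀ c : ℝ, ν ((F ∘ g) ⁻¹' Iic c) = min (ENNReal.ofReal c) (ν univ) := fun c => by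
    have h1 := aux_cdf m hfin c
    have h2 : m univ = ν univ := by rw [hm, Measure.map_apply hgm MeasurableSet.univ, preimage_univ]
    rw [h2] at h1
    rw [← h1]
    exact (Measure.map_apply hgm (hFmono.measurable measurableSet_Iic)).symm
  have hfm : Measurable (F ∘ g) := hFmono.measurable.comp hgm
  have hnull : ∀ c : ℝ, ν ((F ∘ g) ⁻¹' {c}) = 0 := fun c => by
    by_contra h
    have hle : ∀ n : ℕ, ν ((F ∘ g) ⁻¹' {c}) ≤ ENNReal.ofReal (1 / ((n:ℝ) + 1)) := fun n => by
      set d : ℝ := 1 / ((n:ℝ) + 1)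
      have hdpos : 0 < d := by positivity
      have hdis : ν ((F ∘ g) ⁻¹' {c}) + ν ((F ∘ g) ⁻¹' Iic (c - d)) ≤ ν ((F ∘ g) ⁻¹' Iic c) := by
        rw [← measure_union]
        · apply measure_mono
          rw [← preimage_union]
          apply preimage_mono
          rintro x (hx | hx)
          · exact (mem_singleton_iff.1 hx).le
          · exact le_trans (mem_Iic.1 hx) (by linarith)
        · apply Disjoint.preimage
          rw [Set.disjoint_singleton_left]
          simp [hdpos]
        · exact hfm measurableSet_Iic
      rw [hd, hd] at hdis
      have hne : min (ENNReal.ofReal (c - d)) (ν univ) ≠ ∞ :=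
        (lt_of_le_of_lt (min_le_left _ _) ENNReal.ofReal_lt_top).ne
      have : min (ENNReal.ofReal c) (ν univ) ≤ ENNReal.ofReal d + min (ENNReal.ofReal (c - d)) (ν univ) := by
        rcases min_cases (ENNReal.ofReal (c - d)) (ν univ) with ⟨h, -⟩ | ⟨h, -⟩ <;> rw [h]
        · refine (min_le_left _ _).trans ?_
          have := ENNReal.ofReal_add_le (p := d) (q := c - d)
          simpa using this
        · exact (min_le_right _ _).trans le_add_self
      exact (ENNReal.add_le_add_iff_right hne).1 (hdis.trans this)
    have hlim : Filter.Tendsto (fun n : ℕ => ENNReal.ofReal (1 / ((n:ℝ) + 1))) Filter.atTop (nhds 0) := by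
      have := ENNReal.tendsto_ofReal (tendsto_one_div_add_atTop_nhds_zero_nat (𝕜 := ℝ))
      simpa using this
    exact h (le_antisymm (ge_of_tendsto' hlim hle) bot_le)
  refine ⟨F ∘ g, (⋃ q : ℚ, (F ∘ g) ⁻¹' {F q})ᶜ, hfm, ?_, ?_, ?_, hd⟩
  · exact (MeasurableSet.iUnion fun q => hfm (measurableSet_singleton _)).compl
  · rw [compl_compl]
    exact measure_iUnion_null fun q => hnull _
  · have key : ∀ x y, x ∉ (⋃ q : ℚ, (F ∘ g) ⁻¹' {F q}) → F (g x) = F (g y) → ¬ g x < g y := by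
      intro x y hx h hlt
      obtain ⟨q, hq1, hq2⟩ := exists_rat_btwn hlt
      apply hx
      rw [mem_iUnion]
      exact ⟨q, le_antisymm (hFmono hq1.le) ((hFmono hq2.le).trans h.ge)⟩
    intro x hx y hy h
    exact hginj (le_antisymm (not_lt.1 (key y x hy h.symm)) (not_lt.1 (key x y hx h)))

lemma aux_B [MeasurableSpace X] [StandardBorelSpace X] [Nonempty X] (lam : Measure X) [SigmaFinite lam]
    [NullSingletonClass lam] (C C' : Set X) (hC : MeasurableSet C) (hC' : MeasurableSet C')
    (hCC : lam C = lam C') : ∃ (ψ : X → X) (G : Set X), Measurable ψ ∧ MeasurableSet G ∧ G ⊆ C ∧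
      lam (C \ G) = 0 ∧ InjOn ψ G ∧ ψ '' G ⊆ C' ∧ lam (C' \ ψ '' G) = 0 ∧
      ∀ E ⊆ G, MeasurableSet E → lam (ψ '' E) = lam E := by
  obtain ⟨f₁, H₁, hf₁, hH₁, hn₁, hi₁, hd₁⟩ := aux_A (lam.restrict C)
  obtain ⟨f₂, H₂, hf₂, hH₂, hn₂, hi₂, hd₂⟩ := aux_A (lam.restrict C')
  have hκ : (lam.restrict C).map f₁ = (lam.restrict C').map f₂ := by
    have hI : ∀ c, (lam.restrict C).map f₁ (Iic c) = (lam.restrict C').map f₂ (Iic c) := fun c => by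
      rw [Measure.map_apply hf₁ measurableSet_Iic, Measure.map_apply hf₂ measurableSet_Iic, hd₁, hd₂]
      simp [hCC]
    have hfi : ∀ c, (lam.restrict C).map f₁ (Iic c) ≠ ∞ := fun c => by
      rw [Measure.map_apply hf₁ measurableSet_Iic, hd₁]
      exact (lt_of_le_of_lt (min_le_left _ _) ENNReal.ofReal_lt_top).ne
    apply Measure.ext_of_Ioc'
    · intro a b _
      exact (lt_of_le_of_lt (measure_mono Ioc_subset_Iic_self) (hfi b).lt_top).ne
    · intro a b hab
      rw [← Iic_sdiff_Iic, measure_sdiff (Iic_subset_Iic.2 hab.le) measurableSet_Iic.nullMeasurableSet (hfi a),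
        measure_sdiff (Iic_subset_Iic.2 hab.le) measurableSet_Iic.nullMeasurableSet (hI a ▸ hfi a), hI, hI]
  have hmap : ∀ Q, MeasurableSet Q → lam (f₁ ⁻¹' Q ∩ C) = lam (f₂ ⁻¹' Q ∩ C') := fun Q hQ => by
    have := congrArg (fun m => m Q) hκ
    simpa [Measure.map_apply hf₁ hQ, Measure.map_apply hf₂ hQ, Measure.restrict_apply (hf₁ hQ),
      Measure.restrict_apply (hf₂ hQ)] using this
  rw [Measure.restrict_apply hH₁.compl] at hn₁
  rw [Measure.restrict_apply hH₂.compl] at hn₂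
  set G₁ := H₁ ∩ C with hG₁
  set G₂ := H₂ ∩ C' with hG₂
  have hG₁m : MeasurableSet G₁ := hH₁.inter hC
  have hG₂m : MeasurableSet G₂ := hH₂.inter hC'
  have hG₂i : InjOn f₂ G₂ := hi₂.mono inter_subset_left
  have hG₁i : InjOn f₁ G₁ := hi₁.mono inter_subset_left
  have hQm : MeasurableSet (f₂ '' G₂) := hG₂m.image_of_measurable_injOn hf₂ hG₂i
  have : StandardBorelSpace G₂ := hG₂m.standardBorel
  have hemb : MeasurableEmbedding (fun y : G₂ => f₂ y) :=
    (hf₂.comp measurable_subtype_coe).measurableEmbedding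
      (fun x y h => Subtype.ext (hG₂i x.2 y.2 h))
  obtain ⟨h, hh, hhe⟩ := hemb.exists_measurable_extend (g := fun y : G₂ => (y : X))
    measurable_subtype_coe (fun _ => inferInstance)
  have hh' : ∀ y ∈ G₂, h (f₂ y) = y := fun y hy => congrFun hhe ⟨y, hy⟩
  set G := G₁ ∩ f₁ ⁻¹' (f₂ '' G₂) with hG
  have hGm : MeasurableSet G := hG₁m.inter (hf₁ hQm)
  have hf₂h : ∀ x ∈ G, h (f₁ x) ∈ G₂ ∧ f₂ (h (f₁ x)) = f₁ x := by
    rintro x ⟨-, y, hy, hyx⟩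
    rw [← hyx, hh' y hy]; exact ⟨hy, rfl⟩
  have himg : ∀ E ⊆ G, (h ∘ f₁) '' E = G₂ ∩ f₂ ⁻¹' (f₁ '' E) := by
    intro E hE
    ext y
    constructor
    · rintro ⟨x, hx, rfl⟩
      exact ⟨(hf₂h x (hE hx)).1, x, hx, (hf₂h x (hE hx)).2.symm⟩
    · rintro ⟨hy, x, hx, hxy⟩
      exact ⟨x, hx, by rw [Function.comp, hxy, hh' y hy]⟩
  have him : ∀ E ⊆ G, MeasurableSet E → MeasurableSet (f₁ '' E) := fun E hE hEm =>
    hEm.image_of_measurable_injOn hf₁ (hG₁i.mono (hE.trans inter_subset_left))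
  have hae2 : ∀ Q, lam (f₂ ⁻¹' Q ∩ C') = lam (G₂ ∩ f₂ ⁻¹' Q) := fun Q => by
    apply le_antisymm
    · calc lam (f₂ ⁻¹' Q ∩ C') ≤ lam ((G₂ ∩ f₂ ⁻¹' Q) ∪ (H₂ᶜ ∩ C')) := by
            apply measure_mono
            rintro x ⟨hx, hxC⟩
            by_cases hxH : x ∈ H₂
            · exact Or.inl ⟨⟨hxH, hxC⟩, hx⟩
            · exact Or.inr ⟨hxH, hxC⟩
        _ ≤ _ := (measure_union_le _ _).trans (by rw [hn₂, add_zero])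
    · exact measure_mono fun x hx => ⟨hx.2, hx.1.2⟩
  have hae1 : ∀ Q, lam (f₁ ⁻¹' Q ∩ C) = lam (G₁ ∩ f₁ ⁻¹' Q) := fun Q => by
    apply le_antisymm
    · calc lam (f₁ ⁻¹' Q ∩ C) ≤ lam ((G₁ ∩ f₁ ⁻¹' Q) ∪ (H₁ᶜ ∩ C)) := by
            apply measure_mono
            rintro x ⟨hx, hxC⟩
            by_cases hxH : x ∈ H₁
            · exact Or.inl ⟨⟨hxH, hxC⟩, hx⟩
            · exact Or.inr ⟨hxH, hxC⟩
        _ ≤ _ := (measure_union_le _ _).trans (by rw [hn₁, add_zero])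
    · exact measure_mono fun x hx => ⟨hx.2, hx.1.2⟩
  have hCG : lam (C \ G) = 0 := by
    have h0 : lam (f₁ ⁻¹' (f₂ '' G₂)ᶜ ∩ C) = 0 := by
      rw [hmap _ hQm.compl, hae2]
      convert measure_empty (μ := lam)
      ext y
      simp only [mem_inter_iff, mem_preimage, mem_compl_iff, mem_empty_iff_false, iff_false, not_and, not_not]
      exact fun hy => ⟨y, hy, rfl⟩
    refine measure_mono_null ?_ (measure_union_null hn₁ h0)
    rintro x ⟨hx, hxG⟩
    by_cases hxH : x ∈ H₁
    · exact Or.inr ⟨fun hq => hxG ⟨⟨hxH, hx⟩, hq⟩, hx⟩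
    · exact Or.inl ⟨hxH, hx⟩
  refine ⟨h ∘ f₁, G, hh.comp hf₁, hGm, fun x hx => hx.1.2, hCG, ?_, ?_, ?_, ?_⟩
  · intro x hx y hy hxy
    apply hG₁i hx.1 hy.1
    rw [← (hf₂h x hx).2, ← (hf₂h y hy).2]
    exact congrArg f₂ hxy
  · rintro _ ⟨x, hx, rfl⟩
    exact (hf₂h x hx).1.2
  · rw [himg G subset_rfl]
    have h0 : lam (f₂ ⁻¹' (f₁ '' G)ᶜ ∩ C') = 0 := by
      rw [← hmap _ (him G subset_rfl hGm).compl]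
      refine measure_mono_null ?_ hCG
      rintro x ⟨hx, hxC⟩
      exact ⟨hxC, fun hxG => hx ⟨x, hxG, rfl⟩⟩
    refine measure_mono_null ?_ (measure_union_null hn₂ h0)
    rintro x ⟨hx, hxG⟩
    by_cases hxH : x ∈ H₂
    · exact Or.inr ⟨fun hq => hxG ⟨⟨hxH, hx⟩, hq⟩, hx⟩
    · exact Or.inl ⟨hxH, hx⟩
  · intro E hE hEm
    rw [himg E hE, ← hae2, ← hmap _ (him E hE hEm), hae1]
    congr 1
    ext x
    constructor
    · rintro ⟨hx, y, hy, hyx⟩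
      rwa [← hG₁i (hE hy).1 hx hyx]
    · intro hx
      exact ⟨(hE hx).1, x, hx, rfl⟩

lemma aux_subset [MeasurableSpace X] [StandardBorelSpace X] (lam : Measure X) [SigmaFinite lam]
    [NullSingletonClass lam] (C : Set X) (hC : MeasurableSet C) (hCi : lam C = ∞) (a : ℝ≥0∞)
    (ha : a ≠ ∞) : ∃ B ⊆ C, MeasurableSet B ∧ lam B = a := by
  obtain ⟨f, H, hf, -, -, -, hd⟩ := aux_A (lam.restrict C)
  refine ⟨f ⁻¹' Iic a.toReal ∩ C, inter_subset_right, (hf measurableSet_Iic).inter hC, ?_⟩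
  rw [← Measure.restrict_apply (hf measurableSet_Iic), hd]
  simp [hCi, ha]

lemma aux_uncountable [MeasurableSpace X] [StandardBorelSpace X] (lam : Measure X) [SigmaFinite lam]
    (G : Set X) (hG : MeasurableSet G) (hGu : ¬ G.Countable) :
    ∃ N ⊆ G, MeasurableSet N ∧ ¬ N.Countable ∧ lam N = 0 := by
  have : StandardBorelSpace G := hG.standardBorel
  have h1 : ¬ Countable (ℝ × ℝ) := fun h => by
    have : Countable ℝ := (Function.LeftInverse.injective (f := fun x : ℝ => (x, x)) (g := Prod.fst) (fun _ => rfl)).countable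
    exact not_countable (α := ℝ) this
  have e : G ≃ᵐ ℝ × ℝ := PolishSpace.measurableEquivOfNotCountable (by simpa using hGu) h1
  set As : ℝ → Set X := fun t => Subtype.val '' (e ⁻¹' {p | p.1 = t}) with hAs
  have hm : ∀ t, MeasurableSet (As t) := fun t =>
    (MeasurableEmbedding.subtype_coe hG).measurableSet_image.2
      (e.measurable (measurable_fst (measurableSet_singleton t)))
  have hdj : Pairwise (Function.onFun Disjoint As) := by
    intro s t hst
    rw [Function.onFun, Set.disjoint_left]
    rintro _ ⟨x, hx, rfl⟩ ⟨y, hy, hxy⟩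
    rw [Subtype.ext hxy] at hy
    exact hst (hx.symm.trans hy)
  have hc := Measure.countable_meas_pos_of_disjoint_iUnion (μ := lam) hm hdj
  obtain ⟨t, ht⟩ : ∃ t, t ∉ {i | 0 < lam (As i)} := by
    by_contra! h
    have : {i | 0 < lam (As i)} = univ := eq_univ_of_forall h
    rw [this] at hc
    exact not_countable_univ hc
  refine ⟨As t, by rintro _ ⟨x, -, rfl⟩; exact x.2, hm t, ?_, by simpa using ht⟩
  intro hcount
  have h2 : (e ⁻¹' {p | p.1 = t}).Countable :=
    Set.countable_of_injective_of_countable_image Subtype.val_injective.injOn hcount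
  apply not_countable_univ (α := ℝ)
  have h3 := h2.image (fun x => (e x).2)
  refine h3.mono (fun s _ => ?_)
  exact ⟨e.symm (t, s), by simp, by simp⟩

lemma aux_C [MeasurableSpace X] [StandardBorelSpace X] (lam : Measure X) [SigmaFinite lam]
    [NullSingletonClass lam] (hX : lam univ = ∞) (R : X → X) (D : Set X) (hR : Measurable R)
    (hD : MeasurableSet D) (hD0 : lam Dᶜ = 0) (hi : InjOn R D) (hRD : lam (R '' D)ᶜ = 0)
    (hp : ∀ E ⊆ D, MeasurableSet E → lam (R '' E) = lam E) :
    ∃ S : X ≃ᵐ X, MeasurePreserving S lam lam ∧ ∀ᵐ x ∂lam, S x = R x := by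
  classical
  have hDu : ¬ D.Countable := fun h => by
    have h0 := h.measure_zero lam
    have := measure_union_null h0 hD0
    rw [union_compl_self, hX] at this
    exact ENNReal.top_ne_zero this
  obtain ⟨N, hND, hN, hNu, hN0⟩ := aux_uncountable lam D hD hDu
  set D' := D \ N with hD'
  have hD'm : MeasurableSet D' := hD.diff hN
  have hD'D : D' ⊆ D := sdiff_subset
  have hD'0 : lam D'ᶜ = 0 := by
    refine measure_mono_null ?_ (measure_union_null hD0 hN0)
    intro x hx
    by_cases h : x ∈ D
    · exact Or.inr (by by_contra hn; exact hx ⟨h, hn⟩)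
    · exact Or.inl h
  have hi' : InjOn R D' := hi.mono hD'D
  have hIm : MeasurableSet (R '' D') := hD'm.image_of_measurable_injOn hR hi'
  have : StandardBorelSpace D' := hD'm.standardBorel
  have : StandardBorelSpace (D'ᶜ : Set X) := hD'm.compl.standardBorel
  have : StandardBorelSpace ((R '' D')ᶜ : Set X) := hIm.compl.standardBorel
  have hu1 : ¬ Countable (D'ᶜ : Set X) := fun h => by
    have h1 : N ⊆ D'ᶜ := fun x hx hx' => hx'.2 hx
    exact hNu ((Set.countable_coe_iff.1 h).mono h1)
  have hu2 : ¬ Countable ((R '' D')ᶜ : Set X) := fun h => by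
    have h1 : (R '' N).Countable := (Set.countable_coe_iff.1 h).mono (by
      rintro _ ⟨x, hx, rfl⟩ ⟨y, hy, hxy⟩
      rw [hi (hD'D hy) (hND hx) hxy] at hy
      exact hy.2 hx)
    exact hNu (Set.countable_of_injective_of_countable_image (hi.mono hND) h1)
  have hemb : MeasurableEmbedding (fun y : D' => R y) :=
    (hR.comp measurable_subtype_coe).measurableEmbedding
      (fun x y h => Subtype.ext (hi' x.2 y.2 h))
  have hne : Nonempty D' := by
    by_contra hn
    have : D' = ∅ := Set.not_nonempty_iff_eq_empty.1 (fun ⟨x, hx⟩ => hn ⟨⟨x, hx⟩⟩)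
    rw [this, compl_empty, hX] at hD'0
    exact ENNReal.top_ne_zero hD'0
  obtain ⟨h, hh, hhe⟩ := hemb.exists_measurable_extend (g := (id : D' → D')) measurable_id (fun _ => hne)
  have hh' : ∀ y : D', h (R y) = y := fun y => congrFun hhe y
  let e1 : D' ≃ᵐ (R '' D' : Set X) :=
    { toFun := fun y => ⟨R y, y, y.2, rfl⟩
      invFun := fun z => h z
      left_inv := fun y => hh' y
      right_inv := by
        rintro ⟨_, y, hy, rfl⟩
        apply Subtype.ext
        change R (h (R y)) = R y
        rw [hh' ⟨y, hy⟩]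
      measurable_toFun := (hR.comp measurable_subtype_coe).subtype_mk
      measurable_invFun := hh.comp measurable_subtype_coe }
  let e2 := PolishSpace.measurableEquivOfNotCountable hu1 hu2
  let S : X ≃ᵐ X := (MeasurableEquiv.sumCompl hD'm).symm.trans
    ((MeasurableEquiv.sumCongr e1 e2).trans (MeasurableEquiv.sumCompl hIm))
  have hS : ∀ x ∈ D', S x = R x := fun x hx => by
    have : (MeasurableEquiv.sumCompl hD'm).symm x = Sum.inl ⟨x, hx⟩ := by
      rw [MeasurableEquiv.symm_apply_eq]; rfl
    simp only [S, MeasurableEquiv.trans_apply, this]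
    rfl
  have hae : ∀ᵐ x ∂lam, S x = R x := by
    refine measure_mono_null ?_ hD'0
    intro x hx hx'
    exact hx (hS x hx')
  refine ⟨S, ⟨S.measurable, ?_⟩, hae⟩
  ext E hE
  rw [Measure.map_apply S.measurable hE]
  have h1 : lam (S ⁻¹' E) = lam (R ⁻¹' E ∩ D) := by
    apply measure_congr
    have hDae : ∀ᵐ x ∂lam, x ∈ D := hD0
    filter_upwards [hae, hDae] with x hx hxD
    apply propext
    change S x ∈ E ↔ (R x ∈ E ∧ x ∈ D)
    rw [hx]; simp [hxD]
  rw [h1, ← hp _ inter_subset_right ((hR hE).inter hD), Set.image_preimage_inter, inter_comm]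
  apply measure_congr
  have hDae : ∀ᵐ x ∂lam, x ∈ R '' D := hRD
  filter_upwards [hDae] with x hx
  apply propext
  change (x ∈ R '' D ∧ x ∈ E) ↔ x ∈ E
  simp only [hx, true_and]

lemma aux_iter [MeasurableSpace X] (T : X ≃ᵐ X) (i : ℕ) (x : X) :
    (⇑T)^[i] ((⇑T.symm)^[i] x) = x :=
  (Function.RightInverse.iterate (f := T) (g := T.symm) T.apply_symm_apply i) x

lemma aux_iter' [MeasurableSpace X] (T : X ≃ᵐ X) (i : ℕ) (x : X) :
    (⇑T.symm)^[i] ((⇑T)^[i] x) = x :=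
  (Function.LeftInverse.iterate (f := T) (g := T.symm) T.symm_apply_apply i) x

lemma aux_iter_sub [MeasurableSpace X] (T : X ≃ᵐ X) (i m : ℕ) (h : i ≤ m) (x : X) :
    (⇑T)^[i] ((⇑T.symm)^[m] x) = (⇑T.symm)^[m - i] x := by
  obtain ⟨k, rfl⟩ := Nat.exists_eq_add_of_le h
  rw [Function.iterate_add_apply, aux_iter]; simp

lemma aux_marker [MeasurableSpace X] [StandardBorelSpace X] (lam : Measure X) (T : X ≃ᵐ X)
    (hap : Aperiodic lam T) (n : ℕ) (hn : 0 < n) : ∃ B : Set X, MeasurableSet B ∧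
      (∀ x ∈ B, ∀ j, 1 ≤ j → j < n → (⇑T)^[j] x ∉ B) ∧
      ∀ᵐ x ∂lam, ∃ j < n, (⇑T)^[j] x ∈ B ∨ (⇑T.symm)^[j] x ∈ B := by
  obtain ⟨u, hu⟩ := exists_surjective_nat (ℚ × ℚ)
  set e := embeddingReal X
  have he := measurableEmbedding_embeddingReal X
  set V : ℕ → Set X := fun k => e ⁻¹' Ioo ((u k).1 : ℝ) ((u k).2 : ℝ) with hV
  have hVm : ∀ k, MeasurableSet (V k) := fun k => he.measurable measurableSet_Ioo
  have hTi : ∀ j, Measurable ((⇑T)^[j]) := fun j => T.measurable.iterate j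
  have hTi' : ∀ j, Measurable ((⇑T.symm)^[j]) := fun j => T.symm.measurable.iterate j
  set C : ℕ → Set X := fun k => V k ∩ ⋂ j : ℕ, ⋂ _ : 1 ≤ j, ⋂ _ : j < n, ((⇑T)^[j]) ⁻¹' (V k)ᶜ with hC
  have hCm : ∀ k, MeasurableSet (C k) := fun k => (hVm k).inter
    (MeasurableSet.iInter fun j => MeasurableSet.iInter fun _ => MeasurableSet.iInter fun _ =>
      hTi j (hVm k).compl)
  have hCs : ∀ k x, x ∈ C k → ∀ j, 1 ≤ j → j < n → (⇑T)^[j] x ∉ V k := by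
    intro k x hx j h1 h2
    have := hx.2
    simp only [mem_iInter] at this
    exact this j h1 h2
  have hcov : ∀ᵐ x ∂lam, ∃ k, x ∈ C k := by
    filter_upwards [hap] with x hx
    set Fs : Set ℝ := (fun j => e ((⇑T)^[j] x)) '' {j | 1 ≤ j ∧ j < n} with hFs
    have hfin : Fs.Finite := Set.Finite.image _ ((Set.finite_lt_nat n).subset fun j hj => hj.2)
    have hmem : Fsᶜ ∈ nhds (e x) := by
      apply hfin.isClosed.isOpen_compl.mem_nhds
      rintro ⟨j, hj, hje⟩
      exact hx j hj.1 (he.injective hje)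
    obtain ⟨l, r, hlr, hsub⟩ := mem_nhds_iff_exists_Ioo_subset.1 hmem
    obtain ⟨p, hp1, hp2⟩ := exists_rat_btwn hlr.1
    obtain ⟨q, hq1, hq2⟩ := exists_rat_btwn hlr.2
    obtain ⟨k, hk⟩ := hu (p, q)
    refine ⟨k, ?_, ?_⟩
    · simp only [hV, hk]; exact ⟨hp2, hq1⟩
    · simp only [mem_iInter]
      intro j h1 h2 hmem2
      have hmem3 : e ((⇑T)^[j] x) ∈ Ioo (p:ℝ) (q:ℝ) := by
        have : (⇑T)^[j] x ∈ V k := hmem2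
        simp only [hV, hk] at this
        exact this
      exact hsub ⟨hp1.trans hmem3.1, hmem3.2.trans hq2⟩ ⟨j, ⟨h1, h2⟩, rfl⟩
  set Nb : Set X → Set X := fun B => ⋃ j : ℕ, ⋃ _ : j < n, ((⇑T)^[j]) ⁻¹' B ∪ ((⇑T.symm)^[j]) ⁻¹' B with hNb
  have hNbm : ∀ B, MeasurableSet B → MeasurableSet (Nb B) := fun B hB =>
    MeasurableSet.iUnion fun j => MeasurableSet.iUnion fun _ => (hTi j hB).union (hTi' j hB)
  have hNbi : ∀ B x, x ∈ Nb B ↔ ∃ j < n, (⇑T)^[j] x ∈ B ∨ (⇑T.symm)^[j] x ∈ B := by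
    intro B x; simp [hNb]
  let Bs : ℕ → Set X := fun k => Nat.rec ∅ (fun k B => B ∪ (C k \ Nb B)) k
  have hBs : ∀ k, Bs (k+1) = Bs k ∪ (C k \ Nb (Bs k)) := fun k => rfl
  have hBm : ∀ k, MeasurableSet (Bs k) := fun k => by
    induction k with
    | zero => exact MeasurableSet.empty
    | succ k ih => rw [hBs]; exact ih.union ((hCm k).diff (hNbm _ ih))
  have hmono : Monotone Bs := monotone_nat_of_le_succ fun k => by rw [hBs]; exact subset_union_left
  have hsep : ∀ k, ∀ x ∈ Bs k, ∀ j, 1 ≤ j → j < n → (⇑T)^[j] x ∉ Bs k := fun k => by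
    induction k with
    | zero => intro x hx; exact absurd hx (notMem_empty x)
    | succ k ih =>
      rw [hBs]
      rintro x (hx | hx) j h1 h2 (hy | hy)
      · exact ih x hx j h1 h2 hy
      · exact hy.2 ((hNbi _ _).2 ⟨j, h2, Or.inr (by rwa [aux_iter'])⟩)
      · exact hx.2 ((hNbi _ _).2 ⟨j, h2, Or.inl hy⟩)
      · exact hCs k x hx.1 j h1 h2 hy.1.1
  refine ⟨⋃ k, Bs k, MeasurableSet.iUnion hBm, ?_, ?_⟩
  · intro x hx j h1 h2 hy
    obtain ⟨k, hk⟩ := mem_iUnion.1 hx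
    obtain ⟨l, hl⟩ := mem_iUnion.1 hy
    exact hsep (max k l) x (hmono (le_max_left _ _) hk) j h1 h2 (hmono (le_max_right _ _) hl)
  · filter_upwards [hcov] with x hx
    obtain ⟨k, hk⟩ := hx
    by_cases hxn : x ∈ Nb (Bs k)
    · obtain ⟨j, hj, h⟩ := (hNbi _ _).1 hxn
      exact ⟨j, hj, h.imp (fun h => mem_iUnion.2 ⟨k, h⟩) (fun h => mem_iUnion.2 ⟨k, h⟩)⟩
    · exact ⟨0, hn, Or.inl (mem_iUnion.2 ⟨k+1, by rw [hBs]; exact Or.inr ⟨hk, hxn⟩⟩)⟩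

lemma aux_marker_inf [MeasurableSpace X] [StandardBorelSpace X] (lam : Measure X)
    (hX : lam univ = ∞) (T : X ≃ᵐ X) (hT : MeasurePreserving (⇑T) lam lam)
    (hap : Aperiodic lam T) (n : ℕ) (hn : 0 < n) : ∃ B : Set X, MeasurableSet B ∧
      (∀ x ∈ B, ∀ j, 1 ≤ j → j < n → (⇑T)^[j] x ∉ B) ∧ lam B = ∞ := by
  obtain ⟨B, hB, hs, hc⟩ := aux_marker lam T hap n hn
  refine ⟨B, hB, hs, ?_⟩
  by_contra hfin
  have hT' : MeasurePreserving (⇑T.symm) lam lam := hT.symm T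
  have h1 : lam univ ≤ lam (⋃ j ∈ Finset.range n, ((⇑T)^[j]) ⁻¹' B ∪ ((⇑T.symm)^[j]) ⁻¹' B) := by
    apply measure_mono_ae
    filter_upwards [hc] with x hx _
    obtain ⟨j, hj, h⟩ := hx
    change x ∈ ⋃ j ∈ Finset.range n, ((⇑T)^[j]) ⁻¹' B ∪ ((⇑T.symm)^[j]) ⁻¹' B
    simp only [mem_iUnion]
    exact ⟨j, Finset.mem_range.2 hj, h⟩
  have h2 : lam (⋃ j ∈ Finset.range n, ((⇑T)^[j]) ⁻¹' B ∪ ((⇑T.symm)^[j]) ⁻¹' B) < ∞ := by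
    refine lt_of_le_of_lt (measure_biUnion_finset_le _ _) ?_
    apply ENNReal.sum_lt_top.2
    intro j _
    refine lt_of_le_of_lt (measure_union_le _ _) ?_
    rw [(hT.iterate j).measure_preimage hB.nullMeasurableSet,
      (hT'.iterate j).measure_preimage hB.nullMeasurableSet]
    exact ENNReal.add_lt_top.2 ⟨Ne.lt_top hfin, Ne.lt_top hfin⟩
  rw [hX] at h1
  exact absurd h2 (not_lt.2 h1)

lemma aux_base [MeasurableSpace X] [StandardBorelSpace X] (lam : Measure X)
    (T : X ≃ᵐ X) (hT : MeasurePreserving (⇑T) lam lam)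
    (hap : Aperiodic lam T) (μ : Measure X) [IsProbabilityMeasure μ] (ε : ℝ≥0∞) (hε : 0 < ε) :
    ∃ B : Set X, MeasurableSet B ∧ μ (T ⁻¹' B) < ε ∧ ∀ᵐ x ∂lam, ∃ i : ℕ, (⇑T.symm)^[i] x ∈ B := by
  obtain ⟨n, hn⟩ := ENNReal.exists_inv_nat_lt hε.ne'
  have hn0 : 0 < n := by
    rcases Nat.eq_zero_or_pos n with h | h
    · subst h; simp at hn
    · exact h
  obtain ⟨B, hB, hs, hc⟩ := aux_marker lam T hap n hn0
  have hT' : MeasurePreserving (⇑T.symm) lam lam := hT.symm T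
  have hTi' : ∀ j, Measurable ((⇑T.symm)^[j]) := fun j => T.symm.measurable.iterate j
  obtain ⟨i, hi, hμ⟩ : ∃ i < n, μ ((⇑T.symm)^[i] ⁻¹' B) < ε := by
    by_contra! h
    have hlt : ∀ i j, i < j → j < n → Disjoint ((⇑T.symm)^[i] ⁻¹' B) ((⇑T.symm)^[j] ⁻¹' B) := by
      intro i j hij hj
      rw [Set.disjoint_left]
      intro x hx hy
      refine hs _ hy (j - i) (by omega) (by omega) ?_
      rw [aux_iter_sub T _ _ (by omega)]
      have : j - (j - i) = i := by omega
      rw [this]; exact hx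
    have hdis : (↑(Finset.range n) : Set ℕ).PairwiseDisjoint (fun i => (⇑T.symm)^[i] ⁻¹' B) := by
      intro i hi j hj hij
      simp only [Finset.coe_range, mem_Iio] at hi hj
      rcases lt_or_gt_of_ne hij with h | h
      · exact hlt i j h hj
      · exact (hlt j i h hi).symm
    have h1 := measure_biUnion_finset (μ := μ) hdis (fun i _ => hTi' i hB)
    have h2 : ∑ i ∈ Finset.range n, ε ≤ 1 :=
      (Finset.sum_le_sum fun i hi => h i (Finset.mem_range.1 hi)).trans (h1.symm.le.trans prob_le_one)
    simp only [Finset.sum_const, Finset.card_range, nsmul_eq_mul] at h2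
    have h3 : ε ≤ (n : ℝ≥0∞)⁻¹ := by
      rw [ENNReal.le_inv_iff_mul_le, mul_comm]; exact h2
    exact absurd hn (not_lt.2 h3)
  refine ⟨(⇑T.symm)^[i+1] ⁻¹' B, hTi' _ hB, ?_, ?_⟩
  · have : T ⁻¹' ((⇑T.symm)^[i+1] ⁻¹' B) = (⇑T.symm)^[i] ⁻¹' B := by
      ext x; simp
    rwa [this]
  · have := (hT'.iterate (n + i + 1)).quasiMeasurePreserving.ae hc
    filter_upwards [this] with x hx
    obtain ⟨j, hj, h | h⟩ := hx
    · refine ⟨n - j, ?_⟩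
      rw [mem_preimage, ← Function.iterate_add_apply]
      rw [aux_iter_sub T _ _ (by omega)] at h
      convert h using 3
      omega
    · refine ⟨n + j, ?_⟩
      rw [mem_preimage, ← Function.iterate_add_apply]
      rw [← Function.iterate_add_apply] at h
      have he : i + 1 + (n + j) = j + (n + i + 1) := by omega
      rwa [he]

lemma aux_img [MeasurableSpace X] (lam : Measure X) (T : X ≃ᵐ X)
    (hT : MeasurePreserving (⇑T) lam lam) (i : ℕ) (F : Set X) (hF : MeasurableSet F) :
    MeasurableSet ((⇑T)^[i] '' F) ∧ lam ((⇑T)^[i] '' F) = lam F := by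
  have h : (⇑T)^[i] '' F = (⇑T.symm)^[i] ⁻¹' F :=
    congrFun (Set.image_eq_preimage_of_inverse (aux_iter' T i) (aux_iter T i)) F
  rw [h]
  exact ⟨T.symm.measurable.iterate i hF,
    ((hT.symm T).iterate i).measure_preimage hF.nullMeasurableSet⟩

lemma aux_glue [MeasurableSpace X] [StandardBorelSpace X] (lam : Measure X) {ι : Type*} [Countable ι]
    [Nonempty ι] (D : ι → Set X) (g : ι → X → X) (hD : ∀ i, MeasurableSet (D i))
    (hg : ∀ i, Measurable (g i)) (hdis : Pairwise (Function.onFun Disjoint D))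
    (hinj : ∀ i, InjOn (g i) (D i)) (hdis' : Pairwise (Function.onFun Disjoint fun i => g i '' D i))
    (hp : ∀ i, ∀ E ⊆ D i, MeasurableSet E → lam (g i '' E) = lam E) :
    ∃ R : X → X, Measurable R ∧ (∀ i, EqOn R (g i) (D i)) ∧ InjOn R (⋃ i, D i) ∧
      ∀ E ⊆ ⋃ i, D i, MeasurableSet E → lam (R '' E) = lam E := by
  obtain ⟨R, hR, hRe⟩ := exists_measurable_piecewise D hD g hg (fun i j hij x hx =>
    absurd hx.2 (Set.disjoint_left.1 (hdis hij) hx.1))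
  refine ⟨R, hR, hRe, ?_, ?_⟩
  · intro x hx y hy hxy
    obtain ⟨i, hi⟩ := mem_iUnion.1 hx
    obtain ⟨j, hj⟩ := mem_iUnion.1 hy
    rw [hRe i hi, hRe j hj] at hxy
    by_cases hij : i = j
    · subst hij; exact hinj i hi hj hxy
    · exact absurd ⟨y, hj, hxy.symm⟩ (Set.disjoint_left.1 (hdis' hij) ⟨x, hi, rfl⟩)
  · intro E hE hEm
    have h1 : E = ⋃ i, E ∩ D i := by rw [← inter_iUnion, inter_eq_left.2 hE]
    have h2 : R '' E = ⋃ i, g i '' (E ∩ D i) := by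
      conv_lhs => rw [h1]
      rw [image_iUnion]
      exact iUnion_congr fun i => ((hRe i).mono inter_subset_right).image_eq
    rw [h2, measure_iUnion, tsum_congr fun i => hp i _ inter_subset_right (hEm.inter (hD i)),
      ← measure_iUnion, ← h1]
    · intro i j hij
      exact (hdis hij).mono inter_subset_right inter_subset_right
    · exact fun i => hEm.inter (hD i)
    · intro i j hij
      exact (hdis' hij).mono (image_mono inter_subset_right) (image_mono inter_subset_right)
    · exact fun i => (hEm.inter (hD i)).image_of_measurable_injOn (hg i)
        ((hinj i).mono inter_subset_right)

theorem mu_approximate_conjugacy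
    [MeasurableSpace X] [StandardBorelSpace X]
    (lam : Measure X) [SigmaFinite lam] [NullSingletonClass lam] (hX : lam univ = ∞)
    (T₁ T₂ : X ≃ᵐ X)
    (hT₁ : MeasurePreserving (⇑T₁) lam lam) (hT₂ : MeasurePreserving (⇑T₂) lam lam)
    (hap₁ : Aperiodic lam T₁) (hap₂ : Aperiodic lam T₂)
    (μ : Measure X) [IsProbabilityMeasure μ]
    (hequiv₁ : μ ≪ lam) (hequiv₂ : lam ≪ μ) :
    ∀ ε : ℝ≥0∞, 0 < ε → ∃ S : X ≃ᵐ X, MeasurePreserving (⇑S) lam lam ∧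
      μ {x | S (T₁ (S.symm x)) ≠ T₂ x} < ε := by
  intro ε hε
  have hη : 0 < ε / 3 := ENNReal.div_pos hε.ne' (by norm_num)
  set η := ε / 3 with hηd
  have hne : Nonempty X := by
    by_contra h
    have : IsEmpty X := not_nonempty_iff.1 h
    rw [univ_eq_empty_iff.2 this, measure_empty] at hX
    exact ENNReal.zero_ne_top hX
  have hT₂' : MeasurePreserving (⇑T₂.symm) lam lam := hT₂.symm T₂
  have hTi₂ : ∀ j, Measurable ((⇑T₂.symm)^[j]) := fun j => T₂.symm.measurable.iterate j
  have hTi₁ : ∀ j, Measurable ((⇑T₁)^[j]) := fun j => T₁.measurable.iterate j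
  obtain ⟨B, hB, hBμ, hBc⟩ := aux_base lam T₂ hT₂ hap₂ μ η hη
  -- choice of the height
  obtain ⟨m, hm⟩ : ∃ m : ℕ, μ (⋂ i ∈ Finset.range m, (⇑T₂.symm)^[i] ⁻¹' Bᶜ) < η := by
    have ht : Filter.Tendsto (fun m : ℕ => μ (⋂ i ∈ Finset.range m, (⇑T₂.symm)^[i] ⁻¹' Bᶜ))
        Filter.atTop (nhds (μ (⋂ m : ℕ, ⋂ i ∈ Finset.range m, (⇑T₂.symm)^[i] ⁻¹' Bᶜ))) := by
      apply tendsto_measure_iInter_atTop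
      · intro m
        exact (Finset.measurableSet_biInter _ fun i _ => hTi₂ i hB.compl).nullMeasurableSet
      · intro a b hab x hx
        simp only [mem_iInter, Finset.mem_range] at hx ⊢
        exact fun i hi => hx i (hi.trans_le hab)
      · exact ⟨0, measure_ne_top _ _⟩
    have h0 : μ (⋂ m : ℕ, ⋂ i ∈ Finset.range m, (⇑T₂.symm)^[i] ⁻¹' Bᶜ) = 0 := by
      apply hequiv₁
      refine measure_mono_null ?_ hBc
      intro x hx
      simp only [mem_iInter, Finset.mem_range] at hx
      rintro ⟨i, hi⟩
      exact hx (i+1) i (Nat.lt_succ_self i) hi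
    rw [h0] at ht
    exact (ht.eventually (gt_mem_nhds hη)).exists
  obtain ⟨k, hk⟩ : ∃ k : ℕ,
      μ (⋃ i ∈ Finset.range m, (⇑T₂.symm)^[i] ⁻¹' (B \ spanningSets lam k)) < η := by
    have ht : Filter.Tendsto
        (fun k : ℕ => μ (⋃ i ∈ Finset.range m, (⇑T₂.symm)^[i] ⁻¹' (B \ spanningSets lam k)))
        Filter.atTop (nhds (μ (⋂ k : ℕ, ⋃ i ∈ Finset.range m,
          (⇑T₂.symm)^[i] ⁻¹' (B \ spanningSets lam k)))) := by
      apply tendsto_measure_iInter_atTop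
      · intro k
        exact (Finset.measurableSet_biUnion _ fun i _ => hTi₂ i
          (hB.diff (measurableSet_spanningSets lam k))).nullMeasurableSet
      · intro a b hab
        apply iUnion₂_mono
        intro i _ x hx
        exact ⟨hx.1, fun h => hx.2 (monotone_spanningSets lam hab h)⟩
      · exact ⟨0, measure_ne_top _ _⟩
    have h0 : (⋂ k : ℕ, ⋃ i ∈ Finset.range m,
          (⇑T₂.symm)^[i] ⁻¹' (B \ spanningSets lam k)) = ∅ := by
      rw [eq_empty_iff_forall_notMem]
      intro x hx
      simp only [mem_iInter, mem_iUnion] at hx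
      obtain ⟨i, hi, hx2⟩ := hx ((Finset.range m).sup fun i => spanningSetsIndex lam ((⇑T₂.symm)^[i] x))
      apply hx2.2
      apply mem_spanningSets_of_index_le
      exact Finset.le_sup (f := fun i => spanningSetsIndex lam ((⇑T₂.symm)^[i] x)) hi
    rw [h0, measure_empty] at ht
    exact (ht.eventually (gt_mem_nhds hη)).exists
  set B₀ := B ∩ spanningSets lam k with hB₀
  have hB₀m : MeasurableSet B₀ := hB.inter (measurableSet_spanningSets lam k)
  have hB₀f : lam B₀ < ∞ :=
    lt_of_le_of_lt (measure_mono inter_subset_right) (measure_spanningSets_lt_top lam k)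
  obtain ⟨C, hC, hCs, hCi⟩ := aux_marker_inf lam hX T₁ hT₁ hap₁ (m+1) (Nat.succ_pos m)
  obtain ⟨B', hB'C, hB', hB'e⟩ := aux_subset lam C hC hCi (lam B₀) hB₀f.ne
  obtain ⟨ψ, G, hψ, hG, hGB₀, hG0, hψi, hψB', -, hψp⟩ := aux_B lam B₀ B' hB₀m hB' hB'e.symm
  have hGB : G ⊆ B := hGB₀.trans inter_subset_left
  set L : ℕ → Set X := fun i => (⇑T₂.symm)^[i] ⁻¹' G ∩ ⋂ j ∈ Finset.range i, (⇑T₂.symm)^[j] ⁻¹' Bᶜ with hL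
  have hLi : ∀ i x, x ∈ L i ↔ (⇑T₂.symm)^[i] x ∈ G ∧ ∀ j < i, (⇑T₂.symm)^[j] x ∉ B := by
    intro i x; simp [hL]
  have hLm : ∀ i, MeasurableSet (L i) := fun i =>
    (hTi₂ i hG).inter (Finset.measurableSet_biInter _ fun j _ => hTi₂ j hB.compl)
  set g : ℕ → X → X := fun i => (⇑T₁)^[i] ∘ ψ ∘ (⇑T₂.symm)^[i] with hgd
  have hgm : ∀ i, Measurable (g i) := fun i => (hTi₁ i).comp (hψ.comp (hTi₂ i))
  have hginj : ∀ i, InjOn (g i) (L i) := by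
    intro i x hx y hy hxy
    have h1 := T₁.injective.iterate i hxy
    have h2 := hψi ((hLi _ _).1 hx).1 ((hLi _ _).1 hy).1 h1
    exact T₂.symm.injective.iterate i h2
  have hgp : ∀ i, ∀ E ⊆ L i, MeasurableSet E → lam (g i '' E) = lam E := by
    intro i E hE hEm
    have h1 := aux_img lam T₂.symm hT₂' i E hEm
    have h2 : (⇑T₂.symm)^[i] '' E ⊆ G := by
      rintro _ ⟨x, hx, rfl⟩; exact ((hLi _ _).1 (hE hx)).1
    have h3 : MeasurableSet (ψ '' ((⇑T₂.symm)^[i] '' E)) :=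
      h1.1.image_of_measurable_injOn hψ (hψi.mono h2)
    have h4 := aux_img lam T₁ hT₁ i _ h3
    rw [hgd]
    simp only [image_comp]
    rw [h4.2, hψp _ h2 h1.1, h1.2]
  have hLdis : ∀ i j, i < j → Disjoint (L i) (L j) := by
    intro i j hij
    rw [Set.disjoint_left]
    intro x hx hy
    exact ((hLi _ _).1 hy).2 i hij (hGB ((hLi _ _).1 hx).1)
  have hgdis : ∀ i j, i < j → j < m + 1 → Disjoint (g i '' L i) (g j '' L j) := by
    intro i j hij hj
    rw [Set.disjoint_left]
    rintro _ ⟨x, hx, rfl⟩ ⟨y, hy, hxy⟩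
    have hbx : ψ ((⇑T₂.symm)^[i] x) ∈ C := hB'C (hψB' ⟨_, ((hLi _ _).1 hx).1, rfl⟩)
    have hby : ψ ((⇑T₂.symm)^[j] y) ∈ C := hB'C (hψB' ⟨_, ((hLi _ _).1 hy).1, rfl⟩)
    refine hCs _ hby (j - i) (by omega) (by omega) ?_
    have : (⇑T₁)^[j - i] (ψ ((⇑T₂.symm)^[j] y)) = ψ ((⇑T₂.symm)^[i] x) := by
      apply T₁.injective.iterate i
      rw [← Function.iterate_add_apply]
      have : i + (j - i) = j := by omega
      rw [this]
      exact hxy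
    rwa [this]
  have hLf : ∀ i, lam (L i) < ∞ := fun i => by
    refine lt_of_le_of_lt (measure_mono inter_subset_left) ?_
    rw [(hT₂'.iterate i).measure_preimage hG.nullMeasurableSet]
    exact lt_of_le_of_lt (measure_mono hGB₀) hB₀f
  set A : Set X := ⋃ i : Fin (m+1), L i with hA
  set A' : Set X := ⋃ i : Fin (m+1), g i '' L i with hA'
  have hAm : MeasurableSet A := MeasurableSet.iUnion fun i => hLm i
  have hA'm : MeasurableSet A' := MeasurableSet.iUnion fun i =>
    (hLm i).image_of_measurable_injOn (hgm i) (hginj i)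
  have hcompl : ∀ Z, MeasurableSet Z → lam Z < ∞ → lam Zᶜ = ∞ := by
    intro Z hZ hZf
    have := measure_add_measure_compl (μ := lam) hZ
    rw [hX] at this
    by_contra h
    exact (ENNReal.add_lt_top.2 ⟨hZf, Ne.lt_top h⟩).ne this
  have hAf : lam A < ∞ := by
    refine lt_of_le_of_lt (measure_iUnion_fintype_le _ _) ?_
    exact ENNReal.sum_lt_top.2 fun i _ => hLf i
  have hA'f : lam A' < ∞ := by
    refine lt_of_le_of_lt (measure_iUnion_fintype_le _ _) ?_
    exact ENNReal.sum_lt_top.2 fun i _ => by rw [hgp _ _ subset_rfl (hLm i)]; exact hLf i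
  obtain ⟨ψ', G', hψ', hG', hG'A, hG'0, hψ'i, hψ'A, hψ'0, hψ'p⟩ := aux_B lam Aᶜ A'ᶜ hAm.compl hA'm.compl
    ((hcompl A hAm hAf).trans (hcompl A' hA'm hA'f).symm)
  obtain ⟨R, hR, hRe, hRi, hRp⟩ := aux_glue lam (ι := Option (Fin (m+1)))
    (fun o => o.elim G' (fun i => L i)) (fun o => o.elim ψ' (fun i => g i))
    (by rintro (_ | i); exacts [hG', hLm i])
    (by rintro (_ | i); exacts [hψ', hgm i])
    (by
      rintro (_ | i) (_ | j) hij
      · exact absurd rfl hij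
      · exact Set.disjoint_left.2 fun x hx hy => hG'A hx (mem_iUnion.2 ⟨j, hy⟩)
      · exact Set.disjoint_left.2 fun x hx hy => hG'A hy (mem_iUnion.2 ⟨i, hx⟩)
      · have hne : (i : ℕ) ≠ j := fun h => hij (congrArg some (Fin.ext h))
        rcases lt_or_gt_of_ne hne with h | h
        · exact hLdis i j h
        · exact (hLdis j i h).symm)
    (by rintro (_ | i); exacts [hψ'i, hginj i])
    (by
      rintro (_ | i) (_ | j) hij
      · exact absurd rfl hij
      · exact Set.disjoint_left.2 fun x hx hy => hψ'A hx (mem_iUnion.2 ⟨j, hy⟩)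
      · exact Set.disjoint_left.2 fun x hx hy => hψ'A hy (mem_iUnion.2 ⟨i, hx⟩)
      · have hne : (i : ℕ) ≠ j := fun h => hij (congrArg some (Fin.ext h))
        rcases lt_or_gt_of_ne hne with h | h
        · exact hgdis i j h j.2
        · exact (hgdis j i h i.2).symm)
    (by rintro (_ | i); exacts [hψ'p, hgp i])
  set D : Set X := ⋃ o : Option (Fin (m+1)), o.elim G' (fun i => L i) with hD
  have hDm : MeasurableSet D := MeasurableSet.iUnion (by rintro (_ | i); exacts [hG', hLm i])
  have hRL : ∀ i < m + 1, ∀ x ∈ L i, R x = g i x := fun i hi x hx => hRe (some ⟨i, hi⟩) hx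
  obtain ⟨S, hS, hSR⟩ := aux_C lam hX R D hR hDm
    (by
      refine measure_mono_null ?_ hG'0
      intro x hx
      refine ⟨fun hxA => ?_, fun hxG => hx (mem_iUnion.2 ⟨none, hxG⟩)⟩
      obtain ⟨i, hi⟩ := mem_iUnion.1 hxA
      exact hx (mem_iUnion.2 ⟨some i, hi⟩))
    hRi
    (by
      refine measure_mono_null ?_ hψ'0
      intro x hx
      refine ⟨fun hxA => ?_, ?_⟩
      · obtain ⟨i, y, hy, rfl⟩ := mem_iUnion.1 hxA
        exact hx ⟨y, mem_iUnion.2 ⟨some i, hy⟩, hRe (some i) hy⟩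
      · rintro ⟨y, hy, rfl⟩
        exact hx ⟨y, mem_iUnion.2 ⟨none, hy⟩, hRe none hy⟩)
    hRp
  refine ⟨S.symm, hS.symm S, ?_⟩
  have hSR2 : ∀ᵐ x ∂lam, S (T₂ x) = R (T₂ x) := hT₂.quasiMeasurePreserving.ae hSR
  have hG0' : ∀ᵐ x ∂lam, ∀ i : ℕ, (⇑T₂.symm)^[i] x ∉ B₀ \ G := by
    rw [ae_all_iff]
    intro i
    have h0 : ∀ᵐ x ∂lam, x ∉ B₀ \ G := measure_eq_zero_iff_ae_notMem.1 hG0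
    exact (hT₂'.iterate i).quasiMeasurePreserving.ae h0
  set W1 := ⋂ i ∈ Finset.range m, (⇑T₂.symm)^[i] ⁻¹' Bᶜ
  set W2 := ⋃ i ∈ Finset.range m, (⇑T₂.symm)^[i] ⁻¹' (B \ spanningSets lam k)
  have hsub : μ {x | S.symm (T₁ (S.symm.symm x)) ≠ T₂ x} ≤ μ (T₂ ⁻¹' B ∪ W1 ∪ W2) := by
    apply measure_mono_ae
    filter_upwards [hequiv₁.ae_le hSR, hequiv₁.ae_le hSR2, hequiv₁.ae_le hG0'] with x h1 h2 h3 hx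
    change x ∈ T₂ ⁻¹' B ∪ W1 ∪ W2
    by_contra hnot
    have hn1 : T₂ x ∉ B := fun h => hnot (Or.inl (Or.inl h))
    have hn2 : x ∉ W1 := fun h => hnot (Or.inl (Or.inr h))
    have hn3 : x ∉ W2 := fun h => hnot (Or.inr h)
    simp only [W1, mem_iInter, Finset.mem_range, not_forall, mem_preimage, mem_compl_iff, not_not] at hn2
    obtain ⟨i₀, hi₀, hi₀B⟩ := hn2
    classical
    have hex : ∃ i, (⇑T₂.symm)^[i] x ∈ B := ⟨i₀, hi₀B⟩
    set i := Nat.find hex with hi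
    have hiB : (⇑T₂.symm)^[i] x ∈ B := Nat.find_spec hex
    have him : i < m := (Nat.find_min' hex hi₀B).trans_lt hi₀
    have himin : ∀ j < i, (⇑T₂.symm)^[j] x ∉ B := fun j hj => Nat.find_min hex hj
    have hisp : (⇑T₂.symm)^[i] x ∈ spanningSets lam k := by
      by_contra h
      apply hn3
      simp only [W2, mem_iUnion]
      exact ⟨i, Finset.mem_range.2 him, hiB, h⟩
    have hiG : (⇑T₂.symm)^[i] x ∈ G := by
      by_contra h
      exact h3 i ⟨⟨hiB, hisp⟩, h⟩
    have hxL : x ∈ L i := (hLi _ _).2 ⟨hiG, himin⟩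
    have hTxL : T₂ x ∈ L (i+1) := by
      refine (hLi _ _).2 ⟨by simpa using hiG, ?_⟩
      intro j hj
      cases j with
      | zero => exact hn1
      | succ j => simpa using himin j (by omega)
    have e1 : R x = g i x := hRL i (by omega) x hxL
    have e2 : R (T₂ x) = g (i+1) (T₂ x) := hRL (i+1) (by omega) _ hTxL
    have e3 : g (i+1) (T₂ x) = T₁ (g i x) := by
      simp only [hgd, Function.comp_apply, Function.iterate_succ_apply', Function.iterate_succ_apply (⇑T₂.symm),
        MeasurableEquiv.symm_apply_apply]
      rw [← Function.iterate_succ_apply' (⇑T₂.symm), Function.iterate_succ_apply]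
      simp
    apply hx
    change S.symm (T₁ (S x)) = T₂ x
    rw [MeasurableEquiv.symm_apply_eq, h2, e2, e3, ← e1]
    exact congrArg T₁ h1
  calc _ ≤ μ (T₂ ⁻¹' B ∪ W1 ∪ W2) := hsub
    _ ≤ μ (T₂ ⁻¹' B) + μ W1 + μ W2 := (measure_union_le _ _).trans (add_le_add_left (measure_union_le _ _) _)
    _ < η + η + η := ENNReal.add_lt_add (ENNReal.add_lt_add hBμ hm) hk
    _ = ε := ENNReal.add_thirds ε
end
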